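/- Suppose h_X < h_ν(σ) − h_{π_{2*}ν}(σ_2). Then ν is Q-regular, and with probability 1, conditional on Q·ν ≠ 0, π_{2*}(Q·ν) is absolutely continuous with respect to π_{2*}ν, and Q·ν is exact-dimensional with respect to the metric d_{(b_1,b_2)}, with dim(Q·ν) = (1/log b_1)(h_ν(σ) − h_X) + (1/log b_2 − 1/log b_1) h_{π_{2*}ν}(σ_2). -/

import Mathlib

open MeasureTheory ProbabilityTheory Filter Set
open scoped ENNReal

noncomputable section

/-- The one-sided sequence space over an alphabet `A`. -/
abbrev SeqSpace (A : Type*) : Type _ := ℕ → A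

/-- The cylinder `[w]` of sequences starting with the finite word `w`. -/
def cylinderA {A : Type*} (w : List A) : Set (SeqSpace A) :=
  {x | ∀ i : Fin w.length, x i = w.get i}

/-- The prefix `x|_n` of `x` of length `n`, as a finite word. -/
def wordPrefixA {A : Type*} (x : SeqSpace A) (n : ℕ) : List A :=
  List.ofFn (fun i : Fin n => x i)

/-- `Y_w = X_{w_1} X_{w_1w_2} ⋯ X_{w_1⋯w_n}`. -/
def cascadeYA {A : Type*} {Ω : Type*} (X : List A → Ω → ℝ) (w : List A) (ω : Ω) : ℝ :=
  ∏ k ∈ Finset.range w.length, X (w.take (k + 1)) ω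

/-- The total mass `Z_n = ∑_{|u| = n} Y_u ν([u])`. -/
def cascadeZA {A : Type*} [Fintype A] [MeasurableSpace A] {Ω : Type*}
    (X : List A → Ω → ℝ) (ν : Measure (SeqSpace A)) (n : ℕ) (ω : Ω) : ℝ :=
  ∑ u : Fin n → A, cascadeYA X (List.ofFn u) ω * (ν (cylinderA (List.ofFn u))).toReal

/-- The left shift. -/
def shiftA (A : Type*) : SeqSpace A → SeqSpace A := fun x n => x (n + 1)

/-- The entropy sums `n⁻¹ ∑_{|u| = n} −ν([u]) log ν([u])`, whose limit is the
measure-theoretic entropy. -/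
def entropySeqA {A : Type*} [Fintype A] [MeasurableSpace A] (ν : Measure (SeqSpace A))
    (n : ℕ) : ℝ :=
  (n : ℝ)⁻¹ * ∑ u : Fin n → A,
    -((ν (cylinderA (List.ofFn u))).toReal * Real.log ((ν (cylinderA (List.ofFn u))).toReal))

/-- Assumption (M1): the weights `X_u`, `u` a nonempty finite word, are i.i.d. with common
law that of the nonnegative random variable `X₀` of expectation 1. -/
structure CascadeM1A {A : Type*} [MeasurableSpace A] {Ω : Type*} [MeasurableSpace Ω]
    (P : Measure Ω) (X : List A → Ω → ℝ) (X₀ : Ω → ℝ) : Prop where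
  meas : ∀ w, Measurable (X w)
  nonneg : ∀ w ω, 0 ≤ X w ω
  meas₀ : Measurable X₀
  nonneg₀ : ∀ ω, 0 ≤ X₀ ω
  mean₀ : ∫ ω, X₀ ω ∂P = 1
  indep : iIndepFun (fun w : {w : List A // w ≠ []} => X w.1) P
  ident : ∀ w : List A, w ≠ [] → IdentDistrib (X w) X₀ P P

/-- `h_X = E(X log X) ∈ [0, ∞]`, as an extended nonnegative real. -/
def entropyXA {Ω : Type*} [MeasurableSpace Ω] (P : Measure Ω) (X₀ : Ω → ℝ) : ℝ≥0∞ :=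
  (∫⁻ ω, ENNReal.ofReal (X₀ ω * Real.log (X₀ ω)) ∂P) -
    (∫⁻ ω, ENNReal.ofReal (-(X₀ ω * Real.log (X₀ ω))) ∂P)

/-- The canonical projection `π₂` from `Λ₁^{ℤ₊} × Λ₂^{ℤ₊}` (seen as the sequence space over
`Λ₁ × Λ₂`) onto `Λ₂^{ℤ₊}`. -/
def projSnd {b₁ b₂ : ℕ} : SeqSpace (Fin b₁ × Fin b₂) → SeqSpace (Fin b₂) :=
  fun x n => (x n).2

/-- The metric `d_{(b₁,b₂)}((x,y),(x',y')) = max(b₁^{−inf{n : xₙ ≠ x'ₙ}},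
b₂^{−inf{n : yₙ ≠ y'ₙ}})` on the product symbolic space, with values in `[0,∞)`
(encoded in `ℝ≥0∞`, the suprema expressing the negative powers of first disagreement). -/
def distBM (b₁ b₂ : ℕ) (z z' : SeqSpace (Fin b₁ × Fin b₂)) : ℝ≥0∞ :=
  ⨆ n : ℕ, max (if (z n).1 ≠ (z' n).1 then ((b₁ : ℝ≥0∞))⁻¹ ^ n else 0)
    (if (z n).2 ≠ (z' n).2 then ((b₂ : ℝ≥0∞))⁻¹ ^ n else 0)

/-- The ball of radius `ρ` centred at `z` for the metric `d_{(b₁,b₂)}`. -/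
def ballBM (b₁ b₂ : ℕ) (z : SeqSpace (Fin b₁ × Fin b₂)) (ρ : ℝ) :
    Set (SeqSpace (Fin b₁ × Fin b₂)) :=
  {z' | distBM b₁ b₂ z z' < ENNReal.ofReal ρ}

set_option linter.unusedSectionVars false

noncomputable section

/-- Running maxima of Birkhoff sums. -/
def birkMax {α : Type*} (T : α → α) (f : α → ℝ) : ℕ → α → ℝ
  | 0 => f
  | (n + 1) => fun x => f x + max 0 (birkMax T f n (T x))

lemma birkMax_mono_succ {α : Type*} (T : α → α) (f : α → ℝ) (n : ℕ) (x : α) :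
    birkMax T f n x ≤ birkMax T f (n + 1) x := by
  induction n generalizing x with
  | zero => simp [birkMax]
  | succ n ih =>
    have := ih (T x)
    simp only [birkMax] at *
    gcongr

lemma birkMax_mono {α : Type*} (T : α → α) (f : α → ℝ) (x : α) :
    Monotone (fun n => birkMax T f n x) :=
  monotone_nat_of_le_succ (fun n => birkMax_mono_succ T f n x)

lemma birkSum_le_birkMax {α : Type*} (T : α → α) (f : α → ℝ) (n : ℕ) (x : α) :
    ∑ i ∈ Finset.range (n + 1), f (T^[i] x) ≤ birkMax T f n x := by
  induction n generalizing x with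
  | zero => simp [birkMax]
  | succ n ih =>
    rw [Finset.sum_range_succ']
    have := ih (T x)
    simp only [Function.iterate_succ, Function.comp, Function.iterate_zero, id] at *
    simp only [birkMax]
    have h2 := le_max_right 0 (birkMax T f n (T x))
    linarith

lemma birkMax_measurable {α : Type*} [MeasurableSpace α] {T : α → α} (hT : Measurable T)
    {f : α → ℝ} (hf : Measurable f) (n : ℕ) : Measurable (birkMax T f n) := by
  induction n with
  | zero => exact hf
  | succ n ih =>
    simp only [birkMax]
    exact hf.add (measurable_const.max (ih.comp hT))

lemma birkMax_integrable {α : Type*} [MeasurableSpace α] {μ : Measure α} {T : α → α}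
    (hT : MeasurePreserving T μ μ) {f : α → ℝ} (hf : Integrable f μ) (n : ℕ) :
    Integrable (birkMax T f n) μ := by
  induction n with
  | zero => exact hf
  | succ n ih =>
    simp only [birkMax]
    refine hf.add ?_
    have := (hT.integrable_comp_of_integrable ih).pos_part
    refine this.congr (Eventually.of_forall fun x => ?_)
    simp [max_comm]

lemma birkhoff_bdd {α : Type*} [MeasurableSpace α] {μ : Measure α} [IsProbabilityMeasure μ]
    {T : α → α} (hT : Ergodic T μ) {f : α → ℝ} (hfm : Measurable f) (hf : Integrable f μ)
    (hneg : ∫ x, f x ∂μ < 0) :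
    ∀ᵐ x ∂μ, ∃ C : ℝ, ∀ n : ℕ, ∑ i ∈ Finset.range n, f (T^[i] x) ≤ C := by
  have hTm := hT.toMeasurePreserving.measurable
  set A : Set α := {x | ∀ C : ℕ, ∃ n, (C : ℝ) < birkMax T f n x} with hA
  have hAm : MeasurableSet A := by
    have : A = ⋂ C : ℕ, ⋃ n, {x | (C : ℝ) < birkMax T f n x} := by
      ext x; simp [hA]
    rw [this]
    exact MeasurableSet.iInter fun C => MeasurableSet.iUnion fun n =>
      measurableSet_lt measurable_const (birkMax_measurable hTm hfm n)
  have hinv : T ⁻¹' A = A := by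
    ext x
    simp only [hA, mem_preimage, mem_ofPred_eq]
    constructor
    · intro h C
      obtain ⟨C', hC'⟩ := exists_nat_gt ((C : ℝ) - f x)
      obtain ⟨n, hn⟩ := h C'
      refine ⟨n + 1, ?_⟩
      simp only [birkMax]
      have h2 := le_max_right 0 (birkMax T f n (T x))
      linarith
    · intro h C
      obtain ⟨C', hC'⟩ := exists_nat_gt ((C : ℝ) + f x)
      obtain ⟨n, hn⟩ := h C'
      have h1 := hn.trans_le (birkMax_mono_succ T f n x)
      simp only [birkMax] at h1
      refine ⟨n, ?_⟩
      have h3 : (0 : ℝ) ≤ C := Nat.cast_nonneg C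
      rcases le_total 0 (birkMax T f n (T x)) with h | h
      · rw [max_eq_right h] at h1; linarith
      · rw [max_eq_left h] at h1; linarith
  rcases hT.toPreErgodic.measure_self_or_compl_eq_zero hAm hinv with h0 | h0
  · have : ∀ᵐ x ∂μ, x ∉ A := by
      rw [ae_iff]; simpa using h0
    filter_upwards [this] with x hx
    simp only [hA, mem_ofPred_eq, not_forall, not_exists, not_lt] at hx
    obtain ⟨C, hC⟩ := hx
    refine ⟨C, fun n => ?_⟩
    cases n with
    | zero => simp
    | succ n => exact (birkSum_le_birkMax T f n x).trans (hC n)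
  · exfalso
    have hAae : ∀ᵐ x ∂μ, x ∈ A := by rw [ae_iff]; exact h0
    have hlim : Tendsto (fun n => ∫ x, (birkMax T f (n + 1) x - birkMax T f n (T x)) ∂μ) atTop
        (nhds (∫ x, f x ∂μ)) := by
      refine tendsto_integral_of_dominated_convergence (fun x => |f x| + |f (T x)|) ?_ ?_ ?_ ?_
      · intro n
        exact ((birkMax_measurable hTm hfm _).sub
          ((birkMax_measurable hTm hfm n).comp hTm)).aestronglyMeasurable
      · exact hf.abs.add (hT.toMeasurePreserving.integrable_comp_of_integrable hf.abs)
      · intro n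
        refine Eventually.of_forall fun x => ?_
        simp only [birkMax, Real.norm_eq_abs]
        have h1 : f (T x) ≤ birkMax T f n (T x) := birkMax_mono T f (T x) (Nat.zero_le n)
        have h2 := neg_abs_le (f (T x))
        have h3 := neg_abs_le (f x)
        have h4 := le_abs_self (f x)
        have h5 := abs_nonneg (f (T x))
        rcases le_total 0 (birkMax T f n (T x)) with h | h
        · rw [max_eq_right h, abs_le]; constructor <;> linarith
        · rw [max_eq_left h, abs_le]; constructor <;> linarith
      · filter_upwards [hAae] with x hx
        have hx' : T x ∈ A := by
          rw [← mem_preimage, hinv]; exact hx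
        obtain ⟨n, hn⟩ := hx' 0
        refine tendsto_const_nhds.congr' ?_
        filter_upwards [eventually_ge_atTop n] with k hk
        have h1 : (0 : ℝ) ≤ birkMax T f k (T x) := by
          have := birkMax_mono T f (T x) hk
          simp only [Nat.cast_zero] at hn
          exact hn.le.trans this
        simp only [birkMax]
        rw [max_eq_right h1]; ring
    have hnn : ∀ n, 0 ≤ ∫ x, (birkMax T f (n + 1) x - birkMax T f n (T x)) ∂μ := by
      intro n
      have hmp := hT.toMeasurePreserving
      have hi2 : Integrable (fun x => birkMax T f n (T x)) μ :=
        hmp.integrable_comp_of_integrable (birkMax_integrable hmp hf n)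
      rw [integral_sub (birkMax_integrable hmp hf _) hi2]
      have : ∫ x, birkMax T f n (T x) ∂μ = ∫ x, birkMax T f n x ∂μ := by
        have h := integral_map (μ := μ) hmp.measurable.aemeasurable
          (birkMax_measurable hTm hfm n).aestronglyMeasurable
        rw [hmp.map_eq] at h
        exact h.symm
      rw [this, sub_nonneg]
      exact integral_mono (birkMax_integrable hmp hf _) (birkMax_integrable hmp hf _)
        (fun x => birkMax_mono_succ T f n x)
    exact absurd (ge_of_tendsto' hlim hnn) (not_le.mpr hneg)

/-- Upper half of the pointwise ergodic theorem. -/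
lemma birkhoff_upper {α : Type*} [MeasurableSpace α] {μ : Measure α} [IsProbabilityMeasure μ]
    {T : α → α} (hT : Ergodic T μ) {f : α → ℝ} (hfm : Measurable f) (hf : Integrable f μ)
    {ε : ℝ} (hε : 0 < ε) :
    ∀ᵐ x ∂μ, ∀ᶠ n : ℕ in atTop,
      ∑ i ∈ Finset.range n, f (T^[i] x) ≤ n * (∫ x, f x ∂μ + ε) := by
  have h := birkhoff_bdd hT (f := fun x => f x - (∫ x, f x ∂μ + ε / 2))
    (hfm.sub_const _) (hf.sub (integrable_const _)) (by
      rw [integral_sub hf (integrable_const _)]; simp; linarith)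
  filter_upwards [h] with x hx
  obtain ⟨C, hC⟩ := hx
  obtain ⟨N, hN⟩ := exists_nat_gt (C / (ε / 2))
  filter_upwards [eventually_ge_atTop N] with n hn
  have h1 := hC n
  rw [Finset.sum_sub_distrib] at h1
  simp only [Finset.sum_const, Finset.card_range, nsmul_eq_mul] at h1
  have h2 : C < N * (ε / 2) := by rwa [div_lt_iff₀ (by positivity)] at hN
  have h3 : (N : ℝ) * (ε / 2) ≤ n * (ε / 2) := by gcongr
  nlinarith

/-- The pointwise ergodic theorem, in quantitative form. -/
theorem birkhoff_ae {α : Type*} [MeasurableSpace α] {μ : Measure α} [IsProbabilityMeasure μ]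
    {T : α → α} (hT : Ergodic T μ) {f : α → ℝ} (hfm : Measurable f) (hf : Integrable f μ)
    {ε : ℝ} (hε : 0 < ε) :
    ∀ᵐ x ∂μ, ∀ᶠ n : ℕ in atTop,
      |∑ i ∈ Finset.range n, f (T^[i] x) - n * ∫ x, f x ∂μ| ≤ n * ε := by
  filter_upwards [birkhoff_upper hT hfm hf hε, birkhoff_upper hT hfm.neg hf.neg hε] with x h1 h2
  filter_upwards [h1, h2] with n h1 h2
  simp only [Pi.neg_apply, Finset.sum_neg_distrib, integral_neg] at h2
  rw [abs_le]; constructor <;> nlinarith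
end

noncomputable section

/-- The first `n` letters. -/
def preA {A : Type*} (n : ℕ) (z : SeqSpace A) : Fin n → A := fun i => z i

/-- The cylinder of level `n` around `z`. -/
def cylA {A : Type*} (z : SeqSpace A) (n : ℕ) : Set (SeqSpace A) := {z' | ∀ i < n, z' i = z i}

lemma cylA_eq_pre {A : Type*} (z : SeqSpace A) (n : ℕ) : cylA z n = preA n ⁻¹' {preA n z} := by
  ext z'
  simp only [cylA, preA, mem_preimage, mem_singleton_iff, funext_iff, mem_ofPred_eq]
  exact ⟨fun h i => h i i.2, fun h i hi => h ⟨i, hi⟩⟩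

lemma cylinderA_ofFn {A : Type*} (n : ℕ) (u : Fin n → A) :
    cylinderA (List.ofFn u) = preA n ⁻¹' {u} := by
  ext z
  simp only [cylinderA, preA, mem_preimage, mem_singleton_iff, funext_iff, mem_ofPred_eq]
  constructor
  · intro h i
    have := h ⟨i, by simp⟩
    simpa using this
  · intro h i
    have := h ⟨i, by simpa using i.2⟩
    simpa using this

lemma cylinderA_wordPrefix {A : Type*} (z : SeqSpace A) (n : ℕ) :
    cylinderA (wordPrefixA z n) = cylA z n := by
  rw [wordPrefixA, cylinderA_ofFn, cylA_eq_pre]; rfl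

/-- Prepend a letter. -/
def consS {A : Type*} (a : A) (z : SeqSpace A) : SeqSpace A
  | 0 => a
  | (n + 1) => z n

/-- Prepend the first `k` letters of `w`. -/
def consN {A : Type*} : ℕ → SeqSpace A → SeqSpace A → SeqSpace A
  | 0, _, y => y
  | (k + 1), w, y => consS (w 0) (consN k (shiftA A w) y)

lemma shift_consS {A : Type*} (a : A) (z : SeqSpace A) : shiftA A (consS a z) = z := rfl

lemma consS_shift {A : Type*} (z : SeqSpace A) : consS (z 0) (shiftA A z) = z := by
  ext n; cases n <;> rfl

lemma mem_cylA_succ {A : Type*} (z z' : SeqSpace A) (k : ℕ) :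
    z ∈ cylA z' (k + 1) ↔ z 0 = z' 0 ∧ shiftA A z ∈ cylA (shiftA A z') k := by
  simp only [cylA, mem_ofPred_eq, shiftA]
  constructor
  · intro h
    exact ⟨h 0 (by omega), fun i hi => h (i + 1) (by omega)⟩
  · rintro ⟨h0, h⟩ i hi
    cases i with
    | zero => exact h0
    | succ i => exact h i (by omega)

lemma consN_of_mem {A : Type*} (k : ℕ) (w y : SeqSpace A) (h : y ∈ cylA w k) :
    consN k w ((shiftA A)^[k] y) = y := by
  induction k generalizing w y with
  | zero => rfl
  | succ k ih =>
    rw [mem_cylA_succ] at h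
    simp only [consN, Function.iterate_succ, Function.comp]
    rw [ih _ _ h.2, ← h.1, consS_shift]

section
variable {A : Type*} [Fintype A] [MeasurableSpace A] [MeasurableSingletonClass A]

@[fun_prop]
lemma measurable_shiftA {A : Type*} [MeasurableSpace A] : Measurable (shiftA A) :=
  measurable_pi_lambda _ fun n => measurable_pi_apply (n + 1)

@[fun_prop]
lemma measurable_preA {A : Type*} [MeasurableSpace A] (n : ℕ) : Measurable (preA (A := A) n) :=
  measurable_pi_lambda _ fun _ => measurable_pi_apply _

lemma measurable_consS {A : Type*} [MeasurableSpace A] (a : A) : Measurable (consS a) :=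
  measurable_pi_lambda _ fun n => by
    cases n with
    | zero => exact measurable_const
    | succ n => exact measurable_pi_apply n

lemma measurable_consN {A : Type*} [MeasurableSpace A] (k : ℕ) (w : SeqSpace A) :
    Measurable (consN k w) := by
  induction k generalizing w with
  | zero => exact measurable_id
  | succ k ih => exact (measurable_consS _).comp (ih _)

lemma measurableSet_cylA {A : Type*} [MeasurableSpace A] [MeasurableSingletonClass A]
    (z : SeqSpace A) (n : ℕ) : MeasurableSet (cylA z n) := by
  have : cylA z n = ⋂ i ∈ Finset.range n, (fun x : SeqSpace A => x i) ⁻¹' {z i} := by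
    ext; simp [cylA]
  rw [this]
  exact Finset.measurableSet_biInter _ fun i _ =>
    measurable_pi_apply i (measurableSet_singleton _)

lemma measurableSet_zero_eq {A : Type*} [MeasurableSpace A] [MeasurableSingletonClass A] (a : A) :
    MeasurableSet {z : SeqSpace A | z 0 = a} := by
  have h : {z : SeqSpace A | z 0 = a} = (fun z : SeqSpace A => z 0) ⁻¹' {a} := by ext; simp
  rw [h]
  exact (measurable_pi_apply (0 : ℕ)) (measurableSet_singleton a)

lemma mem_zero_eq {A : Type*} {a : A} {z : SeqSpace A} (h : z 0 = a) :
    z ∈ {z : SeqSpace A | z 0 = a} := by simpa using h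

lemma notMem_zero_eq {A : Type*} {a : A} {z : SeqSpace A} (h : ¬ z 0 = a) :
    z ∉ {z : SeqSpace A | z 0 = a} := by simpa using h

/-- Branch measure. -/
def branchM (ν : Measure (SeqSpace A)) (a : A) : Measure (SeqSpace A) :=
  (ν.restrict {z | z 0 = a}).map (shiftA A)

/-- Density of the branch measure. -/
def phiA (ν : Measure (SeqSpace A)) (a : A) : SeqSpace A → ℝ≥0∞ := (branchM ν a).rnDeriv ν

/-- Conditional probability of the zeroth letter given the others. -/
def pInf (ν : Measure (SeqSpace A)) (z : SeqSpace A) : ℝ≥0∞ := phiA ν (z 0) (shiftA A z)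

@[fun_prop]
lemma measurable_phiA (ν : Measure (SeqSpace A)) (a : A) : Measurable (phiA ν a) :=
  Measure.measurable_rnDeriv _ _

lemma measurable_apply_zero {β : Type*} [MeasurableSpace β] (F : A → SeqSpace A → β)
    (hF : ∀ a, Measurable (F a)) : Measurable (fun z : SeqSpace A => F (z 0) z) := by
  have h : Measurable (Function.uncurry F) := measurable_from_prod_countable_right (fun a => hF a)
  have h2 : Measurable (fun z : SeqSpace A => (z 0, z)) :=
    (measurable_pi_apply 0).prodMk measurable_id
  exact h.comp h2

@[fun_prop]
lemma measurable_pInf (ν : Measure (SeqSpace A)) : Measurable (pInf ν) :=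
  measurable_apply_zero (fun a z => phiA ν a (shiftA A z))
    (fun a => (measurable_phiA ν a).comp measurable_shiftA)

variable {ν : Measure (SeqSpace A)} [IsProbabilityMeasure ν]

instance (a : A) : IsFiniteMeasure (branchM ν a) := by
  unfold branchM; infer_instance

lemma branchM_le (hν : MeasurePreserving (shiftA A) ν ν) (a : A) : branchM ν a ≤ ν := by
  conv_rhs => rw [← hν.map_eq]
  exact Measure.map_mono Measure.restrict_le_self measurable_shiftA

lemma branchM_ac (hν : MeasurePreserving (shiftA A) ν ν) (a : A) : branchM ν a ≪ ν :=
  Measure.absolutelyContinuous_of_le (branchM_le hν a)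

lemma peel_eq (hν : MeasurePreserving (shiftA A) ν ν) (a : A) {H : SeqSpace A → ℝ≥0∞}
    (hH : Measurable H) :
    ∫⁻ z, {z : SeqSpace A | z 0 = a}.indicator (fun z => H (shiftA A z)) z ∂ν =
      ∫⁻ z, phiA ν a z * H z ∂ν := by
  rw [lintegral_indicator (measurableSet_zero_eq a), ← lintegral_map hH measurable_shiftA]
  rw [phiA, lintegral_rnDeriv_mul (branchM_ac hν a) hH.aemeasurable]
  rfl

lemma peel_inv (hν : MeasurePreserving (shiftA A) ν ν) (a : A) {H : SeqSpace A → ℝ≥0∞}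
    (hH : Measurable H) :
    ∫⁻ z, {z : SeqSpace A | z 0 = a}.indicator (fun z => (pInf ν z)⁻¹ * H (shiftA A z)) z ∂ν ≤
      ∫⁻ z, H z ∂ν := by
  have : ∀ z, {z : SeqSpace A | z 0 = a}.indicator (fun z => (pInf ν z)⁻¹ * H (shiftA A z)) z =
      {z : SeqSpace A | z 0 = a}.indicator
        (fun z => (fun x => (phiA ν a x)⁻¹ * H x) (shiftA A z)) z := by
    intro z
    by_cases hz : z 0 = a
    · simp [indicator, hz, pInf]
    · simp [indicator, hz]
  rw [lintegral_congr this]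
  have hm : Measurable (fun x => (phiA ν a x)⁻¹ * H x) := by fun_prop
  refine (le_of_eq (peel_eq hν a hm)).trans (lintegral_mono fun z => ?_)
  simp only
  rw [← mul_assoc]
  calc _ ≤ 1 * H z := by gcongr; exact ENNReal.mul_inv_le_one _
    _ = H z := one_mul _

/-- Inverse likelihoods. -/
def rInv (ν : Measure (SeqSpace A)) (k : ℕ) (z : SeqSpace A) : ℝ≥0∞ :=
  ∏ i ∈ Finset.range k, (pInf ν ((shiftA A)^[i] z))⁻¹

lemma measurable_iter_shiftA {A : Type*} [MeasurableSpace A] (k : ℕ) :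
    Measurable ((shiftA A)^[k]) := measurable_shiftA.iterate k

@[fun_prop]
lemma measurable_rInv (ν : Measure (SeqSpace A)) (k : ℕ) : Measurable (rInv ν k) := by
  unfold rInv
  exact Finset.measurable_fun_prod _ fun i _ =>
    ((measurable_pInf ν).comp (measurable_iter_shiftA i)).inv

lemma rInv_succ (ν : Measure (SeqSpace A)) (k : ℕ) (z : SeqSpace A) :
    rInv ν (k + 1) z = (pInf ν z)⁻¹ * rInv ν k (shiftA A z) := by
  rw [rInv, Finset.prod_range_succ', mul_comm]; rfl

lemma peel_up (hν : MeasurePreserving (shiftA A) ν ν) (k : ℕ) (z' : SeqSpace A)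
    {h : SeqSpace A → ℝ≥0∞} (hh : Measurable h) :
    ∫⁻ z, (cylA z' k).indicator (fun z => rInv ν k z * h ((shiftA A)^[k] z)) z ∂ν ≤
      ∫⁻ z, h z ∂ν := by
  induction k generalizing z' with
  | zero => simp [cylA, rInv]
  | succ k ih =>
    refine le_trans (le_of_eq ?_) ((peel_inv hν (z' 0) (H := (cylA (shiftA A z') k).indicator
      (fun z => rInv ν k z * h ((shiftA A)^[k] z))) ?_).trans (ih (shiftA A z')))
    · refine lintegral_congr fun z => ?_
      by_cases h0 : z 0 = z' 0
      · by_cases h1 : shiftA A z ∈ cylA (shiftA A z') k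
        · rw [indicator_of_mem ((mem_cylA_succ _ _ _).2 ⟨h0, h1⟩), indicator_of_mem (mem_zero_eq h0),
            indicator_of_mem h1, rInv_succ, Function.iterate_succ, Function.comp, mul_assoc]
        · rw [indicator_of_notMem (fun hc => h1 ((mem_cylA_succ _ _ _).1 hc).2),
            indicator_of_mem (mem_zero_eq h0), indicator_of_notMem h1, mul_zero]
      · rw [indicator_of_notMem (fun hc => h0 ((mem_cylA_succ _ _ _).1 hc).1),
          indicator_of_notMem (notMem_zero_eq h0)]
    · exact ((measurable_rInv ν k).mul (hh.comp (measurable_iter_shiftA k))).indicator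
        (measurableSet_cylA _ _)

/-- Conditional likelihood of `w` given the future. -/
def gLik (ν : Measure (SeqSpace A)) : ℕ → SeqSpace A → SeqSpace A → ℝ≥0∞
  | 0, _, _ => 1
  | (k + 1), w, y => phiA ν (w 0) (consN k (shiftA A w) y) * gLik ν k (shiftA A w) y

lemma measurable_gLik (ν : Measure (SeqSpace A)) (k : ℕ) (w : SeqSpace A) :
    Measurable (gLik ν k w) := by
  induction k generalizing w with
  | zero => exact measurable_const
  | succ k ih => exact ((measurable_phiA ν _).comp (measurable_consN _ _)).mul (ih _)

lemma gLik_of_mem (ν : Measure (SeqSpace A)) (k : ℕ) (w y : SeqSpace A) (h : y ∈ cylA w k) :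
    gLik ν k w ((shiftA A)^[k] y) = ∏ i ∈ Finset.range k, pInf ν ((shiftA A)^[i] y) := by
  induction k generalizing w y with
  | zero => rfl
  | succ k ih =>
    rw [mem_cylA_succ] at h
    simp only [gLik, Function.iterate_succ, Function.comp]
    rw [Finset.prod_range_succ', ih _ _ h.2, consN_of_mem _ _ _ h.2, mul_comm]
    simp [pInf, h.1]

lemma gLik_lintegral (hν : MeasurePreserving (shiftA A) ν ν) (k : ℕ) (w : SeqSpace A)
    {h : SeqSpace A → ℝ≥0∞} (hh : Measurable h) :
    ∫⁻ y, (cylA w k).indicator (fun y => h ((shiftA A)^[k] y)) y ∂ν =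
      ∫⁻ y, gLik ν k w y * h y ∂ν := by
  induction k generalizing w h with
  | zero => simp [cylA, gLik]
  | succ k ih =>
    have e1 : ∀ z, (cylA w (k + 1)).indicator (fun y => h ((shiftA A)^[k + 1] y)) z =
        {z : SeqSpace A | z 0 = w 0}.indicator (fun z =>
          ((cylA (shiftA A w) k).indicator (fun y => h ((shiftA A)^[k] y))) (shiftA A z)) z := by
      intro z
      by_cases h0 : z 0 = w 0
      · by_cases h1 : shiftA A z ∈ cylA (shiftA A w) k
        · rw [indicator_of_mem ((mem_cylA_succ _ _ _).2 ⟨h0, h1⟩), indicator_of_mem (mem_zero_eq h0),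
            indicator_of_mem h1, Function.iterate_succ, Function.comp]
        · rw [indicator_of_notMem (fun hc => h1 ((mem_cylA_succ _ _ _).1 hc).2),
            indicator_of_mem (mem_zero_eq h0), indicator_of_notMem h1]
      · rw [indicator_of_notMem (fun hc => h0 ((mem_cylA_succ _ _ _).1 hc).1),
          indicator_of_notMem (notMem_zero_eq h0)]
    rw [lintegral_congr e1]
    have hm : Measurable ((cylA (shiftA A w) k).indicator (fun y => h ((shiftA A)^[k] y))) :=
      (hh.comp (measurable_iter_shiftA k)).indicator (measurableSet_cylA _ _)
    refine (peel_eq hν (w 0) hm).trans ?_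
    have e2 : ∀ z, phiA ν (w 0) z * ((cylA (shiftA A w) k).indicator
        (fun y => h ((shiftA A)^[k] y))) z = (cylA (shiftA A w) k).indicator (fun y =>
          (fun x => phiA ν (w 0) (consN k (shiftA A w) x) * h x) ((shiftA A)^[k] y)) z := by
      intro z
      by_cases h1 : z ∈ cylA (shiftA A w) k
      · rw [indicator_of_mem h1, indicator_of_mem h1]
        simp only
        rw [consN_of_mem _ _ _ h1]
      · rw [indicator_of_notMem h1, indicator_of_notMem h1, mul_zero]
    rw [lintegral_congr e2]
    refine (ih (shiftA A w) (((measurable_phiA ν _).comp (measurable_consN _ _)).mul hh)).trans ?_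
    refine lintegral_congr fun y => ?_
    simp only [gLik, Pi.mul_apply, Function.comp]; ring

end
end

noncomputable section

section
variable {A : Type*} [Fintype A] [MeasurableSpace A] [MeasurableSingletonClass A]

lemma integrable_pre (η : Measure (SeqSpace A)) [IsFiniteMeasure η] (n : ℕ)
    (g : (Fin n → A) → ℝ) : Integrable (fun z => g (preA n z)) η := by
  have h : Integrable g (η.map (preA n)) := Integrable.of_finite
  exact h.comp_measurable (measurable_preA n)

lemma integral_pre (η : Measure (SeqSpace A)) [IsFiniteMeasure η] (n : ℕ)
    (g : (Fin n → A) → ℝ) :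
    ∫ z, g (preA n z) ∂η = ∑ u, (η (preA n ⁻¹' {u})).toReal * g u := by
  have h : Integrable g (η.map (preA n)) := Integrable.of_finite
  rw [← integral_map (measurable_preA n).aemeasurable h.aestronglyMeasurable, integral_fintype h]
  refine Finset.sum_congr rfl fun u _ => ?_
  rw [Measure.real, Measure.map_apply (measurable_preA n) (measurableSet_singleton _), smul_eq_mul]

lemma integrable_split {ν : Measure (SeqSpace A)} [IsProbabilityMeasure ν]
    {F : A → SeqSpace A → ℝ} (hF : ∀ a, Integrable (F a) (branchM ν a)) :
    Integrable (fun z => F (z 0) (shiftA A z)) ν ∧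
    ∫ z, F (z 0) (shiftA A z) ∂ν = ∑ a, ∫ z, F a z ∂(branchM ν a) := by
  classical
  have h1 : ∀ a, Integrable ({z : SeqSpace A | z 0 = a}.indicator (fun z => F a (shiftA A z))) ν := by
    intro a
    rw [integrable_indicator_iff (measurableSet_zero_eq a)]
    exact (hF a).comp_measurable measurable_shiftA
  have h2 : (fun z : SeqSpace A => F (z 0) (shiftA A z)) =
      fun z => ∑ a, {z : SeqSpace A | z 0 = a}.indicator (fun z => F a (shiftA A z)) z := by
    ext z
    simp [indicator_apply]
  rw [h2]
  refine ⟨integrable_finsetSum _ fun a _ => h1 a, ?_⟩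
  rw [integral_finsetSum _ fun a _ => h1 a]
  refine Finset.sum_congr rfl fun a _ => ?_
  rw [integral_indicator (measurableSet_zero_eq a)]
  exact (integral_map measurable_shiftA.aemeasurable (hF a).aestronglyMeasurable).symm

/-- Real mass of a cylinder. -/
def mc (ν : Measure (SeqSpace A)) (n : ℕ) (z : SeqSpace A) : ℝ := (ν (cylA z n)).toReal

lemma ae_pre_pos (ν : Measure (SeqSpace A)) {ι : Type*} [Finite ι] [MeasurableSpace ι]
    (r : SeqSpace A → ι) :
    ∀ᵐ z ∂ν, ν (r ⁻¹' {r z}) ≠ 0 := by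
  rw [ae_iff]
  have : {z | ¬ ν (r ⁻¹' {r z}) ≠ 0} ⊆ ⋃ u ∈ {u : ι | ν (r ⁻¹' {u}) = 0}, r ⁻¹' {u} := by
    intro z hz
    simp only [ne_eq, not_not, mem_ofPred_eq] at hz
    simp only [mem_iUnion]
    exact ⟨r z, by simpa using hz, rfl⟩
  refine measure_mono_null this ?_
  rw [measure_biUnion_null_iff (Set.to_countable _)]
  intro u hu
  simpa using hu

lemma ae_mc_pos (ν : Measure (SeqSpace A)) [IsFiniteMeasure ν] (n : ℕ) :
    ∀ᵐ z ∂ν, 0 < mc ν n z := by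
  filter_upwards [ae_pre_pos ν (preA n)] with z hz
  rw [mc, cylA_eq_pre]
  exact ENNReal.toReal_pos hz (measure_ne_top _ _)

/-- Block entropy. -/
def HbA (ν : Measure (SeqSpace A)) (n : ℕ) : ℝ :=
  ∑ u : Fin n → A, (ν (preA n ⁻¹' {u})).toReal * (-Real.log (ν (preA n ⁻¹' {u})).toReal)

lemma entropySeqA_eq (ν : Measure (SeqSpace A)) (n : ℕ) :
    entropySeqA ν n = (n : ℝ)⁻¹ * HbA ν n := by
  simp [entropySeqA, HbA, cylinderA_ofFn]

lemma integral_log_mc (ν : Measure (SeqSpace A)) [IsFiniteMeasure ν] (n : ℕ) :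
    Integrable (fun z => -Real.log (mc ν n z)) ν ∧ ∫ z, -Real.log (mc ν n z) ∂ν = HbA ν n := by
  have h : (fun z => -Real.log (mc ν n z)) =
      fun z => (fun u => -Real.log (ν (preA n ⁻¹' {u})).toReal) (preA n z) := by
    ext z; simp [mc, cylA_eq_pre]
  rw [h]
  exact ⟨integrable_pre ν n (fun u => -Real.log (ν (preA n ⁻¹' {u})).toReal),
    integral_pre ν n (fun u => -Real.log (ν (preA n ⁻¹' {u})).toReal)⟩

/-- minus log of the level-`K` conditional probability -/
def lK (ν : Measure (SeqSpace A)) (K : ℕ) (z : SeqSpace A) : ℝ :=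
  Real.log (mc ν K (shiftA A z)) - Real.log (mc ν (K + 1) z)

variable {ν : Measure (SeqSpace A)} [IsProbabilityMeasure ν]

lemma measurable_mc (ν : Measure (SeqSpace A)) (n : ℕ) : Measurable (mc ν n) := by
  have h : mc ν n = (fun u => (ν (preA n ⁻¹' {u})).toReal) ∘ (preA n) := by
    ext z; simp [mc, cylA_eq_pre]
  rw [h]
  exact (measurable_of_finite _).comp (measurable_preA n)

lemma integral_lK (hν : MeasurePreserving (shiftA A) ν ν) (K : ℕ) :
    Integrable (lK ν K) ν ∧ ∫ z, lK ν K z ∂ν = HbA ν (K + 1) - HbA ν K := by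
  have h1 := integral_log_mc ν (K + 1)
  have h2 := integral_log_mc ν K
  have h3 : Integrable (fun z => -Real.log (mc ν K (shiftA A z))) ν :=
    hν.integrable_comp_of_integrable h2.1
  have h4 : ∫ z, -Real.log (mc ν K (shiftA A z)) ∂ν = HbA ν K := by
    rw [← h2.2]
    have hm : AEStronglyMeasurable (fun z => -Real.log (mc ν K z)) (ν.map (shiftA A)) :=
      (Real.measurable_log.comp (measurable_mc ν K)).neg.aestronglyMeasurable
    have := integral_map (μ := ν) measurable_shiftA.aemeasurable hm
    rw [hν.map_eq] at this
    exact this.symm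
  have h5 : lK ν K = fun z => (-Real.log (mc ν (K + 1) z)) - (-Real.log (mc ν K (shiftA A z))) := by
    ext z; simp [lK]; ring
  rw [h5]
  exact ⟨h1.1.sub h3, by rw [integral_sub h1.1 h3, h1.2, h4]⟩

/-- Finite-level conditional probability. -/
def phiK (ν : Measure (SeqSpace A)) (K : ℕ) (a : A) (y : SeqSpace A) : ℝ :=
  (branchM ν a (cylA y K)).toReal / (ν (cylA y K)).toReal

lemma phiK_pre (ν : Measure (SeqSpace A)) (K : ℕ) (a : A) : phiK ν K a =
    fun y => (fun u => (branchM ν a (preA K ⁻¹' {u})).toReal / (ν (preA K ⁻¹' {u})).toReal)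
      (preA K y) := by
  ext y; simp [phiK, cylA_eq_pre]

lemma phiK_nonneg (ν : Measure (SeqSpace A)) (K : ℕ) (a : A) (y : SeqSpace A) : 0 ≤ phiK ν K a y := by
  unfold phiK; positivity

lemma phiK_le_one (hν : MeasurePreserving (shiftA A) ν ν) (K : ℕ) (a : A) (y : SeqSpace A) :
    phiK ν K a y ≤ 1 := by
  unfold phiK
  refine div_le_one_of_le₀ ?_ ENNReal.toReal_nonneg
  exact ENNReal.toReal_mono (measure_ne_top _ _) (branchM_le hν a _)

lemma branchM_apply_cons (ν : Measure (SeqSpace A)) (K : ℕ) (z : SeqSpace A) :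
    branchM ν (z 0) (cylA (shiftA A z) K) = ν (cylA z (K + 1)) := by
  rw [branchM, Measure.map_apply measurable_shiftA (measurableSet_cylA _ _),
    Measure.restrict_apply (measurable_shiftA (measurableSet_cylA _ _))]
  congr 1
  ext z'
  rw [mem_cylA_succ]
  simp only [mem_inter_iff, mem_preimage, mem_ofPred_eq]
  tauto

lemma integral_negMulLog_phiK (hν : MeasurePreserving (shiftA A) ν ν) (K : ℕ) :
    ∑ a, ∫ y, Real.negMulLog (phiK ν K a y) ∂ν = HbA ν (K + 1) - HbA ν K := by
  rw [← (integral_lK hν K).2]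
  have h1 : ∀ a, Integrable (fun y => -Real.log (phiK ν K a y)) (branchM ν a) := by
    intro a
    rw [phiK_pre]
    exact integrable_pre _ K (fun u => -Real.log
      ((branchM ν a (preA K ⁻¹' {u})).toReal / (ν (preA K ⁻¹' {u})).toReal))
  have h2 : ∫ z, lK ν K z ∂ν = ∫ z, -Real.log (phiK ν K (z 0) (shiftA A z)) ∂ν := by
    refine integral_congr_ae ?_
    filter_upwards [ae_mc_pos ν (K + 1),
      hν.quasiMeasurePreserving.ae (ae_mc_pos ν K)] with z hz1 hz2
    simp only [phiK]
    rw [branchM_apply_cons]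
    rw [mc] at hz1 hz2
    rw [Real.log_div hz1.ne' hz2.ne']
    simp [lK, mc]
  rw [h2, (integrable_split (F := fun a y => -Real.log (phiK ν K a y)) h1).2]
  refine Finset.sum_congr rfl fun a _ => ?_
  rw [phiK_pre]
  rw [integral_pre ν K (fun u => Real.negMulLog
      ((branchM ν a (preA K ⁻¹' {u})).toReal / (ν (preA K ⁻¹' {u})).toReal)),
    integral_pre (branchM ν a) K (fun u => -Real.log
      ((branchM ν a (preA K ⁻¹' {u})).toReal / (ν (preA K ⁻¹' {u})).toReal))]
  refine Finset.sum_congr rfl fun u _ => ?_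
  rw [Real.negMulLog]
  by_cases h : (ν (preA K ⁻¹' {u})).toReal = 0
  · simp [h]
  · field_simp

/-- filtration by prefixes -/
def preFilt (A : Type*) [MeasurableSpace A] :
    Filtration ℕ (inferInstance : MeasurableSpace (SeqSpace A)) where
  seq K := MeasurableSpace.comap (preA K) inferInstance
  mono' := by
    intro i j hij
    have : preA (A := A) i = (fun u : Fin j → A => fun l : Fin i => u (Fin.castLE hij l)) ∘ preA j := rfl
    simp only
    rw [this, ← MeasurableSpace.comap_comp]
    refine MeasurableSpace.comap_mono (measurable_iff_comap_le.1 ?_)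
    exact measurable_pi_lambda _ fun l => measurable_pi_apply _
  le' K := (measurable_preA K).comap_le

lemma le_iSup_preFilt : (inferInstance : MeasurableSpace (SeqSpace A)) ≤ ⨆ n, preFilt A n := by
  refine iSup_le fun i => ?_
  refine le_trans ?_ (le_iSup _ (i + 1))
  change _ ≤ MeasurableSpace.comap (preA (i + 1)) inferInstance
  have : (fun z : SeqSpace A => z i) = (fun u : Fin (i + 1) → A => u (Fin.last i)) ∘ preA (i + 1) := rfl
  rw [this, ← MeasurableSpace.comap_comp]
  exact MeasurableSpace.comap_mono (measurable_iff_comap_le.1 (measurable_pi_apply _))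

lemma phiK_tendsto (hν : MeasurePreserving (shiftA A) ν ν) (a : A) :
    ∀ᵐ y ∂ν, Tendsto (fun K => phiK ν K a y) atTop (nhds (phiA ν a y).toReal) := by
  have hintg : Integrable (fun y => (phiA ν a y).toReal) ν := Measure.integrable_toReal_rnDeriv
  have hsm : StronglyMeasurable[⨆ n, preFilt A n] (fun y => (phiA ν a y).toReal) := by
    have : Measurable (fun y => (phiA ν a y).toReal) := (measurable_phiA ν a).ennreal_toReal
    exact (this.mono le_iSup_preFilt le_rfl).stronglyMeasurable
  have key := hintg.tendsto_ae_condExp (ℱ := preFilt A) hsm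
  have hK : ∀ K, phiK ν K a =ᵐ[ν] ν[(fun y => (phiA ν a y).toReal) | preFilt A K] := by
    intro K
    have hi : Integrable (phiK ν K a) ν := by
      rw [phiK_pre]
      exact integrable_pre ν K (fun u => (branchM ν a (preA K ⁻¹' {u})).toReal /
        (ν (preA K ⁻¹' {u})).toReal)
    refine ae_eq_condExp_of_forall_setIntegral_eq ((preFilt A).le K) hintg
      (fun s _ _ => hi.integrableOn) ?_ ?_
    · rintro s ⟨t, ht, rfl⟩ _
      rw [phiA, Measure.setIntegral_toReal_rnDeriv (branchM_ac hν a), Measure.real]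
      rw [← integral_indicator (measurable_preA K ht), phiK_pre]
      classical
      have e1 : ((preA K ⁻¹' t).indicator fun y => (fun u =>
          (branchM ν a (preA K ⁻¹' {u})).toReal / (ν (preA K ⁻¹' {u})).toReal) (preA K y)) =
          fun y => (t.indicator (fun u =>
          (branchM ν a (preA K ⁻¹' {u})).toReal / (ν (preA K ⁻¹' {u})).toReal)) (preA K y) := by
        ext y; simp [indicator_apply]
      have e2 : (branchM ν a (preA K ⁻¹' t)).toReal =
          ∫ y, (t.indicator (fun _ => (1:ℝ))) (preA K y) ∂(branchM ν a) := by
        have : (fun y => (t.indicator (fun _ => (1:ℝ))) (preA K y)) =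
          (preA K ⁻¹' t).indicator (fun _ => (1:ℝ)) := by ext y; simp [indicator_apply]
        rw [this, integral_indicator (measurable_preA K ht)]
        simp [Measure.real]
      rw [e1, e2, integral_pre, integral_pre]
      refine Finset.sum_congr rfl fun u _ => ?_
      by_cases hu : u ∈ t
      · simp only [indicator_of_mem hu]
        by_cases h : (ν (preA K ⁻¹' {u})).toReal = 0
        · have : (branchM ν a (preA K ⁻¹' {u})).toReal = 0 := by
            refine le_antisymm ?_ ENNReal.toReal_nonneg
            rw [← h]
            exact ENNReal.toReal_mono (measure_ne_top _ _) (branchM_le hν a _)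
          simp [h, this]
        · field_simp
      · simp [indicator_of_notMem hu]
    · rw [phiK_pre]
      refine Measurable.aestronglyMeasurable ?_
      exact (measurable_of_finite (fun u => (branchM ν a (preA K ⁻¹' {u})).toReal /
        (ν (preA K ⁻¹' {u})).toReal)).comp (comap_measurable (preA K))
  filter_upwards [key, ae_all_iff.2 hK] with y h1 h2
  simpa [h2] using h1

lemma negMulLog_abs_le {x : ℝ} (h0 : 0 ≤ x) (h1 : x ≤ 1) : |Real.negMulLog x| ≤ 1 := by
  rw [abs_of_nonneg (Real.negMulLog_nonneg h0 h1)]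
  linarith [Real.negMulLog_le_one_sub_self h0]

lemma phiA_le_one (hν : MeasurePreserving (shiftA A) ν ν) (a : A) : ∀ᵐ y ∂ν, phiA ν a y ≤ 1 :=
  Measure.rnDeriv_le_one_of_le (branchM_le hν a)

lemma integrable_negMulLog_phiA (hν : MeasurePreserving (shiftA A) ν ν) (a : A) :
    Integrable (fun y => Real.negMulLog (phiA ν a y).toReal) ν := by
  refine Integrable.of_bound (C := 1) ?_ ?_
  · exact (Real.continuous_negMulLog.measurable.comp
      (measurable_phiA ν a).ennreal_toReal).aestronglyMeasurable
  · filter_upwards [phiA_le_one hν a] with y hy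
    exact negMulLog_abs_le ENNReal.toReal_nonneg (by simpa using ENNReal.toReal_mono ENNReal.one_ne_top hy)

lemma tendsto_Hdiff (hν : MeasurePreserving (shiftA A) ν ν) :
    Tendsto (fun K => HbA ν (K + 1) - HbA ν K) atTop
      (nhds (∑ a, ∫ y, Real.negMulLog (phiA ν a y).toReal ∂ν)) := by
  simp_rw [← integral_negMulLog_phiK hν]
  refine tendsto_finsetSum _ fun a _ => ?_
  refine tendsto_integral_of_dominated_convergence (fun _ => 1) ?_ (integrable_const _) ?_ ?_
  · intro K
    rw [phiK_pre]
    exact (integrable_pre ν K (fun u => Real.negMulLog ((branchM ν a (preA K ⁻¹' {u})).toReal /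
        (ν (preA K ⁻¹' {u})).toReal))).aestronglyMeasurable
  · intro K
    exact Eventually.of_forall fun y => negMulLog_abs_le (phiK_nonneg _ _ _ _) (phiK_le_one hν _ _ _)
  · filter_upwards [phiK_tendsto hν a] with y hy
    exact (Real.continuous_negMulLog.tendsto _).comp hy

lemma ae_pInf (hν : MeasurePreserving (shiftA A) ν ν) :
    ∀ᵐ z ∂ν, pInf ν z ≠ 0 ∧ pInf ν z ≤ 1 := by
  have h1 : ∀ a, ∀ᵐ y ∂(branchM ν a), phiA ν a y ≠ 0 ∧ phiA ν a y ≤ 1 := by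
    intro a
    filter_upwards [Measure.rnDeriv_pos (branchM_ac hν a),
      (branchM_ac hν a).ae_le (phiA_le_one hν a)] with y h1 h2
    exact ⟨h1.ne', h2⟩
  have h2 : ∀ a, ∀ᵐ z ∂ν, z 0 = a → (phiA ν a (shiftA A z) ≠ 0 ∧ phiA ν a (shiftA A z) ≤ 1) := by
    intro a
    have := ae_of_ae_map measurable_shiftA.aemeasurable (h1 a)
    rw [ae_restrict_iff' (measurableSet_zero_eq a)] at this
    filter_upwards [this] with z hz h0
    exact hz (mem_zero_eq h0)
  filter_upwards [ae_all_iff.2 h2] with z hz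
  exact hz (z 0) rfl

/-- minus log of the conditional probability -/
def lInf (ν : Measure (SeqSpace A)) (z : SeqSpace A) : ℝ := -Real.log (pInf ν z).toReal

lemma measurable_lInf (ν : Measure (SeqSpace A)) : Measurable (lInf ν) :=
  (Real.measurable_log.comp (measurable_pInf ν).ennreal_toReal).neg

lemma measurable_lK (ν : Measure (SeqSpace A)) (K : ℕ) : Measurable (lK ν K) :=
  (Real.measurable_log.comp ((measurable_mc ν K).comp measurable_shiftA)).sub
    (Real.measurable_log.comp (measurable_mc ν (K + 1)))

lemma integral_lInf' (hν : MeasurePreserving (shiftA A) ν ν) :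
    Integrable (lInf ν) ν ∧
    ∫ z, lInf ν z ∂ν = ∑ a, ∫ y, Real.negMulLog (phiA ν a y).toReal ∂ν := by
  have e : ∀ a, (fun y => Real.negMulLog (phiA ν a y).toReal) =
      fun y => ((branchM ν a).rnDeriv ν y).toReal • (-Real.log (phiA ν a y).toReal) := by
    intro a; ext y; simp [Real.negMulLog, phiA]
  have h1 : ∀ a, Integrable (fun y => -Real.log (phiA ν a y).toReal) (branchM ν a) := by
    intro a
    rw [← integrable_rnDeriv_smul_iff (branchM_ac hν a), ← e]
    exact integrable_negMulLog_phiA hν a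
  have h2 := integrable_split (F := fun a y => -Real.log (phiA ν a y).toReal) h1
  refine ⟨h2.1, h2.2.trans (Finset.sum_congr rfl fun a _ => ?_)⟩
  rw [e a, integral_rnDeriv_smul (branchM_ac hν a)]

theorem entropy_main (hν : MeasurePreserving (shiftA A) ν ν) {h : ℝ}
    (hent : Tendsto (entropySeqA ν) atTop (nhds h)) :
    Integrable (lInf ν) ν ∧ ∫ z, lInf ν z ∂ν = h ∧
    Tendsto (fun K => ∫ z, lK ν K z ∂ν) atTop (nhds h) := by
  obtain ⟨h1, h2⟩ := integral_lInf' hν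
  have h3 := tendsto_Hdiff hν
  have h4 := h3.cesaro
  have h5 : (fun n : ℕ => (n:ℝ)⁻¹ * ∑ i ∈ Finset.range n, (HbA ν (i + 1) - HbA ν i)) =
      fun n => entropySeqA ν n - (n:ℝ)⁻¹ * HbA ν 0 := by
    ext n; rw [Finset.sum_range_sub, entropySeqA_eq]; ring
  rw [h5] at h4
  have h6 : Tendsto (fun n : ℕ => entropySeqA ν n - (n:ℝ)⁻¹ * HbA ν 0) atTop (nhds h) := by
    have := hent.sub ((tendsto_inv_atTop_nhds_zero_nat (𝕜 := ℝ)).mul_const (HbA ν 0))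
    simpa using this
  have h7 := tendsto_nhds_unique h6 h4
  refine ⟨h1, by rw [h2, h7], ?_⟩
  simp_rw [fun K => (integral_lK hν K).2]
  rw [h7]; exact h3

lemma entropy_nonneg {h : ℝ} (hent : Tendsto (entropySeqA ν) atTop (nhds h)) : 0 ≤ h := by
  refine ge_of_tendsto' hent fun n => ?_
  rw [entropySeqA_eq, HbA]
  refine mul_nonneg (by positivity) (Finset.sum_nonneg fun u _ => ?_)
  refine mul_nonneg ENNReal.toReal_nonneg ?_
  have : (ν (preA n ⁻¹' {u})).toReal ≤ 1 := by
    simpa using ENNReal.toReal_mono ENNReal.one_ne_top (prob_le_one (μ := ν) (s := preA n ⁻¹' {u}))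
  linarith [Real.log_nonpos ENNReal.toReal_nonneg this]

end
end

noncomputable section

/-- letterwise projection -/
def prQ {A B : Type*} (q : A → B) (z : SeqSpace A) : SeqSpace B := fun n => q (z n)

/-- approximate square -/
def box {A B : Type*} (q : A → B) (n m : ℕ) (z : SeqSpace A) : Set (SeqSpace A) :=
  {z' | (∀ i < n, z' i = z i) ∧ ∀ i < m, q (z' i) = q (z i)}

/-- label of an approximate square -/
def rBox {A B : Type*} (q : A → B) (n m : ℕ) (z : SeqSpace A) : (Fin n → A) × (Fin m → B) :=
  (preA n z, preA m (prQ q z))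

lemma box_eq {A B : Type*} (q : A → B) (n m : ℕ) (z : SeqSpace A) :
    box q n m z = rBox q n m ⁻¹' {rBox q n m z} := by
  ext z'
  simp only [box, rBox, preA, prQ, mem_preimage, mem_singleton_iff, Prod.mk.injEq, funext_iff,
    mem_ofPred_eq]
  exact ⟨fun h => ⟨fun i => h.1 i i.2, fun i => h.2 i i.2⟩,
    fun h => ⟨fun i hi => h.1 ⟨i, hi⟩, fun i hi => h.2 ⟨i, hi⟩⟩⟩

lemma mem_box_self {A B : Type*} (q : A → B) (n m : ℕ) (z : SeqSpace A) : z ∈ box q n m z := by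
  simp [box]

lemma prQ_iter {A B : Type*} (q : A → B) (k : ℕ) (z : SeqSpace A) :
    prQ q ((shiftA A)^[k] z) = (shiftA B)^[k] (prQ q z) := by
  induction k generalizing z with
  | zero => rfl
  | succ k ih => rw [Function.iterate_succ_apply, ih, Function.iterate_succ_apply]; rfl

lemma iter_apply {A : Type*} (k i : ℕ) (z : SeqSpace A) : (shiftA A)^[k] z i = z (i + k) := by
  induction k generalizing z with
  | zero => rfl
  | succ k ih => rw [Function.iterate_succ_apply, ih]; simp [shiftA]; congr 1

lemma mem_box_iff {A B : Type*} (q : A → B) {k m : ℕ} (hkm : k ≤ m) (z z' : SeqSpace A) :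
    z ∈ box q k m z' ↔ z ∈ cylA z' k ∧
      prQ q ((shiftA A)^[k] z) ∈ cylA (prQ q ((shiftA A)^[k] z')) (m - k) := by
  simp only [box, cylA, prQ, mem_ofPred_eq, iter_apply]
  constructor
  · rintro ⟨h1, h2⟩
    exact ⟨h1, fun i hi => h2 _ (by omega)⟩
  · rintro ⟨h1, h2⟩
    refine ⟨h1, fun i hi => ?_⟩
    by_cases hik : i < k
    · rw [h1 i hik]
    · have := h2 (i - k) (by omega)
      rwa [Nat.sub_add_cancel (by omega)] at this

lemma box_of_le {A B : Type*} (q : A → B) {k m : ℕ} (hkm : m ≤ k) (z : SeqSpace A) :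
    box q k m z = box q k k z := by
  ext z'
  simp only [box, mem_ofPred_eq]
  exact ⟨fun h => ⟨h.1, fun i hi => by rw [h.1 i hi]⟩, fun h => ⟨h.1, fun i hi => h.2 i (by omega)⟩⟩

section
variable {S ι : Type*} [MeasurableSpace S] [Fintype ι] [MeasurableSpace ι]
  [MeasurableSingletonClass ι]

lemma fin_part (η : Measure S) {r : S → ι} (hr : Measurable r) (F : ι → ℝ≥0∞)
    {G : S → ℝ≥0∞} (hG : Measurable G) :
    ∫⁻ z, F (r z) * G z ∂η = ∑ i, F i * ∫⁻ z in r ⁻¹' {i}, G z ∂η := by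
  classical
  have h : ∀ z, F (r z) * G z = ∑ i, F i * (r ⁻¹' {i}).indicator G z := by
    intro z
    rw [Finset.sum_eq_single (r z)]
    · simp [indicator]
    · intro b _ hb
      rw [indicator_of_notMem (by simpa using hb.symm), mul_zero]
    · simp
  simp_rw [h]
  rw [lintegral_finsetSum _ fun i _ => (hG.indicator (hr (measurableSet_singleton i))).const_mul _]
  refine Finset.sum_congr rfl fun i _ => ?_
  rw [lintegral_const_mul _ (hG.indicator (hr (measurableSet_singleton i))),
    lintegral_indicator (hr (measurableSet_singleton i))]

lemma sum_fibers (η : Measure S) {r : S → ι} (hr : Measurable r) :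
    ∑ i, η (r ⁻¹' {i}) = η univ := by
  have := fin_part η hr (fun _ => 1) (measurable_const (a := (1:ℝ≥0∞)))
  simpa using this.symm

/-- upper box estimate -/
lemma swap_fibers (η : Measure S) {r : S → ι} (hr : Measurable r) {F : ι → ℝ≥0∞} {G : S → ℝ≥0∞}
    (hG : Measurable G) (h : ∀ z', ∫⁻ z in r ⁻¹' {r z'}, G z ∂η ≤ 1) :
    ∫⁻ z, F (r z) * G z ∂η ≤ ∑ i, F i := by
  rw [fin_part η hr F hG]
  refine Finset.sum_le_sum fun i _ => ?_
  by_cases hi : ∃ z', r z' = i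
  · obtain ⟨z', rfl⟩ := hi
    exact (mul_le_mul_right (h z') _).trans (by simp)
  · have : r ⁻¹' {i} = ∅ := by
      ext z; simp only [mem_preimage, mem_singleton_iff, mem_empty_iff_false, iff_false]
      exact fun h => hi ⟨z, h⟩
    simp [this]

lemma low_fibers (η : Measure S) {r : S → ι} (hr : Measurable r) (F : ι → ℝ≥0∞) :
    ∫⁻ z, F (r z) * (η (r ⁻¹' {r z}))⁻¹ ∂η ≤ ∑ i, F i := by
  refine swap_fibers η hr ((measurable_of_finite (fun i => (η (r ⁻¹' {i}))⁻¹)).comp hr) ?_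
  intro z'
  have : ∫⁻ z in r ⁻¹' {r z'}, (η (r ⁻¹' {r z}))⁻¹ ∂η =
      ∫⁻ z in r ⁻¹' {r z'}, (η (r ⁻¹' {r z'}))⁻¹ ∂η := by
    refine setLIntegral_congr_fun (hr (measurableSet_singleton _)) fun z hz => ?_
    simp only [mem_preimage, mem_singleton_iff] at hz
    simp only [hz]
  rw [this, setLIntegral_const, mul_comm]
  exact ENNReal.mul_inv_le_one _

lemma bc_pairs (η : Measure S) (G : ℕ → ℕ → S → ℝ≥0∞) (hG : ∀ k m, Measurable (G k m))
    (C : ℝ≥0∞) (hC : C ≠ ∞) (h : ∀ k m, k ≤ m → ∫⁻ z, G k m z ∂η ≤ C) {ε : ℝ} (hε : 0 < ε) :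
    ∀ᵐ z ∂η, ∃ n0, ∀ m ≥ n0, ∀ k ≤ m, G k m z ≤ ENNReal.ofReal (Real.exp (ε * m)) := by
  have hm : ∀ m : ℕ, Measurable (fun z => ENNReal.ofReal (Real.exp (-(ε * m))) *
      ∑ k ∈ Finset.range (m + 1), G k m z) := fun m =>
    (Finset.measurable_fun_sum _ fun k _ => hG k m).const_mul _
  have h1 : ∑' m : ℕ, ∫⁻ z, ENNReal.ofReal (Real.exp (-(ε * m))) *
      ∑ k ∈ Finset.range (m + 1), G k m z ∂η ≠ ∞ := by
    have hs : Summable (fun m : ℕ => ((m:ℝ) + 1) * Real.exp (-(ε * m))) := by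
      have e1 := Real.summable_pow_mul_exp_neg_nat_mul 1 hε
      have e0 := Real.summable_pow_mul_exp_neg_nat_mul 0 hε
      refine (e1.add e0).congr fun m => ?_
      simp; ring_nf
    have h2 : ∀ m : ℕ, ∫⁻ z, ENNReal.ofReal (Real.exp (-(ε * m))) *
      ∑ k ∈ Finset.range (m + 1), G k m z ∂η ≤
        C * ENNReal.ofReal (((m:ℝ) + 1) * Real.exp (-(ε * m))) := by
      intro m
      rw [lintegral_const_mul _ (Finset.measurable_fun_sum _ fun k _ => hG k m),
        lintegral_finsetSum _ fun k _ => hG k m]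
      have : ∑ k ∈ Finset.range (m + 1), ∫⁻ z, G k m z ∂η ≤ (m + 1) * C := by
        refine (Finset.sum_le_card_nsmul _ _ C fun k hk => h k m ?_).trans ?_
        · simp at hk; omega
        · simp
      calc _ ≤ ENNReal.ofReal (Real.exp (-(ε * m))) * ((m + 1) * C) := by gcongr
        _ = _ := by
          rw [ENNReal.ofReal_mul (by positivity)]
          have : ENNReal.ofReal ((m:ℝ) + 1) = m + 1 := by
            rw [ENNReal.ofReal_add (by positivity) (by norm_num)]; simp
          rw [this]; ring
    refine ne_top_of_le_ne_top ?_ (ENNReal.tsum_le_tsum h2)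
    rw [ENNReal.tsum_mul_left]
    exact ENNReal.mul_ne_top hC hs.tsum_ofReal_ne_top
  rw [← lintegral_tsum fun m => (hm m).aemeasurable] at h1
  have h3 := ae_lt_top (Measurable.tsum hm) h1
  filter_upwards [h3] with z hz
  have h4 := ENNReal.tendsto_atTop_zero_of_tsum_ne_top hz.ne
  have h5 := h4.eventually (gt_mem_nhds (zero_lt_one))
  obtain ⟨n0, hn0⟩ := eventually_atTop.1 h5
  refine ⟨n0, fun m hm k hk => ?_⟩
  have h6 := hn0 m hm
  have h7 : G k m z ≤ ∑ k ∈ Finset.range (m + 1), G k m z :=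
    Finset.single_le_sum (f := fun k => G k m z) (fun _ _ => zero_le) (by simp; omega)
  have e : ENNReal.ofReal (Real.exp (ε * m)) * ENNReal.ofReal (Real.exp (-(ε * m))) = 1 := by
    rw [← ENNReal.ofReal_mul (by positivity), ← Real.exp_add]; simp
  calc G k m z ≤ ∑ k ∈ Finset.range (m + 1), G k m z := h7
    _ = ENNReal.ofReal (Real.exp (ε * m)) * (ENNReal.ofReal (Real.exp (-(ε * m))) *
      ∑ k ∈ Finset.range (m + 1), G k m z) := by rw [← mul_assoc, e, one_mul]
    _ ≤ ENNReal.ofReal (Real.exp (ε * m)) * 1 := by gcongr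
    _ = _ := mul_one _

end
end

noncomputable section

section
variable {A B : Type*} [Fintype A] [MeasurableSpace A] [MeasurableSingletonClass A]
  [Fintype B] [MeasurableSpace B] [MeasurableSingletonClass B] (q : A → B)

@[fun_prop]
lemma measurable_prQ : Measurable (prQ q) :=
  measurable_pi_lambda _ fun n => (measurable_of_finite q).comp (measurable_pi_apply n)

@[fun_prop]
lemma measurable_rBox (n m : ℕ) : Measurable (rBox q n m) :=
  (measurable_preA n).prodMk ((measurable_preA m).comp (measurable_prQ q))

lemma measurableSet_box (n m : ℕ) (z : SeqSpace A) : MeasurableSet (box q n m z) := by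
  rw [box_eq]; exact measurable_rBox q n m (measurableSet_singleton _)

variable {ν : Measure (SeqSpace A)} [IsProbabilityMeasure ν]

instance : IsProbabilityMeasure (ν.map (prQ q)) :=
  Measure.isProbabilityMeasure_map (measurable_prQ q).aemeasurable

lemma mp_prQ (hν : MeasurePreserving (shiftA A) ν ν) :
    MeasurePreserving (shiftA B) (ν.map (prQ q)) (ν.map (prQ q)) := by
  refine ⟨measurable_shiftA, ?_⟩
  rw [Measure.map_map measurable_shiftA (measurable_prQ q)]
  have : shiftA B ∘ prQ q = prQ q ∘ shiftA A := rfl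
  rw [this, ← Measure.map_map (measurable_prQ q) measurable_shiftA, hν.map_eq]

lemma peel_box (hν : MeasurePreserving (shiftA A) ν ν) {k m : ℕ} (hkm : k ≤ m) (z' : SeqSpace A)
    {g : SeqSpace B → ℝ≥0∞} (hg : Measurable g) :
    ∫⁻ z in box q k m z', rInv ν k z * g (prQ q ((shiftA A)^[k] z)) ∂ν ≤
      ∫⁻ y, (cylA (prQ q ((shiftA A)^[k] z')) (m - k)).indicator g y ∂(ν.map (prQ q)) := by
  have hm : Measurable ((cylA (prQ q ((shiftA A)^[k] z')) (m - k)).indicator g) :=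
    hg.indicator (measurableSet_cylA _ _)
  rw [lintegral_map hm (measurable_prQ q)]
  refine le_trans (le_of_eq ?_) (peel_up hν k z' (hm.comp (measurable_prQ q)))
  rw [← lintegral_indicator (measurableSet_box q k m z')]
  refine lintegral_congr fun z => ?_
  by_cases h1 : z ∈ cylA z' k
  · by_cases h2 : prQ q ((shiftA A)^[k] z) ∈ cylA (prQ q ((shiftA A)^[k] z')) (m - k)
    · rw [indicator_of_mem ((mem_box_iff q hkm _ _).2 ⟨h1, h2⟩), indicator_of_mem h1,
        indicator_of_mem h2]
    · rw [indicator_of_notMem fun h => h2 ((mem_box_iff q hkm _ _).1 h).2, indicator_of_mem h1,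
        indicator_of_notMem h2, mul_zero]
  · rw [indicator_of_notMem fun h => h1 ((mem_box_iff q hkm _ _).1 h).1, indicator_of_notMem h1]

lemma m_up (hν : MeasurePreserving (shiftA A) ν ν) {k m : ℕ} (hkm : k ≤ m) :
    ∫⁻ z, ν (box q k m z) * (rInv ν k z *
      rInv (ν.map (prQ q)) (m - k) (prQ q ((shiftA A)^[k] z))) ∂ν ≤ 1 := by
  simp_rw [box_eq]
  have hg := measurable_rInv (ν.map (prQ q)) (m - k)
  have hG : Measurable (fun z => rInv ν k z *
      rInv (ν.map (prQ q)) (m - k) (prQ q ((shiftA A)^[k] z))) :=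
    (measurable_rInv ν k).mul (hg.comp ((measurable_prQ q).comp (measurable_iter_shiftA k)))
  refine (swap_fibers ν (measurable_rBox q k m) (F := fun i => ν (rBox q k m ⁻¹' {i})) hG ?_).trans ?_
  · intro z'
    rw [← box_eq]
    refine (peel_box q hν hkm z' hg).trans ?_
    have := peel_up (mp_prQ q hν) (m - k) (prQ q ((shiftA A)^[k] z'))
      (measurable_const (a := (1:ℝ≥0∞)))
    simpa using this
  · rw [sum_fibers ν (measurable_rBox q k m), measure_univ]

lemma mem_cylA_add {A : Type*} {k m : ℕ} (hkm : k ≤ m) (y y' : SeqSpace A) :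
    y ∈ cylA y' m ↔ y ∈ cylA y' k ∧ (shiftA A)^[k] y ∈ cylA ((shiftA A)^[k] y') (m - k) := by
  have := mem_box_iff (id : A → A) hkm y y'
  rw [show (prQ (id : A → A)) = id from rfl] at this
  simp only [id] at this
  rw [← this]
  simp only [box, cylA, id, mem_ofPred_eq]
  exact ⟨fun h => ⟨fun i hi => h i (by omega), h⟩, fun h => h.2⟩

lemma m_rel (hν : MeasurePreserving (shiftA A) ν ν) {k m : ℕ} (hkm : k ≤ m) :
    ∫⁻ z, ν (box q k m z) * (rInv ν k z *
      (∏ i ∈ Finset.range k, pInf (ν.map (prQ q)) ((shiftA B)^[i] (prQ q z))) *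
      (ν.map (prQ q) (cylA (prQ q z) m))⁻¹) ∂ν ≤ 1 := by
  simp_rw [box_eq]
  set μ := ν.map (prQ q) with hμ
  have hpm : Measurable (fun z => ∏ i ∈ Finset.range k, pInf μ ((shiftA B)^[i] (prQ q z))) :=
    Finset.measurable_fun_prod _ fun i _ => (measurable_pInf μ).comp
      ((measurable_iter_shiftA i).comp (measurable_prQ q))
  have hcm : Measurable (fun z => (μ (cylA (prQ q z) m))⁻¹) := by
    have : (fun z => (μ (cylA (prQ q z) m))⁻¹) = (fun u => (μ (preA m ⁻¹' {u}))⁻¹) ∘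
      (preA m ∘ prQ q) := by ext z; simp [cylA_eq_pre]
    rw [this]
    exact (measurable_of_finite _).comp ((measurable_preA m).comp (measurable_prQ q))
  have hG : Measurable (fun z => rInv ν k z *
      (∏ i ∈ Finset.range k, pInf μ ((shiftA B)^[i] (prQ q z))) * (μ (cylA (prQ q z) m))⁻¹) :=
    ((measurable_rInv ν k).mul hpm).mul hcm
  refine (swap_fibers ν (measurable_rBox q k m) (F := fun i => ν (rBox q k m ⁻¹' {i})) hG ?_).trans ?_
  · intro z'
    rw [← box_eq]
    have e1 : ∫⁻ z in box q k m z', rInv ν k z *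
      (∏ i ∈ Finset.range k, pInf μ ((shiftA B)^[i] (prQ q z))) * (μ (cylA (prQ q z) m))⁻¹ ∂ν =
      ∫⁻ z in box q k m z', rInv ν k z * (gLik μ k (prQ q z') (prQ q ((shiftA A)^[k] z))) *
        (μ (cylA (prQ q z') m))⁻¹ ∂ν := by
      refine setLIntegral_congr_fun (measurableSet_box q k m z') fun z hz => ?_
      have hz2 : prQ q z ∈ cylA (prQ q z') m := by
        simp only [box, mem_ofPred_eq] at hz
        simpa [cylA, prQ] using hz.2
      have hz3 : cylA (prQ q z) m = cylA (prQ q z') m := by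
        ext y
        simp only [cylA, mem_ofPred_eq] at hz2 ⊢
        exact ⟨fun h i hi => (h i hi).trans (hz2 i hi), fun h i hi => (h i hi).trans (hz2 i hi).symm⟩
      rw [hz3, prQ_iter, gLik_of_mem μ k (prQ q z') (prQ q z)]
      exact ((mem_cylA_add hkm _ _).1 hz2).1
    have hg := measurable_gLik μ k (prQ q z')
    have hgm : Measurable (fun z => rInv ν k z *
        gLik μ k (prQ q z') (prQ q ((shiftA A)^[k] z))) := (measurable_rInv ν k).mul
      (hg.comp ((measurable_prQ q).comp (measurable_iter_shiftA k)))
    rw [e1, lintegral_mul_const _ hgm]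
    refine (mul_le_mul_left (peel_box q hν hkm z' hg) _).trans ?_
    have hms := measurableSet_cylA (prQ q ((shiftA A)^[k] z')) (m - k)
    have e2 := gLik_lintegral (ν := μ) (mp_prQ q hν) k (prQ q z')
      (h := (cylA (prQ q ((shiftA A)^[k] z')) (m - k)).indicator 1)
      (measurable_one.indicator hms)
    have e3 : ∀ y, (cylA (prQ q ((shiftA A)^[k] z')) (m - k)).indicator (gLik μ k (prQ q z')) y =
      gLik μ k (prQ q z') y * (cylA (prQ q ((shiftA A)^[k] z')) (m - k)).indicator 1 y := by
      intro y
      by_cases hy : y ∈ cylA (prQ q ((shiftA A)^[k] z')) (m - k)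
      · simp [hy]
      · simp [hy]
    rw [← hμ, lintegral_congr e3, ← e2]
    have e4 : ∀ y, (cylA (prQ q z') k).indicator (fun y =>
        (cylA (prQ q ((shiftA A)^[k] z')) (m - k)).indicator (1 : SeqSpace B → ℝ≥0∞) ((shiftA B)^[k] y)) y =
        (cylA (prQ q z') m).indicator 1 y := by
      intro y
      have := mem_cylA_add hkm y (prQ q z')
      rw [← prQ_iter] at this
      by_cases h1 : y ∈ cylA (prQ q z') k
      · by_cases h2 : (shiftA B)^[k] y ∈ cylA (prQ q ((shiftA A)^[k] z')) (m - k)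
        · simp [h1, h2, this]
        · simp [h1, h2, this]
      · simp [h1, this]
    rw [lintegral_congr e4, lintegral_indicator_one (measurableSet_cylA _ _)]
    exact ENNReal.mul_inv_le_one _
  · rw [sum_fibers ν (measurable_rBox q k m), measure_univ]

end
end

noncomputable section

lemma cylA_congr {A : Type*} {z z' : SeqSpace A} {n : ℕ} (h : z ∈ cylA z' n) :
    cylA z n = cylA z' n := by
  ext y
  simp only [cylA, mem_ofPred_eq] at h ⊢
  exact ⟨fun h' i hi => (h' i hi).trans (h i hi), fun h' i hi => (h' i hi).trans (h i hi).symm⟩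

lemma cylA_anti {A : Type*} {z : SeqSpace A} {n m : ℕ} (h : n ≤ m) :
    cylA z m ⊆ cylA z n := by
  intro y hy
  simp only [cylA, mem_ofPred_eq] at hy ⊢
  exact fun i hi => hy i (by omega)

section
variable {A B : Type*} [Fintype A] [MeasurableSpace A] [MeasurableSingletonClass A]
  [Fintype B] [MeasurableSpace B] [MeasurableSingletonClass B]

/-- level-K conditional probability -/
def pK (ν : Measure (SeqSpace A)) (K : ℕ) (z : SeqSpace A) : ℝ≥0∞ :=
  ν (cylA z (K + 1)) * (ν (cylA (shiftA A z) K))⁻¹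

/-- product of level-K conditional probabilities -/
def prodK (ν : Measure (SeqSpace A)) (K j : ℕ) (z : SeqSpace A) : ℝ≥0∞ :=
  ∏ i ∈ Finset.range j, pK ν K ((shiftA A)^[i] z)

lemma prodK_succ (ν : Measure (SeqSpace A)) (K j : ℕ) (z : SeqSpace A) :
    prodK ν K (j + 1) z = pK ν K z * prodK ν K j (shiftA A z) := by
  rw [prodK, Finset.prod_range_succ', mul_comm]; rfl

lemma pK_congr (ν : Measure (SeqSpace A)) (K : ℕ) {z z' : SeqSpace A} (h : z ∈ cylA z' (K + 1)) :
    pK ν K z = pK ν K z' := by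
  rw [pK, pK, cylA_congr h, cylA_congr ((mem_cylA_succ _ _ _).1 h).2]

lemma prodK_congr (ν : Measure (SeqSpace A)) (K j : ℕ) {z z' : SeqSpace A}
    (h : z ∈ cylA z' (K + j)) : prodK ν K j z = prodK ν K j z' := by
  induction j generalizing z z' with
  | zero => simp [prodK]
  | succ j ih =>
    rw [prodK_succ, prodK_succ, pK_congr ν K (cylA_anti (by omega) h),
      ih ((mem_cylA_succ _ _ _).1 h).2]

lemma prodK_congr' (ν : Measure (SeqSpace A)) (K n : ℕ) {z z' : SeqSpace A}
    (h : z ∈ cylA z' n) : prodK ν K (n - K) z = prodK ν K (n - K) z' := by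
  by_cases hn : K ≤ n
  · exact prodK_congr ν K _ (cylA_anti (by omega) h)
  · simp [prodK, Nat.sub_eq_zero_of_le (by omega : n ≤ K)]

/-- extension of a word -/
def extA (a0 : A) (n : ℕ) (u : Fin n → A) : SeqSpace A := fun i => if h : i < n then u ⟨i, h⟩ else a0

lemma extA_cons (a0 a : A) (n : ℕ) (u : Fin n → A) :
    extA a0 (n + 1) (Fin.cons a u) = consS a (extA a0 n u) := by
  ext i
  cases i with
  | zero => simp [extA, consS, Fin.cons]
  | succ i =>
    simp only [extA, consS]
    by_cases h : i < n
    · rw [dif_pos h, dif_pos (by omega)]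
      exact Fin.cons_succ (α := fun _ => A) a u ⟨i, h⟩
    · rw [dif_neg h, dif_neg (by omega)]

lemma mem_extA (a0 : A) (n : ℕ) (z : SeqSpace A) : z ∈ cylA (extA a0 n (preA n z)) n := by
  simp only [cylA, extA, preA, mem_ofPred_eq]
  intro i hi
  rw [dif_pos hi]

variable {ν : Measure (SeqSpace A)} [IsProbabilityMeasure ν]

lemma sum_pK (hν : MeasurePreserving (shiftA A) ν ν) (K : ℕ) (y : SeqSpace A) :
    ∑ a, pK ν K (consS a y) ≤ 1 := by
  have h1 : ∀ a, ν (cylA (consS a y) (K + 1)) =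
      (ν.restrict (shiftA A ⁻¹' cylA y K)) ((fun z => z 0) ⁻¹' {a}) := by
    intro a
    rw [Measure.restrict_apply ((measurable_pi_apply 0) (measurableSet_singleton a))]
    congr 1
    ext z
    rw [mem_cylA_succ]
    rfl
  simp only [pK, shift_consS]
  rw [← Finset.sum_mul]
  simp_rw [h1]
  rw [sum_fibers (ν.restrict (shiftA A ⁻¹' cylA y K)) (measurable_pi_apply 0),
    Measure.restrict_apply_univ, hν.measure_preimage (measurableSet_cylA _ _).nullMeasurableSet]
  exact ENNReal.mul_inv_le_one _

lemma sum_prodK (hν : MeasurePreserving (shiftA A) ν ν) (K j : ℕ) (a0 : A) :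
    ∑ u : Fin (K + j) → A, prodK ν K j (extA a0 (K + j) u) ≤ (Fintype.card A : ℝ≥0∞) ^ K := by
  classical
  induction j with
  | zero => simp [prodK]
  | succ j ih =>
    refine le_trans ?_ ih
    have e := Fintype.sum_equiv (Fin.consEquiv (fun _ : Fin (K + j + 1) => A)).symm
      (fun u => prodK ν K (j + 1) (extA a0 (K + j + 1) u))
      (fun p => prodK ν K (j + 1) (extA a0 (K + j + 1) (Fin.cons p.1 p.2))) (by
        intro u
        congr 2
        exact (Fin.cons_self_tail u).symm)
    change ∑ u : Fin (K + j + 1) → A, prodK ν K (j + 1) (extA a0 (K + j + 1) u) ≤ _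
    rw [e, Fintype.sum_prod_type_right]
    refine Finset.sum_le_sum fun u _ => ?_
    simp_rw [extA_cons, prodK_succ, shift_consS]
    rw [← Finset.sum_mul]
    exact (mul_le_mul_left (sum_pK hν K _) _).trans (by simp)

lemma sum_prodK' (hν : MeasurePreserving (shiftA A) ν ν) (K n : ℕ) (a0 : A) :
    ∑ u : Fin n → A, prodK ν K (n - K) (extA a0 n u) ≤ (Fintype.card A : ℝ≥0∞) ^ K := by
  by_cases hn : K ≤ n
  · obtain ⟨j, rfl⟩ := Nat.exists_eq_add_of_le hn
    simpa using sum_prodK hν K j a0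
  · classical
    simp only [prodK, Nat.sub_eq_zero_of_le (by omega : n ≤ K), Finset.range_zero,
      Finset.prod_empty, Finset.sum_const, Finset.card_univ, nsmul_eq_mul, mul_one]
    simp only [Fintype.card_pi, Finset.prod_const, Finset.card_univ, Fintype.card_fin]
    push_cast
    refine pow_le_pow_right₀ ?_ (by omega)
    have : 0 < Fintype.card A := Fintype.card_pos_iff.2 ⟨a0⟩
    exact_mod_cast this

lemma m_low (q : A → B) (hν : MeasurePreserving (shiftA A) ν ν) (K : ℕ) {n m : ℕ} (hnm : n ≤ m) :
    ∫⁻ z, (prodK ν K (n - K) z *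
      prodK (ν.map (prQ q)) K (m - n - K) (prQ q ((shiftA A)^[n] z))) * (ν (box q n m z))⁻¹ ∂ν ≤
      (Fintype.card A : ℝ≥0∞) ^ K * (Fintype.card B : ℝ≥0∞) ^ K := by
  have hne : Nonempty (SeqSpace A) := nonempty_of_isProbabilityMeasure ν
  obtain ⟨z0⟩ := hne
  set μ := ν.map (prQ q) with hμ
  have hμm := mp_prQ q hν
  let r : SeqSpace A → (Fin n → A) × (Fin (m - n) → B) :=
    fun z => (preA n z, preA (m - n) (prQ q ((shiftA A)^[n] z)))
  have hr : Measurable r := (measurable_preA n).prodMk ((measurable_preA _).comp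
    ((measurable_prQ q).comp (measurable_iter_shiftA n)))
  have h1 : ∀ z, box q n m z = r ⁻¹' {r z} := by
    intro z
    ext z'
    rw [mem_box_iff q hnm, cylA_eq_pre, cylA_eq_pre]
    simp [r]
  let F : (Fin n → A) × (Fin (m - n) → B) → ℝ≥0∞ := fun i =>
    prodK ν K (n - K) (extA (z0 0) n i.1) * prodK μ K (m - n - K) (extA (q (z0 0)) (m - n) i.2)
  have h2 : ∀ z, (prodK ν K (n - K) z * prodK μ K (m - n - K) (prQ q ((shiftA A)^[n] z))) *
      (ν (box q n m z))⁻¹ = F (r z) * (ν (r ⁻¹' {r z}))⁻¹ := by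
    intro z
    rw [h1]
    simp only [F, r]
    rw [← prodK_congr' ν K n (mem_extA (z0 0) n z),
      ← prodK_congr' μ K (m - n) (mem_extA (q (z0 0)) (m - n) (prQ q ((shiftA A)^[n] z)))]
  rw [lintegral_congr h2]
  refine (low_fibers ν hr F).trans ?_
  rw [Fintype.sum_prod_type]
  simp only [F]
  rw [← Fintype.sum_mul_sum]
  exact mul_le_mul' (sum_prodK' hν K n _) (sum_prodK' hμm K (m - n) _)

lemma measurable_prodK (ν : Measure (SeqSpace A)) (K j : ℕ) : Measurable (prodK ν K j) := by
  have h : ∀ n, Measurable (fun z => ν (cylA z n)) := by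
    intro n
    have : (fun z => ν (cylA z n)) = (fun u => ν (preA n ⁻¹' {u})) ∘ preA n := by
      ext z; simp [cylA_eq_pre]
    rw [this]
    exact (measurable_of_finite _).comp (measurable_preA n)
  have : Measurable (pK ν K) := (h _).mul (((h K).comp measurable_shiftA).inv)
  exact Finset.measurable_fun_prod _ fun i _ => this.comp (measurable_iter_shiftA i)

/-- Birkhoff sums -/
def SB (f : SeqSpace A → ℝ) (n : ℕ) (z : SeqSpace A) : ℝ :=
  ∑ i ∈ Finset.range n, f ((shiftA A)^[i] z)

lemma SB_add (f : SeqSpace A → ℝ) (n m : ℕ) (z : SeqSpace A) :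
    SB f (n + m) z = SB f n z + SB f m ((shiftA A)^[n] z) := by
  simp only [SB, Finset.sum_range_add, ← Function.iterate_add_apply]
  congr 1
  refine Finset.sum_congr rfl fun i _ => ?_
  rw [Nat.add_comm]

lemma ae_iter {A : Type*} [MeasurableSpace A] {ν : Measure (SeqSpace A)}
    (hν : MeasurePreserving (shiftA A) ν ν) {p : SeqSpace A → Prop}
    (h : ∀ᵐ z ∂ν, p z) : ∀ᵐ z ∂ν, ∀ i, p ((shiftA A)^[i] z) :=
  ae_all_iff.2 fun i => (hν.iterate i).quasiMeasurePreserving.ae h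

lemma ae_rInv (hν : MeasurePreserving (shiftA A) ν ν) :
    ∀ᵐ z ∂ν, ∀ k, rInv ν k z = ENNReal.ofReal (Real.exp (SB (lInf ν) k z)) ∧
      ∏ i ∈ Finset.range k, pInf ν ((shiftA A)^[i] z) =
        ENNReal.ofReal (Real.exp (-SB (lInf ν) k z)) := by
  filter_upwards [ae_iter hν (ae_pInf hν)] with z hz k
  have hp : ∀ i, pInf ν ((shiftA A)^[i] z) = ENNReal.ofReal (Real.exp (-lInf ν ((shiftA A)^[i] z))) := by
    intro i
    obtain ⟨h0, h1⟩ := hz i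
    have ht : pInf ν ((shiftA A)^[i] z) ≠ ∞ := ne_top_of_le_ne_top ENNReal.one_ne_top h1
    rw [lInf, neg_neg, Real.exp_log (ENNReal.toReal_pos h0 ht), ENNReal.ofReal_toReal ht]
  constructor
  · rw [rInv, SB, Real.exp_sum, ENNReal.ofReal_prod_of_nonneg fun i _ => (Real.exp_pos _).le]
    refine Finset.prod_congr rfl fun i _ => ?_
    rw [hp, ← ENNReal.ofReal_inv_of_pos (Real.exp_pos _), Real.exp_neg, inv_inv]
  · rw [SB, ← Finset.sum_neg_distrib, Real.exp_sum,
      ENNReal.ofReal_prod_of_nonneg fun i _ => (Real.exp_pos _).le]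
    exact Finset.prod_congr rfl fun i _ => hp _

lemma ae_prodK (hν : MeasurePreserving (shiftA A) ν ν) (K : ℕ) :
    ∀ᵐ z ∂ν, ∀ j, prodK ν K j z = ENNReal.ofReal (Real.exp (-SB (lK ν K) j z)) := by
  have h : ∀ᵐ z ∂ν, pK ν K z = ENNReal.ofReal (Real.exp (-lK ν K z)) := by
    filter_upwards [ae_mc_pos ν (K + 1),
      hν.quasiMeasurePreserving.ae (ae_mc_pos ν K)] with z hz1 hz2
    have e : -lK ν K z = Real.log (mc ν (K + 1) z / mc ν K (shiftA A z)) := by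
      rw [Real.log_div hz1.ne' hz2.ne', lK]; ring
    rw [e, Real.exp_log (by positivity), div_eq_mul_inv, ENNReal.ofReal_mul hz1.le,
      ENNReal.ofReal_inv_of_pos hz2, mc, mc, ENNReal.ofReal_toReal (measure_ne_top _ _),
      ENNReal.ofReal_toReal (measure_ne_top _ _), pK]
  filter_upwards [ae_iter hν h] with z hz j
  rw [prodK, SB, ← Finset.sum_neg_distrib, Real.exp_sum,
    ENNReal.ofReal_prod_of_nonneg fun i _ => (Real.exp_pos _).le]
  exact Finset.prod_congr rfl fun i _ => hz i

end
end

noncomputable section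

section
variable {A B : Type*} [Fintype A] [MeasurableSpace A] [MeasurableSingletonClass A]
  [Fintype B] [MeasurableSpace B] [MeasurableSingletonClass B]
  {ν : Measure (SeqSpace A)} [IsProbabilityMeasure ν]

lemma birk_A (hν : Ergodic (shiftA A) ν) {f : SeqSpace A → ℝ} (hfm : Measurable f)
    (hf : Integrable f ν) {ε : ℝ} (hε : 0 < ε) :
    ∀ᵐ z ∂ν, ∀ᶠ n : ℕ in atTop, |SB f n z - n * ∫ x, f x ∂ν| ≤ n * ε :=
  birkhoff_ae hν hfm hf hε

lemma birk_B (q : A → B) (hν : Ergodic (shiftA A) ν) {f : SeqSpace B → ℝ} (hfm : Measurable f)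
    (hf : Integrable f (ν.map (prQ q))) {ε : ℝ} (hε : 0 < ε) :
    ∀ᵐ z ∂ν, ∀ᶠ n : ℕ in atTop,
      |SB f n (prQ q z) - n * ∫ x, f x ∂(ν.map (prQ q))| ≤ n * ε := by
  have h1 : Integrable (fun z => f (prQ q z)) ν := hf.comp_measurable (measurable_prQ q)
  have h2 := birkhoff_ae hν (hfm.comp (measurable_prQ q)) h1 hε
  rw [integral_map (measurable_prQ q).aemeasurable hfm.aestronglyMeasurable]
  filter_upwards [h2] with z hz
  filter_upwards [hz] with n hn
  simpa [SB, prQ_iter] using hn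

theorem box_upper (q : A → B) (hν : Ergodic (shiftA A) ν) {h h' : ℝ}
    (hent : Tendsto (entropySeqA ν) atTop (nhds h))
    (hent' : Tendsto (entropySeqA (ν.map (prQ q))) atTop (nhds h')) {ε : ℝ} (hε : 0 < ε) :
    ∀ᵐ z ∂ν, ∃ n0 : ℕ, ∀ k ≥ n0, ∀ m ≥ k, ν (box q k m z) ≤
      ENNReal.ofReal (Real.exp (-(k * h) - (m - k) * h' + ε * m)) := by
  have hmp := hν.toMeasurePreserving
  have hmp' := mp_prQ q hmp
  set μ := ν.map (prQ q) with hμ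
  obtain ⟨i1, i2, -⟩ := entropy_main hmp hent
  obtain ⟨j1, j2, -⟩ := entropy_main hmp' hent'
  have hε4 : 0 < ε / 4 := by positivity
  have b1 := birk_A hν (measurable_lInf ν) i1 hε4
  have b2 := birk_B q hν (measurable_lInf μ) j1 hε4
  rw [i2] at b1
  rw [j2] at b2
  have b3 := bc_pairs ν (fun k m z => ν (box q k m z) * (rInv ν k z *
      rInv μ (m - k) (prQ q ((shiftA A)^[k] z)))) (fun k m => by
        have : Measurable (fun z => ν (box q k m z)) := by
          simp_rw [box_eq]
          exact (measurable_of_finite (fun i => ν (rBox q k m ⁻¹' {i}))).comp (measurable_rBox q k m)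
        exact this.mul ((measurable_rInv ν k).mul ((measurable_rInv μ _).comp
          ((measurable_prQ q).comp (measurable_iter_shiftA k))))) 1 ENNReal.one_ne_top
      (fun k m hkm => m_up q hmp hkm) hε4
  have b4 : ∀ᵐ z ∂ν, ∀ n, ∀ k, rInv μ k ((shiftA B)^[n] (prQ q z)) =
      ENNReal.ofReal (Real.exp (SB (lInf μ) k ((shiftA B)^[n] (prQ q z)))) := by
    have := ae_of_ae_map (measurable_prQ q).aemeasurable (ae_iter hmp' (ae_rInv hmp'))
    filter_upwards [this] with z hz n k
    exact (hz n k).1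
  filter_upwards [b1, b2, b3, b4, ae_rInv hmp] with z h1 h2 h3 h4 h5
  obtain ⟨n1, h1⟩ := eventually_atTop.1 h1
  obtain ⟨n2, h2⟩ := eventually_atTop.1 h2
  obtain ⟨n3, h3⟩ := h3
  refine ⟨max n1 (max n2 n3), fun k hk m hkm => ?_⟩
  simp only [ge_iff_le, max_le_iff] at hk
  have a1 := (abs_le.1 (h1 k hk.1)).1
  have a2 := (abs_le.1 (h2 k hk.2.1)).2
  have a3 := (abs_le.1 (h2 m (by omega))).1
  have a4 := h3 m (by omega) k hkm
  rw [prQ_iter, h4, (h5 k).1] at a4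
  have a5 : SB (lInf μ) m (prQ q z) = SB (lInf μ) k (prQ q z) +
      SB (lInf μ) (m - k) ((shiftA B)^[k] (prQ q z)) := by
    rw [← SB_add]; congr 1; omega
  rw [← ENNReal.ofReal_mul (by positivity), ← Real.exp_add] at a4
  set s := SB (lInf ν) k z + SB (lInf μ) (m - k) ((shiftA B)^[k] (prQ q z)) with hs
  have a6 : ν (box q k m z) ≤ ENNReal.ofReal (Real.exp (ε / 4 * m)) *
      ENNReal.ofReal (Real.exp (-s)) := by
    have e : ENNReal.ofReal (Real.exp s) * ENNReal.ofReal (Real.exp (-s)) = 1 := by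
      rw [← ENNReal.ofReal_mul (by positivity), ← Real.exp_add]; simp
    calc ν (box q k m z) = ν (box q k m z) * ENNReal.ofReal (Real.exp s) *
          ENNReal.ofReal (Real.exp (-s)) := by rw [mul_assoc, e, mul_one]
      _ ≤ _ := by gcongr
  refine a6.trans ?_
  rw [← ENNReal.ofReal_mul (by positivity), ← Real.exp_add]
  refine ENNReal.ofReal_le_ofReal (Real.exp_le_exp.2 ?_)
  have hkm' : (k:ℝ) * (ε/4) ≤ m * (ε/4) := by gcongr
  nlinarith

theorem box_lower (q : A → B) (hν : Ergodic (shiftA A) ν) {h h' : ℝ}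
    (hent : Tendsto (entropySeqA ν) atTop (nhds h))
    (hent' : Tendsto (entropySeqA (ν.map (prQ q))) atTop (nhds h')) {ε : ℝ} (hε : 0 < ε) :
    ∀ᵐ z ∂ν, ∃ n0 : ℕ, ∀ k ≥ n0, ∀ m ≥ k,
      ENNReal.ofReal (Real.exp (-(k * h) - (m - k) * h' - ε * m)) ≤ ν (box q k m z) := by
  have hmp := hν.toMeasurePreserving
  have hmp' := mp_prQ q hmp
  have h0 := entropy_nonneg hent
  have h0' := entropy_nonneg hent'
  set μ := ν.map (prQ q) with hμ
  obtain ⟨-, -, i3⟩ := entropy_main hmp hent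
  obtain ⟨-, -, j3⟩ := entropy_main hmp' hent'
  have hε4 : 0 < ε / 8 := by positivity
  obtain ⟨K, hK1, hK2⟩ : ∃ K, ∫ z, lK ν K z ∂ν < h + ε / 8 ∧ ∫ z, lK μ K z ∂μ < h' + ε / 8 :=
    ((i3.eventually (gt_mem_nhds (by linarith))).and
      (j3.eventually (gt_mem_nhds (by linarith)))).exists
  have b1 := birk_A hν (measurable_lK ν K) (integral_lK hmp K).1 hε4
  have b2 := birk_B q hν (measurable_lK μ K) (integral_lK hmp' K).1 hε4
  rw [← hμ] at b2
  set D := ∫ z, lK ν K z ∂ν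
  set D' := ∫ z, lK μ K z ∂μ
  have b3 := bc_pairs ν (fun k m z => (prodK ν K (k - K) z *
      prodK μ K (m - k - K) (prQ q ((shiftA A)^[k] z))) * (ν (box q k m z))⁻¹) (fun k m => by
        have : Measurable (fun z => (ν (box q k m z))⁻¹) := by
          simp_rw [box_eq]
          exact (measurable_of_finite (fun i => (ν (rBox q k m ⁻¹' {i}))⁻¹)).comp (measurable_rBox q k m)
        exact ((measurable_prodK ν K _).mul ((measurable_prodK μ K _).comp
          ((measurable_prQ q).comp (measurable_iter_shiftA k)))).mul this)
      ((Fintype.card A : ℝ≥0∞) ^ K * (Fintype.card B : ℝ≥0∞) ^ K)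
      (ENNReal.mul_ne_top (by finiteness) (by finiteness))
      (fun k m hkm => m_low q hmp K hkm) hε4
  have b4 : ∀ᵐ z ∂ν, ∀ n, ∀ k, prodK μ K k ((shiftA B)^[n] (prQ q z)) =
      ENNReal.ofReal (Real.exp (-SB (lK μ K) k ((shiftA B)^[n] (prQ q z)))) :=
    ae_of_ae_map (measurable_prQ q).aemeasurable (ae_iter hmp' (ae_prodK hmp' K))
  filter_upwards [b1, b2, b3, b4, ae_prodK hmp K] with z h1 h2 h3 h4 h5
  obtain ⟨n1, h1⟩ := eventually_atTop.1 h1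
  obtain ⟨n2, h2⟩ := eventually_atTop.1 h2
  obtain ⟨n3, h3⟩ := h3
  refine ⟨max (n1 + K) (max n2 n3), fun k hk m hkm => ?_⟩
  simp only [ge_iff_le, max_le_iff] at hk
  have a1 := (abs_le.1 (h1 (k - K) (by omega))).2
  have a4 := h3 m (by omega) k hkm
  rw [prQ_iter, h4, h5, ← ENNReal.ofReal_mul (by positivity), ← Real.exp_add] at a4
  have hkm' : (k:ℝ) ≤ m := by exact_mod_cast hkm
  have hKk : ((k - K : ℕ) : ℝ) ≤ k := by exact_mod_cast Nat.sub_le _ _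
  have c1 : SB (lK ν K) (k - K) z ≤ k * h + 2 * (ε / 8) * m := by
    have hp : (0:ℝ) ≤ ((k - K : ℕ) : ℝ) := by positivity
    nlinarith
  have c2 : SB (lK μ K) (m - k - K) ((shiftA B)^[k] (prQ q z)) ≤ (m - k) * h' + 3 * (ε / 8) * m := by
    by_cases hmk : K ≤ m - k
    · have a5 : SB (lK μ K) (m - K) (prQ q z) = SB (lK μ K) k (prQ q z) +
        SB (lK μ K) (m - k - K) ((shiftA B)^[k] (prQ q z)) := by
        rw [← SB_add]; congr 1; omega
      have a2 := (abs_le.1 (h2 (m - K) (by omega))).2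
      have a3 := (abs_le.1 (h2 k (by omega))).1
      have e1 : ((m - K : ℕ) : ℝ) = m - K := by rw [Nat.cast_sub (by omega)]
      have e2 : (K:ℝ) ≤ m - k := by
        have : (K:ℝ) + k ≤ m := by exact_mod_cast (by omega : K + k ≤ m)
        linarith
      rw [e1] at a2
      have hKp : (0:ℝ) ≤ K := by positivity
      have f1 : ((m:ℝ) - K - k) * D' ≤ (m - K - k) * (h' + ε / 8) :=
        mul_le_mul_of_nonneg_left hK2.le (by linarith)
      have f2 : (k:ℝ) * (ε / 8) ≤ m * (ε/8) := by gcongr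
      nlinarith
    · rw [Nat.sub_eq_zero_of_le (by omega : m - k ≤ K)]
      simp only [SB, Finset.range_zero, Finset.sum_empty]
      have : (0:ℝ) ≤ (m - k) * h' := mul_nonneg (by linarith) h0'
      positivity
  set s := -SB (lK ν K) (k - K) z + -SB (lK μ K) (m - k - K) ((shiftA B)^[k] (prQ q z)) with hs
  have hpos : ν (box q k m z) ≠ 0 := by
    intro hc
    rw [hc, ENNReal.inv_zero, ENNReal.mul_top (by simp [Real.exp_pos])] at a4
    exact absurd a4 (by simp)
  have a6 : ENNReal.ofReal (Real.exp s) ≤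
      ENNReal.ofReal (Real.exp (ε / 8 * m)) * ν (box q k m z) := by
    rw [← ENNReal.div_le_iff hpos (measure_ne_top _ _), div_eq_mul_inv]
    exact a4
  have e : ENNReal.ofReal (Real.exp (-(ε / 8 * m))) * ENNReal.ofReal (Real.exp (ε / 8 * m)) = 1 := by
    rw [← ENNReal.ofReal_mul (by positivity), ← Real.exp_add]; simp
  calc ENNReal.ofReal (Real.exp (-(k * h) - (m - k) * h' - ε * m))
      ≤ ENNReal.ofReal (Real.exp (-(ε / 8 * m))) * ENNReal.ofReal (Real.exp s) := by
        rw [← ENNReal.ofReal_mul (by positivity), ← Real.exp_add]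
        refine ENNReal.ofReal_le_ofReal (Real.exp_le_exp.2 ?_)
        have : (0:ℝ) ≤ ε * m := by positivity
        linarith
    _ ≤ ENNReal.ofReal (Real.exp (-(ε / 8 * m))) *
        (ENNReal.ofReal (Real.exp (ε / 8 * m)) * ν (box q k m z)) := by gcongr
    _ = ν (box q k m z) := by rw [← mul_assoc, e, one_mul]

end
end

noncomputable section

section
variable {A : Type*} {Ω : Type*} 

/-- weights along a path -/
def xE (X : List A → Ω → ℝ) (z : SeqSpace A) (j : ℕ) (ω : Ω) : ℝ≥0∞ :=
  ENNReal.ofReal (X (wordPrefixA z (j + 1)) ω)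

/-- cascade density along a path -/
def yE (X : List A → Ω → ℝ) (z : SeqSpace A) (N : ℕ) (ω : Ω) : ℝ≥0∞ :=
  ENNReal.ofReal (cascadeYA X (wordPrefixA z N) ω)

lemma wordPrefix_length (z : SeqSpace A) (n : ℕ) : (wordPrefixA z n).length = n := by
  simp [wordPrefixA]

lemma wordPrefix_take (z : SeqSpace A) {n k : ℕ} (h : k ≤ n) :
    (wordPrefixA z n).take k = wordPrefixA z k := by
  apply List.ext_getElem
  · simp [wordPrefixA, h]
  · intro i h1 h2
    simp [wordPrefixA]

lemma wordPrefix_eq_iff (z z' : SeqSpace A) (n : ℕ) :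
    wordPrefixA z n = wordPrefixA z' n ↔ z ∈ cylA z' n := by
  rw [wordPrefixA, wordPrefixA, List.ofFn_inj, cylA_eq_pre]
  rfl

lemma wordPrefix_ne (z : SeqSpace A) (n : ℕ) : wordPrefixA z (n + 1) ≠ [] := by
  intro h
  have := wordPrefix_length z (n + 1)
  rw [h] at this
  simp at this

/-- prefix as a nonempty word -/
def wp (z : SeqSpace A) (j : ℕ) : {w : List A // w ≠ []} := ⟨wordPrefixA z (j + 1), wordPrefix_ne z j⟩

lemma wp_eq {z z' : SeqSpace A} {i j : ℕ} (h : wp z i = wp z' j) : i = j ∧ z ∈ cylA z' (i + 1) := by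
  have h1 : wordPrefixA z (i + 1) = wordPrefixA z' (j + 1) := congrArg Subtype.val h
  have h2 : i = j := by
    have := congrArg List.length h1
    rw [wordPrefix_length, wordPrefix_length] at this
    omega
  subst h2
  exact ⟨rfl, (wordPrefix_eq_iff _ _ _).1 h1⟩

lemma yE_congr (X : List A → Ω → ℝ) {z z' : SeqSpace A} {N : ℕ} (h : z ∈ cylA z' N) (ω : Ω) :
    yE X z N ω = yE X z' N ω := by
  rw [yE, yE, (wordPrefix_eq_iff _ _ _).2 h]

lemma yE_prod {X : List A → Ω → ℝ} (hX : ∀ w ω, 0 ≤ X w ω) (z : SeqSpace A) (N : ℕ) (ω : Ω) :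
    yE X z N ω = ∏ j ∈ Finset.range N, xE X z j ω := by
  rw [yE, cascadeYA, ENNReal.ofReal_prod_of_nonneg fun _ _ => hX _ _, wordPrefix_length]
  refine Finset.prod_congr rfl fun j hj => ?_
  rw [xE, wordPrefix_take z (by simpa using hj)]

variable [MeasurableSpace Ω]

/-- sigma-algebra generated by some weights -/
@[reducible] def sig (X : List A → Ω → ℝ) (S : Set {w : List A // w ≠ []}) : MeasurableSpace Ω :=
  ⨆ w ∈ S, MeasurableSpace.comap (X w.1) inferInstance

lemma sig_mono (X : List A → Ω → ℝ) {S T : Set {w : List A // w ≠ []}} (h : S ⊆ T) :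
    sig X S ≤ sig X T := biSup_mono h

variable [MeasurableSpace A] {P : Measure Ω} [IsProbabilityMeasure P] {X : List A → Ω → ℝ}
  {X₀ : Ω → ℝ}

lemma sig_le (hM : CascadeM1A P X X₀) (S : Set {w : List A // w ≠ []}) :
    sig X S ≤ (inferInstance : MeasurableSpace Ω) :=
  iSup₂_le fun w _ => (hM.meas w.1).comap_le

lemma meas_sig (X : List A → Ω → ℝ) (S : Set {w : List A // w ≠ []}) {w : {w : List A // w ≠ []}}
    (hw : w ∈ S) : Measurable[sig X S] (X w.1) := by
  have h1 : MeasurableSpace.comap (X w.1) inferInstance ≤ sig X S :=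
    le_iSup₂ (f := fun (w : {w : List A // w ≠ []}) (_ : w ∈ S) =>
      MeasurableSpace.comap (X w.1) inferInstance) w hw
  exact (comap_measurable (X w.1)).mono h1 le_rfl

lemma lint_X0 (hM : CascadeM1A P X X₀) : ∫⁻ ω, ENNReal.ofReal (X₀ ω) ∂P = 1 := by
  have hi : Integrable X₀ P := by
    by_contra h
    have := integral_undef h
    rw [hM.mean₀] at this
    exact one_ne_zero this
  rw [← ofReal_integral_eq_lintegral_ofReal hi (Eventually.of_forall hM.nonneg₀), hM.mean₀]
  simp

lemma lint_X (hM : CascadeM1A P X X₀) {w : List A} (hw : w ≠ []) :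
    ∫⁻ ω, ENNReal.ofReal (X w ω) ∂P = 1 := by
  rw [← lint_X0 hM]
  exact ((hM.ident w hw).comp ENNReal.measurable_ofReal).lintegral_eq

lemma indep_step (hM : CascadeM1A P X X₀) (S : Set {w : List A // w ≠ []})
    {w : {w : List A // w ≠ []}} (hw : w ∉ S) {f : Ω → ℝ≥0∞} (hf : Measurable[sig X S] f) :
    ∫⁻ ω, f ω * ENNReal.ofReal (X w.1 ω) ∂P = ∫⁻ ω, f ω ∂P := by
  have hI : iIndep (fun w : {w : List A // w ≠ []} =>
      MeasurableSpace.comap (X w.1) (inferInstance : MeasurableSpace ℝ)) P :=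
    (iIndepFun_iff_iIndep _ _ _).1 hM.indep
  have hind : Indep (sig X S) (sig X {w}) P :=
    indep_iSup_of_disjoint (m := fun w : {w : List A // w ≠ []} =>
      MeasurableSpace.comap (X w.1) (inferInstance : MeasurableSpace ℝ))
      (fun i => (hM.meas i.1).comap_le) hI
      (Set.disjoint_singleton_right.2 hw : Disjoint S {w})
  have hg : Measurable[sig X {w}] (fun ω => ENNReal.ofReal (X w.1 ω)) :=
    ENNReal.measurable_ofReal.comp (meas_sig X {w} rfl)
  have := lintegral_mul_eq_lintegral_mul_lintegral_of_independent_measurableSpace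
    (sig_le hM S) (sig_le hM {w}) hind hf hg
  rw [this, lint_X hM w.2, mul_one]

lemma meas_xE (X : List A → Ω → ℝ) {S : Set {w : List A // w ≠ []}} {z : SeqSpace A} {j : ℕ}
    (h : wp z j ∈ S) : Measurable[sig X S] (xE X z j) :=
  ENNReal.measurable_ofReal.comp (meas_sig X S h)

lemma indep_path (hM : CascadeM1A P X X₀) (S : Set {w : List A // w ≠ []}) (z : SeqSpace A)
    (c N : ℕ) (hS : ∀ j, c ≤ j → j < N → wp z j ∉ S) {f : Ω → ℝ≥0∞} (hf : Measurable[sig X S] f) :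
    ∫⁻ ω, f ω * ∏ j ∈ Finset.Ico c N, xE X z j ω ∂P = ∫⁻ ω, f ω ∂P := by
  induction N with
  | zero => simp
  | succ N ih =>
    by_cases hcN : c ≤ N
    · rw [← ih fun j h1 h2 => hS j h1 (by omega)]
      simp_rw [Finset.prod_Ico_succ_top hcN, ← mul_assoc]
      let S' := S ∪ {w | ∃ j < N, w = wp z j}
      have hw : wp z N ∉ S' := by
        rintro (h | ⟨j, hj, h⟩)
        · exact hS N hcN (by omega) h
        · have := (wp_eq h).1; omega
      refine indep_step hM S' hw ?_
      refine Measurable.mul (hf.mono (sig_mono X subset_union_left) le_rfl) ?_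
      refine Finset.measurable_fun_prod _ fun j hj => meas_xE X ?_
      simp only [Finset.mem_Ico] at hj
      exact Or.inr ⟨j, hj.2, rfl⟩
    · rw [Finset.Ico_eq_empty (by omega)]; simp

/-- the words on a path -/
def spine (z : SeqSpace A) (N : ℕ) : Set {w : List A // w ≠ []} := {w | ∃ j < N, w = wp z j}

lemma meas_yE_spine (hM : CascadeM1A P X X₀) (z : SeqSpace A) {k N : ℕ} (h : k ≤ N) :
    Measurable[sig X (spine z N)] (yE X z k) := by
  have : yE X z k = fun ω => ∏ j ∈ Finset.range k, xE X z j ω := by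
    ext ω; exact yE_prod hM.nonneg z k ω
  rw [this]
  refine Finset.measurable_fun_prod _ fun j hj => meas_xE X ?_
  simp only [Finset.mem_range] at hj
  exact ⟨j, by omega, rfl⟩

lemma meas_yE (hM : CascadeM1A P X X₀) (z : SeqSpace A) (k : ℕ) : Measurable (yE X z k) :=
  (meas_yE_spine hM z le_rfl).mono (sig_le hM _) le_rfl

lemma star_pt (hM : CascadeM1A P X X₀) (z z' : SeqSpace A) (N : ℕ) {f : Ω → ℝ≥0∞}
    (hf : Measurable[sig X (spine z N)] f) :
    ∃ k ≤ N, z' ∈ cylA z k ∧ (∀ n ≤ N, z' ∈ cylA z n → n ≤ k) ∧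
      ∫⁻ ω, f ω * yE X z' N ω ∂P = ∫⁻ ω, f ω * yE X z k ω ∂P := by
  classical
  by_cases h : z' ∈ cylA z N
  · exact ⟨N, le_rfl, h, fun n hn _ => hn, by simp_rw [yE_congr X h]⟩
  · have hex : ∃ c, z' c ≠ z c ∧ c < N := by
      by_contra hc
      push Not at hc
      apply h
      simp only [cylA, mem_ofPred_eq]
      intro i hi
      by_contra h'
      exact absurd (hc i h') (by omega)
    let c := Nat.find hex
    obtain ⟨hc1, hc2⟩ := Nat.find_spec hex
    change z' c ≠ z c at hc1
    change c < N at hc2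
    have hmem : z' ∈ cylA z c := by
      simp only [cylA, mem_ofPred_eq]
      intro i hi
      by_contra h'
      exact Nat.find_min hex hi ⟨h', by omega⟩
    refine ⟨c, hc2.le, hmem, ?_, ?_⟩
    · intro n _ hn'
      by_contra hlt
      simp only [cylA, mem_ofPred_eq] at hn'
      exact hc1 (hn' c (by omega))
    · have hfm : Measurable[sig X (spine z N)] (fun ω => f ω * yE X z c ω) :=
        hf.mul (meas_yE_spine hM z hc2.le)
      rw [← indep_path hM (spine z N) z' c N ?_ hfm]
      · refine lintegral_congr fun ω => ?_
        rw [← yE_congr X hmem, yE_prod hM.nonneg, yE_prod hM.nonneg, mul_assoc,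
          Finset.prod_range_mul_prod_Ico _ hc2.le]
      · rintro j hj1 hj2 ⟨i, hi, hij⟩
        have h1 := (wp_eq hij).2
        simp only [cylA, mem_ofPred_eq] at h1
        exact hc1 (h1 c (by omega))

lemma lint_yE (hM : CascadeM1A P X X₀) (z : SeqSpace A) (N : ℕ) : ∫⁻ ω, yE X z N ω ∂P = 1 := by
  have := indep_path hM ∅ z 0 N (fun _ _ _ => by simp) (f := fun _ => 1) measurable_const
  simp only [one_mul, lintegral_const, measure_univ, mul_one] at this
  rw [← this]
  refine lintegral_congr fun ω => ?_
  rw [yE_prod hM.nonneg]; simp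

variable [Fintype A] [MeasurableSingletonClass A]

lemma meas_joint {S α : Type*} [MeasurableSpace S] [MeasurableSpace α] {ι : Type*} [Fintype ι] [MeasurableSpace ι]
    [MeasurableSingletonClass ι] {r : S → ι} (hr : Measurable r) {F : α → ι → ℝ≥0∞}
    (hF : ∀ i, Measurable (fun a => F a i)) : Measurable (fun p : α × S => F p.1 (r p.2)) := by
  have h : Measurable (Function.uncurry F) := measurable_from_prod_countable_left hF
  exact h.comp (measurable_fst.prodMk (hr.comp measurable_snd))

/-- density as a function of the word -/
def yW (X : List A → Ω → ℝ) (N : ℕ) (ω : Ω) (u : Fin N → A) : ℝ≥0∞ :=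
  ENNReal.ofReal (cascadeYA X (List.ofFn u) ω)

lemma meas_yW (hM : CascadeM1A P X X₀) (N : ℕ) (u : Fin N → A) :
    Measurable (fun ω => yW X N ω u) := by
  refine ENNReal.measurable_ofReal.comp ?_
  exact Finset.measurable_fun_prod _ fun j _ => hM.meas _

lemma meas_yE_joint (hM : CascadeM1A P X X₀) (N : ℕ) :
    Measurable (fun p : Ω × SeqSpace A => yE X p.2 N p.1) :=
  meas_joint (measurable_preA N) (F := fun ω u => yW X N ω u) (meas_yW hM N)

lemma meas_yE_right (N : ℕ) (ω : Ω) : Measurable (fun z : SeqSpace A => yE X z N ω) :=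
  (measurable_of_finite (fun u => yW X N ω u)).comp (measurable_preA N)

/-- truncated spine sums -/
def TN {B : Type*} (q : A → B) (X : List A → Ω → ℝ) (ν : Measure (SeqSpace A)) (n m N : ℕ)
    (z : SeqSpace A) (ω : Ω) : ℝ≥0∞ :=
  ∑ k ∈ Finset.Icc n N, yE X z k ω * ν (box q k m z)

lemma meas_TN_spine {B : Type*} (q : A → B) (hM : CascadeM1A P X X₀) (ν : Measure (SeqSpace A))
    (n m N : ℕ) (z : SeqSpace A) : Measurable[sig X (spine z N)] (TN q X ν n m N z) := by
  refine Finset.measurable_fun_sum _ fun k hk => ?_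
  simp only [Finset.mem_Icc] at hk
  exact (meas_yE_spine hM z hk.2).mul_const _

lemma star {B : Type*} [Fintype B] [MeasurableSpace B] [MeasurableSingletonClass B]
    (q : A → B) (hM : CascadeM1A P X X₀) (ν : Measure (SeqSpace A)) [IsProbabilityMeasure ν]
    {n N : ℕ} (m : ℕ) (hnN : n ≤ N) (z : SeqSpace A) :
    ∫⁻ ω, yE X z N ω * ((∫⁻ z' in box q n m z, yE X z' N ω ∂ν) * (TN q X ν n m N z ω)⁻¹) ∂P ≤ 1 := by
  let f : Ω → ℝ≥0∞ := fun ω => yE X z N ω * (TN q X ν n m N z ω)⁻¹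
  have hf : Measurable[sig X (spine z N)] f :=
    (meas_yE_spine hM z le_rfl).mul (meas_TN_spine q hM ν n m N z).inv
  have hf' : Measurable f := hf.mono (sig_le hM _) le_rfl
  have e1 : ∫⁻ ω, yE X z N ω * ((∫⁻ z' in box q n m z, yE X z' N ω ∂ν) *
      (TN q X ν n m N z ω)⁻¹) ∂P = ∫⁻ z' in box q n m z, ∫⁻ ω, f ω * yE X z' N ω ∂P ∂ν := by
    rw [lintegral_lintegral_swap]
    · refine lintegral_congr fun ω => ?_
      rw [lintegral_const_mul _ (meas_yE_right N ω)]
      simp only [f]; ring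
    · exact (((hf'.comp measurable_fst).mul (meas_yE_joint hM N)).comp measurable_swap).aemeasurable
  let g : ℕ → SeqSpace A → ℝ≥0∞ := fun k => (cylA z k).indicator 1
  have hg : ∀ k, Measurable (g k) := fun k => measurable_one.indicator (measurableSet_cylA z k)
  rw [e1]
  calc ∫⁻ z' in box q n m z, ∫⁻ ω, f ω * yE X z' N ω ∂P ∂ν
      ≤ ∫⁻ z' in box q n m z, ∑ k ∈ Finset.Icc n N, (∫⁻ ω, f ω * yE X z k ω ∂P) * g k z' ∂ν := by
        refine setLIntegral_mono' (measurableSet_box q n m z) fun z' hz' => ?_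
        obtain ⟨k, hk1, hk2, hk3, hk4⟩ := star_pt hM z z' N hf
        rw [hk4]
        have hnk : n ≤ k := hk3 n hnN (by
          simp only [box, mem_ofPred_eq] at hz'
          simpa [cylA] using hz'.1)
        refine le_trans ?_ (Finset.single_le_sum
          (f := fun k => (∫⁻ ω, f ω * yE X z k ω ∂P) * g k z') (fun _ _ => zero_le)
          (Finset.mem_Icc.2 ⟨hnk, hk1⟩))
        simp [g, indicator_of_mem hk2]
    _ = ∑ k ∈ Finset.Icc n N, (∫⁻ ω, f ω * yE X z k ω ∂P) * ν (box q k m z) := by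
        rw [lintegral_finsetSum _ fun k _ => (hg k).const_mul _]
        refine Finset.sum_congr rfl fun k hk => ?_
        simp only [Finset.mem_Icc] at hk
        rw [lintegral_const_mul _ (hg k)]
        simp only [g]
        rw [lintegral_indicator_one (measurableSet_cylA z k),
          Measure.restrict_apply (measurableSet_cylA z k)]
        congr 2
        ext z'
        simp only [cylA, box, mem_inter_iff, mem_ofPred_eq]
        exact ⟨fun h => ⟨h.1, h.2.2⟩, fun h => ⟨h.1, fun i hi => h.1 i (by omega), h.2⟩⟩
    _ = ∫⁻ ω, f ω * TN q X ν n m N z ω ∂P := by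
        simp only [TN, Finset.mul_sum]
        rw [lintegral_finsetSum]
        · refine Finset.sum_congr rfl fun k _ => ?_
          have hfk : Measurable (fun ω => f ω * yE X z k ω) := hf'.mul (meas_yE hM z k)
          rw [← lintegral_mul_const _ hfk]
          refine lintegral_congr fun ω => ?_
          rw [mul_assoc]
        · exact fun k _ => hf'.mul ((meas_yE hM z k).mul_const _)
    _ ≤ ∫⁻ ω, yE X z N ω ∂P := by
        refine lintegral_mono fun ω => ?_
        simp only [f]
        rw [mul_assoc]
        calc _ ≤ yE X z N ω * 1 := by
              gcongr; rw [mul_comm]; exact ENNReal.mul_inv_le_one _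
          _ = _ := mul_one _
    _ = 1 := lint_yE hM z N

end
end

noncomputable section

section
variable {A : Type*} {Ω : Type*} [MeasurableSpace Ω] 

/-- the tilted law of the weights -/
def tiltL (P : Measure Ω) (X₀ : Ω → ℝ) : Measure ℝ := (P.map X₀).withDensity ENNReal.ofReal

variable [MeasurableSpace A] {P : Measure Ω} [IsProbabilityMeasure P] {X : List A → Ω → ℝ}
  {X₀ : Ω → ℝ}

lemma tiltL_apply (hM : CascadeM1A P X X₀) {s : Set ℝ} (hs : MeasurableSet s) :
    tiltL P X₀ s = ∫⁻ ω, ENNReal.ofReal (X₀ ω) * s.indicator 1 (X₀ ω) ∂P := by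
  rw [tiltL, withDensity_apply _ hs, ← lintegral_indicator hs,
    lintegral_map (ENNReal.measurable_ofReal.indicator hs) hM.meas₀]
  refine lintegral_congr fun ω => ?_
  by_cases h : X₀ ω ∈ s <;> simp [h]

lemma tiltL_prob (hM : CascadeM1A P X X₀) : IsProbabilityMeasure (tiltL P X₀) := by
  constructor
  rw [tiltL_apply hM MeasurableSet.univ]
  simpa using lint_X0 hM

lemma tilt_pi (hM : CascadeM1A P X X₀) (z : SeqSpace A) (N : ℕ) :
    (P.withDensity (yE X z N)).map (fun ω (j : Fin N) => X (wordPrefixA z (j + 1)) ω) =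
      Measure.pi (fun _ : Fin N => tiltL P X₀) := by
  haveI := tiltL_prob hM
  symm
  have hV : Measurable (fun ω (j : Fin N) => X (wordPrefixA z (j + 1)) ω) :=
    measurable_pi_lambda _ fun j => hM.meas _
  apply Measure.pi_eq
  intro s hs
  rw [Measure.map_apply hV (MeasurableSet.univ_pi hs),
    withDensity_apply _ (hV (MeasurableSet.univ_pi hs)),
    ← lintegral_indicator (hV (MeasurableSet.univ_pi hs))]
  let g : Fin N → ℝ → ℝ≥0∞ := fun j x => ENNReal.ofReal x * (s j).indicator 1 x
  have hg : ∀ j, Measurable (g j) := fun j =>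
    ENNReal.measurable_ofReal.mul (measurable_one.indicator (hs j))
  have hind : iIndepFun (fun (j : Fin N) => g j ∘ X (wp z j).1) P := by
    have h1 : iIndepFun (fun (j : Fin N) => X (wp z j).1) P := by
      refine iIndepFun.precomp (g := fun j : Fin N => wp z j) ?_ hM.indep
      intro i j hij
      exact Fin.ext (wp_eq hij).1
    exact h1.comp g hg
  have := lintegral_prod_eq_prod_lintegral_of_indepFun Finset.univ _ hind
    (fun j => (hg j).comp (hM.meas _))
  calc _ = ∫⁻ ω, ∏ j : Fin N, (g j ∘ X (wp z j).1) ω ∂P := by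
        refine lintegral_congr fun ω => ?_
        simp only [g, Function.comp, wp, Finset.prod_mul_distrib]
        by_cases h : ∀ j : Fin N, X (wordPrefixA z (j + 1)) ω ∈ s j
        · rw [indicator_of_mem (by simpa using h), yE_prod hM.nonneg, Finset.prod_range]
          rw [Finset.prod_eq_one (f := fun j : Fin N => (s j).indicator 1 _), mul_one]
          · rfl
          · intro j _; simp [h j]
        · rw [indicator_of_notMem (by simpa using h)]
          push Not at h
          obtain ⟨j, hj⟩ := h
          rw [Finset.prod_eq_zero (f := fun j : Fin N => (s j).indicator 1 _)
            (Finset.mem_univ j), mul_zero]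
          simp [hj]
    _ = _ := by
        rw [this]
        refine Finset.prod_congr rfl fun j _ => ?_
        rw [tiltL_apply hM (hs j)]
        exact ((hM.ident _ (wp z j).2).comp (hg j)).lintegral_eq

/-- law of the weights along a typical path -/
def tiltI (P : Measure Ω) (X₀ : Ω → ℝ) : Measure (ℕ → ℝ) := 
  Measure.infinitePi (fun _ : ℕ => tiltL P X₀)

lemma tiltI_prob (hM : CascadeM1A P X X₀) : IsProbabilityMeasure (tiltI P X₀) := by
  haveI := tiltL_prob hM
  unfold tiltI; infer_instance

lemma tiltI_map (hM : CascadeM1A P X X₀) (N : ℕ) :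
    (tiltI P X₀).map (fun t (j : Fin N) => t j) = Measure.pi (fun _ : Fin N => tiltL P X₀) := by
  haveI := tiltL_prob hM
  symm
  apply Measure.pi_eq
  intro s hs
  have hV : Measurable (fun (t : ℕ → ℝ) (j : Fin N) => t j) :=
    measurable_pi_lambda _ fun j => measurable_pi_apply _
  rw [Measure.map_apply hV (MeasurableSet.univ_pi hs)]
  have := Measure.infinitePi_pi (fun _ : ℕ => tiltL P X₀) (s := Finset.range N)
    (t := fun i => if h : i < N then s ⟨i, h⟩ else univ) (by
      intro i hi
      simp only [Finset.mem_range] at hi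
      simp [hi, hs])
  rw [Finset.prod_range] at this
  simp only [Fin.is_lt, dite_true] at this
  rw [tiltI, ← this]
  congr 1
  ext t
  simp only [mem_preimage, Set.mem_pi, mem_univ, true_implies, Finset.coe_range, mem_Iio]
  constructor
  · intro h i hi
    simp only [hi, dite_true]
    exact h ⟨i, hi⟩
  · intro h j
    have := h j j.2
    simpa using this

lemma tilt_lint (hM : CascadeM1A P X X₀) (z : SeqSpace A) (N : ℕ) {g : (Fin N → ℝ) → ℝ≥0∞}
    (hg : Measurable g) :
    ∫⁻ ω, yE X z N ω * g (fun j : Fin N => X (wordPrefixA z (j + 1)) ω) ∂P =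
      ∫⁻ t, g (fun j : Fin N => t j) ∂(tiltI P X₀) := by
  have hV : Measurable (fun ω (j : Fin N) => X (wordPrefixA z (j + 1)) ω) :=
    measurable_pi_lambda _ fun j => hM.meas _
  have hV' : Measurable (fun (t : ℕ → ℝ) (j : Fin N) => t j) :=
    measurable_pi_lambda _ fun j => measurable_pi_apply _
  rw [← lintegral_map hg hV', tiltI_map hM, ← tilt_pi hM z N, lintegral_map hg hV]
  have hgV : Measurable (fun ω => g (fun j : Fin N => X (wordPrefixA z (j + 1)) ω)) := hg.comp hV
  rw [lintegral_withDensity_eq_lintegral_mul _ (meas_yE hM z N) hgV]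
  rfl

/-- the product of the first weights -/
def yT (k : ℕ) (t : ℕ → ℝ) : ℝ≥0∞ := ∏ j ∈ Finset.range k, ENNReal.ofReal (t j)

lemma measurable_yT (k : ℕ) : Measurable (yT k) :=
  Finset.measurable_fun_prod _ fun j _ => ENNReal.measurable_ofReal.comp (measurable_pi_apply j)

lemma entropyX_facts (hM : CascadeM1A P X X₀) (hfin : entropyXA P X₀ ≠ ⊤) :
    Integrable (fun ω => X₀ ω * Real.log (X₀ ω)) P ∧
      ∫ ω, X₀ ω * Real.log (X₀ ω) ∂P = (entropyXA P X₀).toReal := by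
  have hm : Measurable (fun ω => X₀ ω * Real.log (X₀ ω)) :=
    hM.meas₀.mul (Real.measurable_log.comp hM.meas₀)
  have hlow : ∀ ω, X₀ ω - 1 ≤ X₀ ω * Real.log (X₀ ω) := by
    intro ω
    rcases (hM.nonneg₀ ω).eq_or_lt with h | h
    · rw [← h]; simp
    · have := Real.one_sub_inv_le_log_of_pos h
      calc X₀ ω - 1 = X₀ ω * (1 - (X₀ ω)⁻¹) := by field_simp
        _ ≤ _ := mul_le_mul_of_nonneg_left this h.le
  have hb : ∫⁻ ω, ENNReal.ofReal (-(X₀ ω * Real.log (X₀ ω))) ∂P ≠ ⊤ := by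
    have : ∫⁻ ω, ENNReal.ofReal (-(X₀ ω * Real.log (X₀ ω))) ∂P ≤ ∫⁻ ω, 1 ∂P := by
      refine lintegral_mono fun ω => ?_
      rw [← ENNReal.ofReal_one]
      apply ENNReal.ofReal_le_ofReal
      linarith [hlow ω, hM.nonneg₀ ω]
    exact ne_top_of_le_ne_top (by simp) this
  have ha : ∫⁻ ω, ENNReal.ofReal (X₀ ω * Real.log (X₀ ω)) ∂P ≠ ⊤ := by
    intro h
    apply hfin
    rw [entropyXA, h, ENNReal.top_sub hb]
  have hi : Integrable (fun ω => X₀ ω * Real.log (X₀ ω)) P := by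
    refine ⟨hm.aestronglyMeasurable, ?_⟩
    rw [hasFiniteIntegral_iff_norm]
    calc _ ≤ ∫⁻ ω, (ENNReal.ofReal (X₀ ω * Real.log (X₀ ω)) +
          ENNReal.ofReal (-(X₀ ω * Real.log (X₀ ω)))) ∂P := by
          refine lintegral_mono fun ω => ?_
          rw [Real.norm_eq_abs]
          rcases abs_cases (X₀ ω * Real.log (X₀ ω)) with ⟨h, _⟩ | ⟨h, _⟩ <;> rw [h]
          · exact le_self_add
          · exact le_add_self
      _ < ⊤ := by
          rw [lintegral_add_left hm.ennreal_ofReal]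
          exact ENNReal.add_lt_top.2 ⟨ha.lt_top, hb.lt_top⟩
  refine ⟨hi, ?_⟩
  have hX : Integrable X₀ P := by
    by_contra h
    have := integral_undef h
    rw [hM.mean₀] at this
    exact one_ne_zero this
  have h0 : 0 ≤ ∫ ω, X₀ ω * Real.log (X₀ ω) ∂P := by
    have h1 : ∫ ω, (X₀ ω - 1) ∂P = 0 := by
      rw [integral_sub hX (integrable_const _), hM.mean₀]; simp
    rw [← h1]
    exact integral_mono (hX.sub (integrable_const _)) hi hlow
  have e := integral_eq_lintegral_pos_part_sub_lintegral_neg_part hi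
  rw [entropyXA, ENNReal.toReal_sub_of_le _ ha]
  · exact e
  · rw [e] at h0
    exact (ENNReal.toReal_le_toReal hb ha).1 (by linarith)

lemma slln (hM : CascadeM1A P X X₀) (hfin : entropyXA P X₀ ≠ ⊤) {ε : ℝ} (hε : 0 < ε) :
    ∀ᵐ t ∂(tiltI P X₀), ∀ᶠ k : ℕ in atTop,
      ENNReal.ofReal (Real.exp (k * ((entropyXA P X₀).toReal - ε))) ≤ yT k t ∧
      yT k t ≤ ENNReal.ofReal (Real.exp (k * ((entropyXA P X₀).toReal + ε))) := by
  haveI := tiltL_prob hM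
  have hf := entropyX_facts hM hfin
  have hρpos : ∀ᵐ x ∂(tiltL P X₀), 0 < x := by
    rw [ae_iff]
    have : {x : ℝ | ¬ 0 < x} = Iic 0 := by ext; simp
    rw [this, tiltL, withDensity_apply _ measurableSet_Iic, setLIntegral_eq_zero_iff measurableSet_Iic ENNReal.measurable_ofReal]
    exact Eventually.of_forall fun x hx => by simpa using hx
  have hmap : Integrable (fun x => Real.log x * (ENNReal.ofReal x).toReal) (P.map X₀) ∧
      ∫ x, Real.log x * (ENNReal.ofReal x).toReal ∂(P.map X₀) = (entropyXA P X₀).toReal := by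
    have hmm : Measurable (fun x => Real.log x * (ENNReal.ofReal x).toReal) :=
      Real.measurable_log.mul ENNReal.measurable_ofReal.ennreal_toReal
    have e : (fun x => Real.log x * (ENNReal.ofReal x).toReal) ∘ X₀ =
        fun ω => X₀ ω * Real.log (X₀ ω) := by
      ext ω
      simp only [Function.comp]
      rw [ENNReal.toReal_ofReal (hM.nonneg₀ ω), mul_comm]
    constructor
    · rw [integrable_map_measure hmm.aestronglyMeasurable hM.meas₀.aemeasurable, e]
      exact hf.1
    · rw [integral_map hM.meas₀.aemeasurable hmm.aestronglyMeasurable, ← hf.2]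
      exact congrArg (fun f => ∫ ω, f ω ∂P) e
  have hlogi : Integrable Real.log (tiltL P X₀) := by
    rw [tiltL, integrable_withDensity_iff ENNReal.measurable_ofReal (by simp)]
    exact hmap.1
  have hlog : ∫ x, Real.log x ∂(tiltL P X₀) = (entropyXA P X₀).toReal := by
    rw [tiltL, integral_withDensity_eq_integral_toReal_smul ENNReal.measurable_ofReal (by simp),
      ← hmap.2]
    refine integral_congr_ae (Eventually.of_forall fun x => ?_)
    simp [mul_comm]
  have mp := fun i : ℕ => measurePreserving_eval_infinitePi (fun _ : ℕ => tiltL P X₀) i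
  have hind : iIndepFun (fun (i : ℕ) (t : ℕ → ℝ) => Real.log (t i)) (tiltI P X₀) :=
    iIndepFun_infinitePi (P := fun _ : ℕ => tiltL P X₀) (X := fun _ => Real.log)
      (fun _ => Real.measurable_log)
  have key := strong_law_ae_real (μ := tiltI P X₀) (fun (i : ℕ) (t : ℕ → ℝ) => Real.log (t i))
    ((mp 0).integrable_comp_of_integrable hlogi) (fun i j hij => hind.indepFun hij) (fun i => by
      have h1 : IdentDistrib (fun t : ℕ → ℝ => t i) (fun t : ℕ → ℝ => t 0) (tiltI P X₀) (tiltI P X₀) :=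
        ⟨(measurable_pi_apply i).aemeasurable, (measurable_pi_apply 0).aemeasurable,
          (mp i).map_eq.trans (mp 0).map_eq.symm⟩
      exact h1.comp Real.measurable_log)
  have hintg : ∫ t, Real.log (t 0) ∂(tiltI P X₀) = (entropyXA P X₀).toReal := by
    rw [← hlog, ← (mp 0).map_eq, integral_map (mp 0).measurable.aemeasurable
      Real.measurable_log.aestronglyMeasurable]
    rfl
  rw [hintg] at key
  have hpos : ∀ᵐ t ∂(tiltI P X₀), ∀ i : ℕ, 0 < t i :=
    ae_all_iff.2 fun i => (mp i).quasiMeasurePreserving.ae hρpos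
  filter_upwards [key, hpos] with t ht hp
  have h1 := ht.eventually (Icc_mem_nhds (sub_lt_self _ hε) (lt_add_of_pos_right _ hε))
  filter_upwards [h1, eventually_gt_atTop 0] with k hk hk0
  have hk0' : (0 : ℝ) < k := by exact_mod_cast hk0
  have e : yT k t = ENNReal.ofReal (Real.exp (∑ i ∈ Finset.range k, Real.log (t i))) := by
    rw [yT, Real.exp_sum, ENNReal.ofReal_prod_of_nonneg fun _ _ => (Real.exp_pos _).le]
    exact Finset.prod_congr rfl fun i _ => by rw [Real.exp_log (hp i)]
  rw [e]
  simp only [mem_Icc, le_div_iff₀ hk0', div_le_iff₀ hk0'] at hk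
  constructor <;> apply ENNReal.ofReal_le_ofReal <;> apply Real.exp_le_exp.2 <;> linarith

end
end

noncomputable section

lemma tsum_fin {f : ℕ → ℝ≥0∞} (hf : ∀ k, f k ≠ ⊤) {c : ℝ} (hc : 0 < c)
    (h : ∀ᶠ k : ℕ in atTop, f k ≤ ENNReal.ofReal (Real.exp (-(c * k)))) : ∑' k, f k ≠ ⊤ := by
  obtain ⟨n, hn⟩ := eventually_atTop.1 h
  have h2 : Summable (fun k : ℕ => Real.exp (-(c * k))) := by
    have := Real.summable_exp_nat_mul_iff.2 (neg_lt_zero.2 hc)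
    refine this.congr fun k => ?_
    congr 1; ring
  have h3 : ∑' k : ℕ, ENNReal.ofReal (Real.exp (-(c * k))) ≠ ⊤ :=
    h2.tsum_ofReal_ne_top
  rw [← ENNReal.summable.sum_add_tsum_nat_add' (f := f) (k := n)]
  · refine ENNReal.add_ne_top.2 ⟨ENNReal.sum_ne_top.2 fun k _ => hf k, ?_⟩
    refine ne_top_of_le_ne_top h3 ?_
    calc ∑' k, f (k + n) ≤ ∑' k : ℕ, ENNReal.ofReal (Real.exp (-(c * k))) := by
          refine ENNReal.tsum_le_tsum fun k => ?_
          refine (hn _ (by omega)).trans (ENNReal.ofReal_le_ofReal (Real.exp_le_exp.2 ?_))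
          push_cast
          nlinarith [Nat.cast_nonneg (α := ℝ) n]
      _ ≤ _ := le_rfl

section
variable {A B : Type*} {Ω : Type*} [MeasurableSpace Ω] [MeasurableSpace A] [Fintype A]
  [MeasurableSingletonClass A] [MeasurableSpace B] [Fintype B] [MeasurableSingletonClass B]
  {P : Measure Ω} [IsProbabilityMeasure P] {X : List A → Ω → ℝ}
  {X₀ : Ω → ℝ} {ν : Measure (SeqSpace A)} [IsProbabilityMeasure ν] (q : A → B)

lemma box_zero (N : ℕ) (z : SeqSpace A) : ν.map (prQ q) (cylA (prQ q z) N) = ν (box q 0 N z) := by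
  rw [Measure.map_apply (measurable_prQ q) (measurableSet_cylA _ _)]
  congr 1
  ext z'
  simp [box, cylA, prQ]

lemma meas_nubox (η : Measure (SeqSpace A)) (k m : ℕ) : Measurable (fun z => η (box q k m z)) := by
  have : (fun z => η (box q k m z)) = (fun i => η (rBox q k m ⁻¹' {i})) ∘ rBox q k m := by
    ext z; simp [box_eq]
  rw [this]
  exact (measurable_of_finite _).comp (measurable_rBox q k m)

lemma ae_box_pos : ∀ᵐ z ∂ν, ∀ k m, ν (box q k m z) ≠ 0 := by
  rw [ae_all_iff]; intro k; rw [ae_all_iff]; intro m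
  filter_upwards [ae_pre_pos ν (rBox q k m)] with z hz
  rwa [box_eq]

lemma box_anti {k k' m m' : ℕ} (h : k ≤ k') (h' : m ≤ m') (z : SeqSpace A) :
    box q k' m' z ⊆ box q k m z := by
  intro z' hz
  simp only [box, mem_ofPred_eq] at hz ⊢
  exact ⟨fun i hi => hz.1 i (by omega), fun i hi => hz.2 i (by omega)⟩

/-- the limit-free spine sums -/
def WT (ν : Measure (SeqSpace A)) (N : ℕ) (z : SeqSpace A) (t : ℕ → ℝ) : ℝ≥0∞ :=
  (∑ k ∈ Finset.Icc 0 N, yT k t * ν (box q k N z)) * (ν (box q 0 N z))⁻¹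

lemma WT_tight (hM : CascadeM1A P X X₀) (hfin : entropyXA P X₀ ≠ ⊤) (hν : Ergodic (shiftA A) ν)
    {h h' : ℝ} (hent : Tendsto (entropySeqA ν) atTop (nhds h))
    (hent' : Tendsto (entropySeqA (ν.map (prQ q))) atTop (nhds h'))
    (hδ : (entropyXA P X₀).toReal < h - h') {ε : ℝ≥0∞} (hε : ε ≠ 0) :
    ∃ M : ℕ, ∀ N : ℕ, (ν.prod (tiltI P X₀)) {p | (M : ℝ≥0∞) < WT q ν N p.1 p.2} ≤ ε := by
  have := tiltI_prob hM
  have hmp := hν.toMeasurePreserving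
  let μ := ν.map (prQ q)
  let hX := (entropyXA P X₀).toReal
  let η := (h - h' - hX) / 8
  have hη : 0 < η := by simp only [η]; linarith
  let R : ℕ → ℕ → SeqSpace A → ℝ≥0∞ := fun k m z => ν (box q k m z) *
    ((rInv ν k z * ∏ i ∈ Finset.range k, pInf μ ((shiftA B)^[i] (prQ q z))) *
      (μ (cylA (prQ q z) m))⁻¹)
  have hR : ∀ k m, k ≤ m → ∫⁻ z, R k m z ∂ν ≤ 1 := fun k m hkm => m_rel q hmp hkm
  let a : ℕ → SeqSpace A → ℝ := fun k z => SB (lInf ν) k z - SB (lInf μ) k (prQ q z)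
  have hRa : ∀ᵐ z ∂ν, ∀ k m, R k m z = ν (box q k m z) *
      (ENNReal.ofReal (Real.exp (a k z)) * (ν (box q 0 m z))⁻¹) := by
    have h2 := (mp_prQ q hmp)
    have h3 : ∀ᵐ z ∂ν, ∀ k, rInv μ k (prQ q z) = ENNReal.ofReal (Real.exp (SB (lInf μ) k (prQ q z))) ∧
          ∏ i ∈ Finset.range k, pInf μ ((shiftA B)^[i] (prQ q z)) =
            ENNReal.ofReal (Real.exp (-SB (lInf μ) k (prQ q z))) :=
      ae_of_ae_map (measurable_prQ q).aemeasurable (ae_rInv h2)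
    filter_upwards [ae_rInv hmp, h3] with z h1 h3 k m
    simp only [R]
    rw [(h1 k).1, (h3 k).2, ← ENNReal.ofReal_mul (Real.exp_pos _).le, ← Real.exp_add, box_zero]
    rfl
  have hRm : ∀ k m, Measurable (R k m) := by
    intro k m
    have hpm : Measurable (fun z => ∏ i ∈ Finset.range k, pInf μ ((shiftA B)^[i] (prQ q z))) :=
      Finset.measurable_fun_prod _ fun i _ => (measurable_pInf μ).comp
        ((measurable_iter_shiftA i).comp (measurable_prQ q))
    have hcm : Measurable (fun z => (μ (cylA (prQ q z) m))⁻¹) := by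
      simp only [μ, box_zero]
      exact (meas_nubox q ν 0 m).inv
    exact (meas_nubox q ν k m).mul (((measurable_rInv ν k).mul hpm).mul hcm)
  -- finiteness of the dominating series
  let S : SeqSpace A × (ℕ → ℝ) → ℝ≥0∞ := fun p =>
    ∑' k : ℕ, yT k p.2 * ENNReal.ofReal (Real.exp (η * k - a k p.1))
  have ham : ∀ k, Measurable (a k) := fun k =>
    (Finset.measurable_fun_sum _ fun i _ => (measurable_lInf ν).comp (measurable_iter_shiftA i)).sub
    ((Finset.measurable_fun_sum _ fun i _ => (measurable_lInf μ).comp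
      (measurable_iter_shiftA i)).comp (measurable_prQ q))
  have hSm : Measurable S := Measurable.tsum fun k =>
    ((measurable_yT k).comp measurable_snd).mul
      (((measurable_const.sub ((ham k).comp measurable_fst)).exp).ennreal_ofReal)
  have hSfin : ∀ᵐ p ∂(ν.prod (tiltI P X₀)), S p ≠ ⊤ := by
    have e1 := entropy_main hmp hent
    have e2 := entropy_main (mp_prQ q hmp) hent'
    have b1 := birk_A hν (measurable_lInf ν) e1.1 hη
    have b2 := birk_B q hν (measurable_lInf μ) e2.1 hη
    rw [e1.2.1] at b1
    rw [e2.2.1] at b2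
    have b3 := slln hM hfin hη
    have b1' := (Measure.quasiMeasurePreserving_fst (μ := ν) (ν := tiltI P X₀)).ae (b1.and b2)
    have b3' := (Measure.quasiMeasurePreserving_snd (μ := ν) (ν := tiltI P X₀)).ae b3
    filter_upwards [b1', b3'] with p hp1 hp3
    refine tsum_fin (c := 4 * η) ?_ (by positivity) ?_
    · intro k
      refine ENNReal.mul_ne_top ?_ ENNReal.ofReal_ne_top
      exact ENNReal.prod_ne_top fun _ _ => ENNReal.ofReal_ne_top
    · filter_upwards [hp1.1, hp1.2, hp3] with k h1 h2 h3
      calc _ ≤ ENNReal.ofReal (Real.exp (k * (hX + η))) *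
            ENNReal.ofReal (Real.exp (η * k - a k p.1)) := by gcongr; exact h3.2
        _ ≤ _ := by
            rw [← ENNReal.ofReal_mul (Real.exp_pos _).le, ← Real.exp_add]
            apply ENNReal.ofReal_le_ofReal (Real.exp_le_exp.2 ?_)
            have hh : h - h' - hX = 8 * η := by simp only [η]; ring
            have : (k : ℝ) * (h - h' - hX) = k * (8 * η) := by rw [hh]
            simp only [a]
            linarith [(abs_le.1 h1).1, (abs_le.1 h2).2]
  -- choice of k0
  have hgeo : ∑' k : ℕ, ENNReal.ofReal (Real.exp (-(η * k))) ≠ ⊤ :=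
    tsum_fin (fun _ => ENNReal.ofReal_ne_top) hη (Eventually.of_forall fun _ => le_rfl)
  have hε2 : (0 : ℝ≥0∞) < ε / 2 := (ENNReal.div_pos hε (by simp))
  obtain ⟨k0, hk0⟩ := ((ENNReal.tendsto_sum_nat_add _ hgeo).eventually_le_const hε2).exists
  -- the dominating function
  let W : SeqSpace A × (ℕ → ℝ) → ℝ≥0∞ := fun p => (∑ k ∈ Finset.range k0, yT k p.2) + S p
  have hWm : Measurable W := (Finset.measurable_fun_sum _ fun k _ =>
    (measurable_yT k).comp measurable_snd).add hSm
  have hWfin : ∀ᵐ p ∂(ν.prod (tiltI P X₀)), W p ≠ ⊤ := by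
    filter_upwards [hSfin] with p hp
    refine ENNReal.add_ne_top.2 ⟨ENNReal.sum_ne_top.2 fun k _ => ?_, hp⟩
    exact ENNReal.prod_ne_top fun _ _ => ENNReal.ofReal_ne_top
  have htail : Tendsto (fun M : ℕ => (ν.prod (tiltI P X₀)) {p | (M : ℝ≥0∞) < W p}) atTop (nhds 0) := by
    have h0 : (ν.prod (tiltI P X₀)) (⋂ M : ℕ, {p | (M : ℝ≥0∞) < W p}) = 0 := by
      refine measure_mono_null ?_ (ae_iff.1 hWfin)
      intro p hp
      simp only [mem_iInter, mem_ofPred_eq] at hp ⊢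
      simp only [not_not]
      by_contra hne
      obtain ⟨n, hn⟩ := ENNReal.exists_nat_gt hne
      exact absurd (hp n) (not_lt.2 hn.le)
    rw [← h0]
    refine tendsto_measure_iInter_atTop
      (fun M => (measurableSet_lt measurable_const hWm).nullMeasurableSet) ?_ ⟨0, measure_ne_top _ _⟩
    intro M M' hMM p hp
    simp only [mem_ofPred_eq] at hp ⊢
    exact lt_of_le_of_lt (by exact_mod_cast hMM) hp
  obtain ⟨M, hMt⟩ := (htail.eventually_le_const hε2).exists
  refine ⟨M, fun N => ?_⟩
  let bad : ℕ → Set (SeqSpace A) := fun k =>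
    {z | k ≤ N ∧ ENNReal.ofReal (Real.exp (η * k)) ≤ R k N z}
  have hbad : ∀ k, ν (bad k) ≤ ENNReal.ofReal (Real.exp (-(η * k))) := by
    intro k
    by_cases hk : k ≤ N
    · have h1 := mul_meas_ge_le_lintegral (μ := ν) (hRm k N) (ENNReal.ofReal (Real.exp (η * k)))
      have h2 : bad k = {z | ENNReal.ofReal (Real.exp (η * k)) ≤ R k N z} := by
        ext z; simp [bad, hk]
      rw [h2, Real.exp_neg, ENNReal.ofReal_inv_of_pos (Real.exp_pos _)]
      rw [← one_div, ENNReal.le_div_iff_mul_le (Or.inl (by simp [Real.exp_pos]))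
        (Or.inl ENNReal.ofReal_ne_top), mul_comm]
      exact h1.trans (hR k N hk)
    · have h2 : bad k = ∅ := by ext z; simp [bad, hk]
      simp [h2]
  have hbadm : ∀ k, MeasurableSet (bad k) := fun k => by
    by_cases hk : k ≤ N
    · have h2 : bad k = {z | ENNReal.ofReal (Real.exp (η * k)) ≤ R k N z} := by
        ext z; simp [bad, hk]
      rw [h2]; exact measurableSet_le measurable_const (hRm k N)
    · have h2 : bad k = ∅ := by ext z; simp [bad, hk]
      simp [h2]
  calc _ ≤ (ν.prod (tiltI P X₀)) ({p | (M : ℝ≥0∞) < W p} ∪ ⋃ j : ℕ, Prod.fst ⁻¹' bad (j + k0)) := by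
        apply measure_mono_ae
        filter_upwards [(Measure.quasiMeasurePreserving_fst (μ := ν) (ν := tiltI P X₀)).ae
          (hRa.and (ae_box_pos q))] with p hp0 hpW
        obtain ⟨hp, hpos⟩ := hp0
        change (M : ℝ≥0∞) < WT q ν N p.1 p.2 at hpW
        by_contra hnot
        change p ∉ ({p | (M : ℝ≥0∞) < W p} ∪ ⋃ j : ℕ, Prod.fst ⁻¹' bad (j + k0) : Set (SeqSpace A × (ℕ → ℝ))) at hnot
        simp only [mem_union, mem_iUnion, mem_preimage, mem_ofPred_eq, not_or, not_exists,
          not_lt] at hnot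
        refine absurd (hpW.trans_le ?_) (not_lt.2 hnot.1)
        -- bound WT by W
        have hbd : ∀ k ∈ Finset.Icc 0 N, yT k p.2 * ν (box q k N p.1) * (ν (box q 0 N p.1))⁻¹ ≤
            (if k < k0 then yT k p.2 else 0) +
              yT k p.2 * ENNReal.ofReal (Real.exp (η * k - a k p.1)) := by
          intro k hk
          simp only [Finset.mem_Icc] at hk
          by_cases hkk : k < k0
          · rw [if_pos hkk]
            refine le_trans ?_ le_self_add
            rw [mul_assoc]
            calc _ ≤ yT k p.2 * 1 := by
                  gcongr
                  calc _ ≤ ν (box q 0 N p.1) * (ν (box q 0 N p.1))⁻¹ := by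
                        gcongr; exact box_anti q (Nat.zero_le _) le_rfl _
                    _ ≤ 1 := ENNReal.mul_inv_le_one _
              _ = _ := mul_one _
          · rw [if_neg hkk, zero_add, mul_assoc]
            gcongr
            have h1 := hnot.2 (k - k0)
            rw [Nat.sub_add_cancel (not_lt.1 hkk)] at h1
            simp only [bad, mem_ofPred_eq, not_and, not_le] at h1
            have h2 := h1 hk.2
            rw [hp k N] at h2
            rw [Real.exp_sub, ENNReal.ofReal_div_of_pos (Real.exp_pos _),
              ENNReal.le_div_iff_mul_le (Or.inl (by simp [Real.exp_pos]))
              (Or.inl ENNReal.ofReal_ne_top)]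
            refine le_trans (le_of_eq ?_) h2.le
            ring
        rw [WT, Finset.sum_mul]
        refine (Finset.sum_le_sum hbd).trans ?_
        rw [Finset.sum_add_distrib]
        refine add_le_add ?_ (ENNReal.sum_le_tsum _)
        rw [← Finset.sum_filter]
        refine Finset.sum_le_sum_of_subset ?_
        intro k hk
        simp only [Finset.mem_filter] at hk
        simpa using hk.2
    _ ≤ ε / 2 + ∑' j : ℕ, ENNReal.ofReal (Real.exp (-(η * ((j + k0 : ℕ) : ℝ)))) := by
        refine (measure_union_le _ _).trans (add_le_add hMt ?_)
        refine (measure_iUnion_le _).trans (ENNReal.tsum_le_tsum fun j => ?_)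
        rw [(measurePreserving_fst (μ := ν) (ν := tiltI P X₀)).measure_preimage
          (hbadm _).nullMeasurableSet]
        exact hbad _
    _ ≤ ε / 2 + ε / 2 := by gcongr
    _ = ε := ENNReal.add_halves ε

end
end

noncomputable section

section
variable {A B : Type*} {Ω : Type*} [MeasurableSpace Ω] [MeasurableSpace A] [Fintype A]
  [MeasurableSingletonClass A] [MeasurableSpace B] [Fintype B] [MeasurableSingletonClass B]
  {P : Measure Ω} [IsProbabilityMeasure P] {X : List A → Ω → ℝ}
  {X₀ : Ω → ℝ} {ν : Measure (SeqSpace A)} [IsProbabilityMeasure ν] (q : A → B)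

/-- cell densities by label -/
def fL (X : List A → Ω → ℝ) (ν : Measure (SeqSpace A)) (N : ℕ) (ω : Ω)
    (i : (Fin 0 → A) × (Fin N → B)) : ℝ≥0∞ :=
  (∫⁻ z' in rBox q 0 N ⁻¹' {i}, yE X z' N ω ∂ν) * (ν (rBox q 0 N ⁻¹' {i}))⁻¹

open Classical in
/-- mass of the set with large density -/
def QT (X : List A → Ω → ℝ) (ν : Measure (SeqSpace A)) (N : ℕ) (K : ℕ) (ω : Ω) : ℝ≥0∞ :=
  ∫⁻ z, yE X z N ω * (if (K : ℝ≥0∞) < fL q X ν N ω (rBox q 0 N z) then 1 else 0) ∂ν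

lemma meas_int (hM : CascadeM1A P X X₀) (ν : Measure (SeqSpace A)) [IsFiniteMeasure ν] (N : ℕ) :
    Measurable (fun ω => ∫⁻ z', yE X z' N ω ∂ν) :=
  (meas_yE_joint hM N).lintegral_prod_right'

lemma meas_fL (hM : CascadeM1A P X X₀) (N : ℕ) (i : (Fin 0 → A) × (Fin N → B)) :
    Measurable (fun ω => fL q X ν N ω i) :=
  (meas_int hM _ N).mul_const _

lemma meas_QTint (hM : CascadeM1A P X X₀) (N K : ℕ) : Measurable (fun p : Ω × SeqSpace A =>
    open Classical in yE X p.2 N p.1 *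
      (if (K : ℝ≥0∞) < fL q X ν N p.1 (rBox q 0 N p.2) then 1 else 0)) := by
  refine (meas_yE_joint hM N).mul (Measurable.ite ?_ measurable_const measurable_const)
  exact measurableSet_lt measurable_const
    (meas_joint (measurable_rBox q 0 N) (F := fun ω i => fL q X ν N ω i) (meas_fL q hM N))

lemma meas_QT (hM : CascadeM1A P X X₀) (N K : ℕ) : Measurable (QT q X ν N K) := 
  (meas_QTint q hM N K).lintegral_prod_right'

lemma QT_anti (N : ℕ) {K K' : ℕ} (h : K ≤ K') (ω : Ω) : QT q X ν N K' ω ≤ QT q X ν N K ω := by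
  classical
  refine lintegral_mono fun z => ?_
  gcongr
  by_cases h1 : (K' : ℝ≥0∞) < fL q X ν N ω (rBox q 0 N z)
  · have h2 : (K : ℝ≥0∞) < fL q X ν N ω (rBox q 0 N z) :=
      lt_of_le_of_lt (by exact_mod_cast h) h1
    simp [h1, h2]
  · simp [h1]

lemma QT_split (N K : ℕ) (ω : Ω) (I : Set ((Fin 0 → A) × (Fin N → B))) :
    ∫⁻ z in rBox q 0 N ⁻¹' I, yE X z N ω ∂ν ≤ K * ν (rBox q 0 N ⁻¹' I) + QT q X ν N K ω := by
  classical
  let F : (Fin 0 → A) × (Fin N → B) → ℝ≥0∞ := fun i =>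
    if i ∈ I ∧ fL q X ν N ω i ≤ K then 1 else 0
  have hr := measurable_rBox q 0 N
  have hI : MeasurableSet (rBox q 0 N ⁻¹' I) := hr (Set.toFinite I).measurableSet
  have hy := meas_yE_right (X := X) N ω
  have hFy : Measurable (fun z => F (rBox q 0 N z) * yE X z N ω) :=
    ((measurable_of_finite F).comp hr).mul hy
  calc _ ≤ ∫⁻ z, (F (rBox q 0 N z) * yE X z N ω + yE X z N ω *
          (if (K : ℝ≥0∞) < fL q X ν N ω (rBox q 0 N z) then 1 else 0)) ∂ν := by
        rw [← lintegral_indicator hI]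
        refine lintegral_mono fun z => ?_
        by_cases h1 : rBox q 0 N z ∈ I
        · by_cases h2 : (K : ℝ≥0∞) < fL q X ν N ω (rBox q 0 N z)
          · rw [indicator_of_mem (by exact h1)]
            simp [h2]
          · simp [F, h1, h2, not_lt.1 h2]
        · rw [indicator_of_notMem (by exact h1)]
          exact zero_le
    _ = ∑ i, F i * (∫⁻ z in rBox q 0 N ⁻¹' {i}, yE X z N ω ∂ν) + QT q X ν N K ω := by
        rw [lintegral_add_left hFy, fin_part ν hr F hy, QT]
    _ ≤ ∑ i, (K * if i ∈ I then 1 else 0) * (∫⁻ z in rBox q 0 N ⁻¹' {i}, 1 ∂ν) + QT q X ν N K ω := by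
        refine add_le_add (Finset.sum_le_sum fun i _ => ?_) le_rfl
        by_cases h1 : i ∈ I
        · by_cases h2 : fL q X ν N ω i ≤ K
          · simp only [F, h1, h2, and_self, if_true, one_mul, mul_one, lintegral_const,
              Measure.restrict_apply_univ]
            by_cases h0 : ν (rBox q 0 N ⁻¹' {i}) = 0
            · rw [setLIntegral_measure_zero _ _ h0]; exact zero_le
            · rw [fL, ← div_eq_mul_inv, ENNReal.div_le_iff_le_mul (Or.inl h0)
                (Or.inl (measure_ne_top _ _))] at h2
              exact h2
          · simp [F, h2]
        · simp [F, h1]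
    _ = _ := by
        rw [← fin_part ν hr (fun i => K * if i ∈ I then 1 else 0) measurable_const]
        congr 1
        simp only [mul_one]
        rw [lintegral_const_mul]
        · congr 1
          rw [← lintegral_indicator_one hI]
          refine lintegral_congr fun z => ?_
          by_cases h : rBox q 0 N z ∈ I <;> simp [indicator, h]
        · exact (measurable_of_finite (fun i => if i ∈ I then (1 : ℝ≥0∞) else 0)).comp hr

lemma QT_tail (hM : CascadeM1A P X X₀) (hfin : entropyXA P X₀ ≠ ⊤) (hν : Ergodic (shiftA A) ν)
    {h h' : ℝ} (hent : Tendsto (entropySeqA ν) atTop (nhds h))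
    (hent' : Tendsto (entropySeqA (ν.map (prQ q))) atTop (nhds h'))
    (hδ : (entropyXA P X₀).toReal < h - h') {ε : ℝ≥0∞} (hε : ε ≠ 0) :
    ∃ K : ℕ, ∀ N : ℕ, ∫⁻ ω, QT q X ν N K ω ∂P ≤ ε := by
  classical
  have := tiltI_prob hM
  have hε2 : ε / 2 ≠ 0 := (ENNReal.div_pos hε (by simp)).ne'
  obtain ⟨M0, hM0⟩ := WT_tight q hM hfin hν hent hent' hδ hε2
  let M := M0 + 1
  have hMt : ∀ N, (ν.prod (tiltI P X₀)) {p | (M : ℝ≥0∞) < WT q ν N p.1 p.2} ≤ ε / 2 := by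
    intro N
    refine (measure_mono ?_).trans (hM0 N)
    intro p hp
    simp only [mem_ofPred_eq] at hp ⊢
    refine lt_of_le_of_lt ?_ hp
    simp [M]
  obtain ⟨K0, hK0⟩ : ∃ K0 : ℕ, (M : ℝ≥0∞) / (ε / 2) < K0 :=
    ENNReal.exists_nat_gt (ENNReal.div_ne_top (by simp) hε2)
  let K := K0
  have hKpos : (K : ℝ≥0∞) ≠ 0 := by
    intro h0
    rw [h0] at hK0
    exact not_lt_zero hK0
  have hMK : (M : ℝ≥0∞) / K ≤ ε / 2 := by
    by_cases he : ε / 2 = ⊤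
    · rw [he]; exact le_top
    refine ENNReal.div_le_of_le_mul ?_
    have := hK0.le
    rw [ENNReal.div_le_iff_le_mul (Or.inl hε2) (Or.inl he)] at this
    rwa [mul_comm]
  refine ⟨K, fun N => ?_⟩
  -- pointwise split
  have hpt : ∀ᵐ z ∂ν, ∀ ω,
      yE X z N ω * (if (K : ℝ≥0∞) < fL q X ν N ω (rBox q 0 N z) then 1 else 0) ≤
      yE X z N ω * (if (M : ℝ≥0∞) < TN q X ν 0 N N z ω * (ν (box q 0 N z))⁻¹ then 1 else 0) +
      (M : ℝ≥0∞) / K * (yE X z N ω * ((∫⁻ z' in box q 0 N z, yE X z' N ω ∂ν) *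
        (TN q X ν 0 N N z ω)⁻¹)) := by
    filter_upwards [ae_box_pos q] with z hz ω
    by_cases h1 : (K : ℝ≥0∞) < fL q X ν N ω (rBox q 0 N z)
    · by_cases h2 : (M : ℝ≥0∞) < TN q X ν 0 N N z ω * (ν (box q 0 N z))⁻¹
      · simp [h1, h2]
      · rw [if_pos h1, if_neg h2, mul_one, mul_zero, zero_add]
        set T := TN q X ν 0 N N z ω
        set Q := ∫⁻ z' in box q 0 N z, yE X z' N ω ∂ν with hQ
        set c := ν (box q 0 N z) with hc
        have hc0 : c ≠ 0 := hz 0 N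
        have hct : c ≠ ⊤ := measure_ne_top _ _
        have h1' : (K : ℝ≥0∞) * c ≤ Q := by
          have := h1.le
          rw [fL, ← box_eq, ← div_eq_mul_inv] at this
          rwa [ENNReal.le_div_iff_mul_le (Or.inl hc0) (Or.inl hct)] at this
        have h2' : T ≤ M * c := by
          have := not_lt.1 h2
          rwa [← div_eq_mul_inv, ENNReal.div_le_iff_le_mul (Or.inl hc0) (Or.inl hct)] at this
        have h3 : (1 : ℝ≥0∞) ≤ (M : ℝ≥0∞) / K * (Q * T⁻¹) := by
          have hM0 : (M : ℝ≥0∞) ≠ 0 := by simp [M]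
          have hMt : (M : ℝ≥0∞) ≠ ⊤ := by simp
          calc (1 : ℝ≥0∞) = (M : ℝ≥0∞) / K * ((K * c) * (M * c)⁻¹) := by
                rw [ENNReal.mul_inv (Or.inl hM0) (Or.inl hMt), div_eq_mul_inv]
                calc (1 : ℝ≥0∞) = ((M : ℝ≥0∞) * (M : ℝ≥0∞)⁻¹) * ((K : ℝ≥0∞) * (K : ℝ≥0∞)⁻¹) * (c * c⁻¹) := by
                      rw [ENNReal.mul_inv_cancel hM0 hMt, ENNReal.mul_inv_cancel hc0 hct,
                        ENNReal.mul_inv_cancel hKpos (by simp)]; simp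
                  _ = _ := by ring
            _ ≤ _ := by gcongr
        calc yE X z N ω = yE X z N ω * 1 := (mul_one _).symm
          _ ≤ yE X z N ω * ((M : ℝ≥0∞) / K * (Q * T⁻¹)) := by gcongr
          _ = _ := by ring
    · rw [if_neg h1, mul_zero]; exact zero_le
  -- swap
  have hswap : ∫⁻ ω, QT q X ν N K ω ∂P = ∫⁻ z, ∫⁻ ω, yE X z N ω *
      (if (K : ℝ≥0∞) < fL q X ν N ω (rBox q 0 N z) then 1 else 0) ∂P ∂ν := by
    unfold QT
    exact lintegral_lintegral_swap (meas_QTint q hM N K).aemeasurable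
  have hWTm : Measurable (fun p : SeqSpace A × (ℕ → ℝ) => WT q ν N p.1 p.2) := by
    unfold WT
    refine Measurable.mul ?_ ((meas_nubox q ν 0 N).comp measurable_fst).inv
    exact Finset.measurable_fun_sum _ fun k _ => ((measurable_yT k).comp measurable_snd).mul
      ((meas_nubox q ν k N).comp measurable_fst)
  have hset : MeasurableSet {p : SeqSpace A × (ℕ → ℝ) | (M : ℝ≥0∞) < WT q ν N p.1 p.2} :=
    measurableSet_lt measurable_const hWTm
  rw [hswap]
  calc _ ≤ ∫⁻ z, ((tiltI P X₀) {t | (M : ℝ≥0∞) < WT q ν N z t} + (M : ℝ≥0∞) / K) ∂ν := by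
        refine lintegral_mono_ae ?_
        filter_upwards [hpt] with z hz
        have hTm : Measurable (TN q X ν 0 N N z) :=
          (meas_TN_spine q hM ν 0 N N z).mono (sig_le hM _) le_rfl
        refine (lintegral_mono hz).trans ?_
        have hm1 : Measurable (fun ω => yE X z N ω *
            (if (M : ℝ≥0∞) < TN q X ν 0 N N z ω * (ν (box q 0 N z))⁻¹ then (1 : ℝ≥0∞) else 0)) :=
          (meas_yE hM z N).mul (Measurable.ite (measurableSet_lt measurable_const
            (hTm.mul_const _)) measurable_const measurable_const)
        have hm2 : Measurable (fun ω => yE X z N ω * ((∫⁻ z' in box q 0 N z, yE X z' N ω ∂ν) *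
            (TN q X ν 0 N N z ω)⁻¹)) :=
          (meas_yE hM z N).mul ((meas_int hM _ N).mul hTm.inv)
        rw [lintegral_add_left hm1, lintegral_const_mul _ hm2]
        refine add_le_add ?_ ?_
        · let D : (Fin N → ℝ) → ℝ≥0∞ := fun v =>
            (∑ k ∈ Finset.Icc 0 N, (∏ j ∈ Finset.range k,
              if h : j < N then ENNReal.ofReal (v ⟨j, h⟩) else 1) * ν (box q k N z)) *
              (ν (box q 0 N z))⁻¹
          have hD : Measurable D := by
            refine Measurable.mul_const ?_ _
            refine Finset.measurable_fun_sum _ fun k _ => Measurable.mul_const ?_ _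
            refine Finset.measurable_fun_prod _ fun j _ => ?_
            by_cases hj : j < N
            · simp only [hj, dite_true]
              exact ENNReal.measurable_ofReal.comp (measurable_pi_apply _)
            · simp only [hj, dite_false]; exact measurable_const
          have hDm : Measurable (fun v => if (M : ℝ≥0∞) < D v then (1 : ℝ≥0∞) else 0) :=
            Measurable.ite (measurableSet_lt measurable_const hD) measurable_const measurable_const
          have hprod : ∀ (k : ℕ) (t : ℕ → ℝ), k ∈ Finset.Icc 0 N →
              (∏ j ∈ Finset.range k, if h : j < N then
                ENNReal.ofReal ((fun j : Fin N => t j) ⟨j, h⟩) else 1) = yT k t := by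
            intro k t hk
            simp only [Finset.mem_Icc] at hk
            refine Finset.prod_congr rfl fun j hj => ?_
            simp only [Finset.mem_range] at hj
            rw [dif_pos (by omega)]
          have hDT : ∀ t : ℕ → ℝ, D (fun j : Fin N => t j) = WT q ν N z t := by
            intro t
            simp only [D, WT]
            congr 1
            refine Finset.sum_congr rfl fun k hk => ?_
            rw [hprod k t hk]
          have hDX : ∀ ω, D (fun j : Fin N => X (wordPrefixA z (j + 1)) ω) =
              TN q X ν 0 N N z ω * (ν (box q 0 N z))⁻¹ := by
            intro ω
            rw [hDT (fun j => X (wordPrefixA z (j + 1)) ω), WT, TN]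
            congr 1
            refine Finset.sum_congr rfl fun k hk => ?_
            rw [yE_prod hM.nonneg]; rfl
          have := tilt_lint hM z N hDm
          simp only [hDX, hDT] at this
          rw [this]
          have hs2 : MeasurableSet {t : ℕ → ℝ | (M : ℝ≥0∞) < WT q ν N z t} :=
            measurable_prodMk_left hset
          rw [← lintegral_indicator_one hs2]
          refine lintegral_mono fun t => le_of_eq ?_
          by_cases ht : (M : ℝ≥0∞) < WT q ν N z t <;> simp [ht]
        · calc _ ≤ (M : ℝ≥0∞) / K * 1 := by
                gcongr; exact star q hM ν N (Nat.zero_le _) z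
            _ = _ := mul_one _
    _ = (ν.prod (tiltI P X₀)) {p | (M : ℝ≥0∞) < WT q ν N p.1 p.2} + (M : ℝ≥0∞) / K := by
        rw [lintegral_add_right _ measurable_const, Measure.prod_apply hset]
        simp only [lintegral_const, measure_univ, mul_one]
        rfl
    _ ≤ ε / 2 + ε / 2 := add_le_add (hMt N) hMK
    _ = ε := ENNReal.add_halves ε

lemma cascadeZ_nonneg (hM : CascadeM1A P X X₀) (N : ℕ) (ω : Ω) : 0 ≤ cascadeZA X ν N ω :=
  Finset.sum_nonneg fun u _ => mul_nonneg (Finset.prod_nonneg fun _ _ => hM.nonneg _ _)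
    ENNReal.toReal_nonneg

lemma cascadeZ_eq (hM : CascadeM1A P X X₀) (N : ℕ) (ω : Ω) :
    ENNReal.ofReal (cascadeZA X ν N ω) = ∫⁻ z, yE X z N ω ∂ν := by
  have h1 := fin_part ν (measurable_preA N) (fun u => yW X N ω u) (G := fun _ => 1) measurable_const
  simp only [mul_one] at h1
  have h2 : ∀ z : SeqSpace A, yW X N ω (preA N z) = yE X z N ω := fun z => rfl
  simp only [h2] at h1
  rw [h1, cascadeZA, ENNReal.ofReal_sum_of_nonneg]
  · refine Finset.sum_congr rfl fun u _ => ?_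
    have h0 : 0 ≤ cascadeYA X (List.ofFn u) ω := Finset.prod_nonneg fun _ _ => hM.nonneg _ _
    rw [ENNReal.ofReal_mul h0,
      ENNReal.ofReal_toReal (measure_ne_top _ _), cylinderA_ofFn]
    simp [yW]
  · exact fun u _ => mul_nonneg (Finset.prod_nonneg fun _ _ => hM.nonneg _ _)
      ENNReal.toReal_nonneg

lemma meas_Z (hM : CascadeM1A P X X₀) (N : ℕ) : Measurable (cascadeZA X ν N) :=
  Finset.measurable_fun_sum _ fun u _ => Measurable.mul_const
    (Finset.measurable_fun_prod _ fun _ _ => hM.meas _) _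

lemma UI_main (hM : CascadeM1A P X X₀) (hfin : entropyXA P X₀ ≠ ⊤) (hν : Ergodic (shiftA A) ν)
    {h h' : ℝ} (hent : Tendsto (entropySeqA ν) atTop (nhds h))
    (hent' : Tendsto (entropySeqA (ν.map (prQ q))) atTop (nhds h'))
    (hδ : (entropyXA P X₀).toReal < h - h') :
    UniformIntegrable (fun n ω => cascadeZA X ν n ω) 1 P := by
  refine uniformIntegrable_of le_rfl ENNReal.one_ne_top
    (fun N => (meas_Z hM N).aestronglyMeasurable) fun ε hε => ?_
  obtain ⟨K, hK⟩ := QT_tail q hM hfin hν hent hent' hδ (ε := ENNReal.ofReal ε / 2)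
    (ENNReal.div_pos (by simpa using hε) (by simp)).ne'
  refine ⟨2 * K, fun N => ?_⟩
  rw [eLpNorm_one_eq_lintegral_enorm]
  calc _ ≤ ∫⁻ ω, 2 * QT q X ν N K ω ∂P := by
        refine lintegral_mono fun ω => ?_
        by_cases hω : 2 * (K : NNReal) ≤ ‖cascadeZA X ν N ω‖₊
        · rw [indicator_of_mem (by simpa using hω)]
          have hs := QT_split (X := X) (ν := ν) q N K ω univ
          simp only [preimage_univ, Measure.restrict_univ, measure_univ, mul_one] at hs
          rw [← cascadeZ_eq hM] at hs
          have e : ‖cascadeZA X ν N ω‖ₑ = ENNReal.ofReal (cascadeZA X ν N ω) :=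
            Real.enorm_eq_ofReal (cascadeZ_nonneg hM N ω)
          rw [e]
          have h2 : 2 * (K : ℝ≥0∞) ≤ ENNReal.ofReal (cascadeZA X ν N ω) := by
            rw [← e, enorm_eq_nnnorm]
            exact_mod_cast hω
          have h3 : ENNReal.ofReal (cascadeZA X ν N ω) ≠ ⊤ := ENNReal.ofReal_ne_top
          generalize ENNReal.ofReal (cascadeZA X ν N ω) = Z at *
          have h4 : Z + Z ≤ Z + 2 * QT q X ν N K ω := by
            calc Z + Z = 2 * Z := (two_mul _).symm
              _ ≤ 2 * (K + QT q X ν N K ω) := by gcongr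
              _ = 2 * K + 2 * QT q X ν N K ω := by ring
              _ ≤ _ := by gcongr
          exact (ENNReal.add_le_add_iff_left h3).1 h4
        · rw [indicator_of_notMem (by simpa using hω)]
          simp
    _ = 2 * ∫⁻ ω, QT q X ν N K ω ∂P := lintegral_const_mul _ (meas_QT q hM N K)
    _ ≤ 2 * (ENNReal.ofReal ε / 2) := by gcongr; exact hK N
    _ = _ := ENNReal.mul_div_cancel (by simp) (by simp)

end
end

noncomputable section

section
variable {A B : Type*} {Ω : Type*} [MeasurableSpace Ω] [MeasurableSpace A] [Fintype A]
  [MeasurableSingletonClass A] [MeasurableSpace B] [Fintype B] [MeasurableSingletonClass B]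
  {P : Measure Ω} [IsProbabilityMeasure P] {X : List A → Ω → ℝ}
  {X₀ : Ω → ℝ} {ν : Measure (SeqSpace A)} [IsProbabilityMeasure ν] (q : A → B)

/-- convergence on cylinders -/
def ConvA (X : List A → Ω → ℝ) (ν : Measure (SeqSpace A)) (ω : Ω) (η : Measure (SeqSpace A)) : Prop :=
  ∀ w : List A, Tendsto (fun n => ∫⁻ x in cylinderA w, yE X x n ω ∂ν) atTop (nhds (η (cylinderA w)))

lemma pre_sum (η : Measure (SeqSpace A)) (M : ℕ) (I : Set (Fin M → A)) [DecidablePred (· ∈ I)]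
    {f : SeqSpace A → ℝ≥0∞} (hf : Measurable f) :
    ∫⁻ z in preA M ⁻¹' I, f z ∂η = ∑ u : Fin M → A, if u ∈ I then ∫⁻ z in preA M ⁻¹' {u}, f z ∂η else 0 := by
  have hr := measurable_preA (A := A) M
  have hI : MeasurableSet (preA M ⁻¹' I) := hr (Set.toFinite I).measurableSet
  have h1 := fin_part η hr (fun u => if u ∈ I then 1 else 0) hf
  rw [← lintegral_indicator hI]
  simp only [ite_mul, one_mul, zero_mul] at h1
  rw [← h1]
  refine lintegral_congr fun z => ?_
  by_cases h : preA M z ∈ I <;> simp [indicator, h]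

lemma conv_fin {ω : Ω} {η : Measure (SeqSpace A)} (hc : ConvA X ν ω η) (M : ℕ) (I : Set (Fin M → A)) :
    Tendsto (fun n => ∫⁻ z in preA M ⁻¹' I, yE X z n ω ∂ν) atTop (nhds (η (preA M ⁻¹' I))) := by
  classical
  have h1 : η (preA M ⁻¹' I) = ∑ u : Fin M → A, if u ∈ I then η (preA M ⁻¹' {u}) else 0 := by
    have := pre_sum η M I (f := fun _ => 1) measurable_const
    simpa using this
  rw [h1]
  simp only [fun n => pre_sum ν M I (meas_yE_right (X := X) n ω)]
  refine tendsto_finsetSum _ fun u _ => ?_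
  by_cases hu : u ∈ I
  · simp only [hu, if_true]
    have := hc (List.ofFn u)
    rwa [cylinderA_ofFn] at this
  · simp only [hu, if_false]
    exact tendsto_const_nhds

lemma le_add_liminf {x c : ℝ≥0∞} {a b : ℕ → ℝ≥0∞} (ha : Tendsto a atTop (nhds x))
    (h : ∀ᶠ n in atTop, a n ≤ c + b n) : x ≤ c + liminf b atTop := by
  have h1 : x - c ≤ liminf b atTop := by
    refine le_of_forall_gt fun r hr => ?_
    by_contra hlt
    have hr' := not_lt.1 hlt
    have hfr := frequently_lt_of_liminf_lt (by isBoundedDefault) hr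
    obtain ⟨r', hr1, hr2⟩ := exists_between hr
    have hfr := frequently_lt_of_liminf_lt (by isBoundedDefault) hr1
    have : x ≤ c + r' := le_of_tendsto_of_frequently ha
      ((hfr.and_eventually h).mono fun n hn => hn.2.trans (by gcongr; exact hn.1.le))
    have h4 : x - c ≤ r' := tsub_le_iff_left.2 this
    exact absurd (hr'.trans h4) (not_le.2 hr2)
  exact tsub_le_iff_left.1 h1

lemma AC_pt [TopologicalSpace B] [DiscreteTopology B] [BorelSpace B] {ω : Ω} {η : Measure (SeqSpace A)}
    (hc : ConvA X ν ω η) (hR : ⨅ K : ℕ, liminf (fun N => QT q X ν N K ω) atTop = 0) :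
    η.map (prQ q) ≪ ν.map (prQ q) := by
  have hq := measurable_prQ (A := A) q
  have hopen : ∀ O : Set (SeqSpace B), IsOpen O → ∀ K : ℕ,
      η.map (prQ q) O ≤ K * ν.map (prQ q) O + liminf (fun N => QT q X ν N K ω) atTop := by
    intro O hO K
    let OM : ℕ → Set (SeqSpace B) := fun M => {y | cylA y M ⊆ O}
    have hmono : Monotone OM := fun M M' h y hy => (cylA_anti h).trans hy
    have hU : O = ⋃ M, OM M := by
      ext y
      simp only [OM, mem_iUnion, mem_ofPred_eq]
      constructor
      · intro hy
        obtain ⟨I, u, hu1, hu2⟩ := isOpen_pi_iff.1 hO y hy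
        refine ⟨I.sup id + 1, fun y' hy' => hu2 ?_⟩
        intro i hi
        simp only [cylA, mem_ofPred_eq] at hy'
        have : i ≤ I.sup id := Finset.le_sup (f := id) hi
        rw [hy' i (by omega)]
        exact (hu1 i hi).2
      · rintro ⟨M, hM⟩
        refine hM ?_
        simp [cylA]
    have hcong : ∀ M y y', (∀ i < M, y i = y' i) → y ∈ OM M → y' ∈ OM M := by
      intro M y y' h hy
      have : y' ∈ cylA y M := by
        simp only [cylA, mem_ofPred_eq]; exact fun i hi => (h i hi).symm
      simp only [OM, mem_ofPred_eq] at hy ⊢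
      rwa [cylA_congr this]
    have hM : ∀ M, η.map (prQ q) (OM M) ≤ K * ν.map (prQ q) O +
        liminf (fun N => QT q X ν N K ω) atTop := by
      intro M
      have hOm : MeasurableSet (OM M) := by
        have : OM M = preA M ⁻¹' (preA M '' OM M) := by
          ext y
          constructor
          · exact fun h => ⟨y, h, rfl⟩
          · rintro ⟨y', h1, h2⟩
            exact hcong M y' y (fun i hi => congrFun h2 ⟨i, hi⟩) h1
        rw [this]
        exact measurable_preA M (Set.toFinite _).measurableSet
      rw [Measure.map_apply hq hOm]
      have e1 : prQ q ⁻¹' (OM M) = preA M ⁻¹' (preA M '' (prQ q ⁻¹' (OM M))) := by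
        ext z
        constructor
        · exact fun h => ⟨z, h, rfl⟩
        · rintro ⟨z', h1, h2⟩
          refine hcong M (prQ q z') (prQ q z) (fun i hi => ?_) h1
          have := congrFun h2 ⟨i, hi⟩
          exact congrArg q this
      have ht := conv_fin hc M (preA M '' (prQ q ⁻¹' (OM M)))
      rw [← e1] at ht
      refine le_add_liminf ht ?_
      filter_upwards [eventually_ge_atTop M] with N hN
      have e2 : prQ q ⁻¹' (OM M) = rBox q 0 N ⁻¹' (rBox q 0 N '' (prQ q ⁻¹' (OM M))) := by
        ext z
        constructor
        · exact fun h => ⟨z, h, rfl⟩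
        · rintro ⟨z', h1, h2⟩
          refine hcong M (prQ q z') (prQ q z) (fun i hi => ?_) h1
          exact congrFun (congrArg Prod.snd h2) ⟨i, by omega⟩
      rw [e2]
      refine (QT_split q N K ω _).trans ?_
      rw [← e2, ← Measure.map_apply hq hOm]
      gcongr
      rw [hU]
      exact subset_iUnion OM M
    conv_lhs => rw [hU]
    rw [hmono.measure_iUnion]
    exact iSup_le hM
  refine Measure.AbsolutelyContinuous.mk fun s hs h0 => ?_
  rw [← nonpos_iff_eq_zero, ← hR]
  refine le_iInf fun K => ?_
  refine ENNReal.le_of_forall_pos_le_add fun ε hε _ => ?_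
  have hlt : ν.map (prQ q) s < (ε : ℝ≥0∞) / (K + 1) := by
    rw [h0]
    exact ENNReal.div_pos (by exact_mod_cast hε.ne') (by finiteness)
  obtain ⟨O, hsO, hO, hOlt⟩ := Set.exists_isOpen_lt_of_lt s _ hlt
  calc _ ≤ η.map (prQ q) O := measure_mono hsO
    _ ≤ _ := hopen O hO K
    _ ≤ ε + liminf (fun N => QT q X ν N K ω) atTop := by
        gcongr
        calc _ ≤ ((K : ℝ≥0∞) + 1) * ((ε : ℝ≥0∞) / (K + 1)) := by
              gcongr; exact le_self_add
          _ = ε := ENNReal.mul_div_cancel (by simp) (by finiteness)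
    _ = _ := add_comm _ _

lemma R_zero (hM : CascadeM1A P X X₀) (hfin : entropyXA P X₀ ≠ ⊤) (hν : Ergodic (shiftA A) ν)
    {h h' : ℝ} (hent : Tendsto (entropySeqA ν) atTop (nhds h))
    (hent' : Tendsto (entropySeqA (ν.map (prQ q))) atTop (nhds h'))
    (hδ : (entropyXA P X₀).toReal < h - h') :
    ∀ᵐ ω ∂P, ⨅ K : ℕ, liminf (fun N => QT q X ν N K ω) atTop = 0 := by
  have hm : ∀ K, Measurable (fun ω => liminf (fun N => QT q X ν N K ω) atTop) := fun K =>
    Measurable.liminf fun N => meas_QT q hM N K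
  have hmi : Measurable (fun ω => ⨅ K : ℕ, liminf (fun N => QT q X ν N K ω) atTop) :=
    Measurable.iInf hm
  have h0 : ∫⁻ ω, ⨅ K : ℕ, liminf (fun N => QT q X ν N K ω) atTop ∂P = 0 := by
    by_contra hne
    obtain ⟨r, hr0, hr⟩ := exists_between (pos_iff_ne_zero.2 hne)
    obtain ⟨K, hK⟩ := QT_tail q hM hfin hν hent hent' hδ hr0.ne'
    have : ∫⁻ ω, ⨅ K : ℕ, liminf (fun N => QT q X ν N K ω) atTop ∂P ≤ r := by
      calc _ ≤ ∫⁻ ω, liminf (fun N => QT q X ν N K ω) atTop ∂P :=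
            lintegral_mono fun ω => iInf_le _ K
        _ ≤ liminf (fun N => ∫⁻ ω, QT q X ν N K ω ∂P) atTop :=
            lintegral_liminf_le fun N => meas_QT q hM N K
        _ ≤ liminf (fun _ : ℕ => r) atTop := liminf_le_liminf (Eventually.of_forall hK)
        _ = r := by simp
    exact absurd hr (not_lt.2 this)
  exact (lintegral_eq_zero_iff hmi).1 h0

end
end

noncomputable section

section
variable {A B : Type*} {Ω : Type*} [MeasurableSpace Ω] [MeasurableSpace A] [Fintype A]
  [MeasurableSingletonClass A] [MeasurableSpace B] [Fintype B] [MeasurableSingletonClass B]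
  {P : Measure Ω} [IsProbabilityMeasure P] {X : List A → Ω → ℝ}
  {X₀ : Ω → ℝ} {ν : Measure (SeqSpace A)} [IsProbabilityMeasure ν] (q : A → B)

/-- random measures dominated by the approximations on cylinders -/
def SubA (X : List A → Ω → ℝ) (ν : Measure (SeqSpace A)) (κ : Ω → Measure (SeqSpace A)) : Prop :=
  ∀ ω (M : ℕ) (I : Set (Fin M → A)),
    κ ω (preA M ⁻¹' I) ≤ liminf (fun n => ∫⁻ z in preA M ⁻¹' I, yE X z n ω ∂ν) atTop

lemma sum_liminf_le {ι : Type*} [Fintype ι] (f : ℕ → ι → ℝ≥0∞) :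
    ∑ i, liminf (fun n => f n i) atTop ≤ liminf (fun n => ∑ i, f n i) atTop := by
  letI : MeasurableSpace ι := ⊤
  haveI : MeasurableSingletonClass ι := ⟨fun _ => trivial⟩
  have : ∫⁻ i, liminf (fun n => f n i) atTop ∂(Measure.count : Measure ι) ≤
      liminf (fun n => ∫⁻ i, f n i ∂(Measure.count : Measure ι)) atTop :=
    lintegral_liminf_le (fun n => measurable_of_finite _)
  simpa [lintegral_count, tsum_fintype] using this

lemma preA_surj [Nonempty A] (M : ℕ) : Function.Surjective (preA (A := A) M) := by
  intro u
  refine ⟨fun i => if h : i < M then u ⟨i, h⟩ else Classical.arbitrary A, ?_⟩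
  funext i
  simp [preA]

lemma fatou_gen (hM : CascadeM1A P X X₀) {κ : Ω → Measure (SeqSpace A)} (hk : SubA X ν κ) (M : ℕ)
    (Φ : Ω → SeqSpace A → ℝ≥0∞) (Ψ : ℕ → Ω → SeqSpace A → ℝ≥0∞)
    (hΦd : ∀ ω z z', preA M z = preA M z' → Φ ω z = Φ ω z')
    (hΨd : ∀ N ω z z', preA M z = preA M z' → Ψ N ω z = Ψ N ω z')
    (hΨm : ∀ N, Measurable (fun p : Ω × SeqSpace A => Ψ N p.1 p.2))
    (hle : ∀ ω z, Φ ω z ≤ liminf (fun N => Ψ N ω z) atTop) {c : ℝ≥0∞}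
    (hc : ∀ᶠ N in atTop, ∫⁻ ω, ∫⁻ z, yE X z N ω * Ψ N ω z ∂ν ∂P ≤ c) :
    ∫⁻ ω, ∫⁻ z, Φ ω z ∂(κ ω) ∂P ≤ c := by
  have hne : Nonempty A := by
    obtain ⟨z⟩ := ν.nonempty_of_neZero
    exact ⟨z 0⟩
  let s := Function.surjInv (preA_surj (A := A) M)
  have hs : ∀ z, preA M z = preA M (s (preA M z)) := fun z =>
    (Function.surjInv_eq (preA_surj (A := A) M) _).symm
  have hr := measurable_preA (A := A) M
  have key : ∀ ω, ∫⁻ z, Φ ω z ∂(κ ω) ≤ liminf (fun N => ∫⁻ z, yE X z N ω * Ψ N ω z ∂ν) atTop := by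
    intro ω
    have e1 : ∫⁻ z, Φ ω z ∂(κ ω) = ∑ u, Φ ω (s u) * κ ω (preA M ⁻¹' {u}) := by
      have := fin_part (κ ω) hr (fun u => Φ ω (s u)) (G := fun _ => 1) measurable_const
      simp only [mul_one, lintegral_const, Measure.restrict_apply MeasurableSet.univ, univ_inter,
        one_mul] at this
      rw [← this]
      exact lintegral_congr fun z => hΦd _ _ _ (hs z)
    have e2 : ∀ N, ∫⁻ z, yE X z N ω * Ψ N ω z ∂ν =
        ∑ u, Ψ N ω (s u) * ∫⁻ z in preA M ⁻¹' {u}, yE X z N ω ∂ν := by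
      intro N
      rw [← fin_part ν hr (fun u => Ψ N ω (s u)) (meas_yE_right (X := X) N ω)]
      refine lintegral_congr fun z => ?_
      rw [hΨd N ω _ _ (hs z), mul_comm]
    simp only [e1, e2]
    refine le_trans (Finset.sum_le_sum fun u _ => ?_) (sum_liminf_le _)
    refine (mul_le_mul' (hle ω (s u)) (hk ω M {u})).trans ?_
    exact ENNReal.le_liminf_mul
  have hm : ∀ N, Measurable (fun ω => ∫⁻ z, yE X z N ω * Ψ N ω z ∂ν) := fun N =>
    ((meas_yE_joint hM N).mul (hΨm N)).lintegral_prod_right'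
  calc _ ≤ ∫⁻ ω, liminf (fun N => ∫⁻ z, yE X z N ω * Ψ N ω z ∂ν) atTop ∂P := lintegral_mono key
    _ ≤ liminf (fun N => ∫⁻ ω, ∫⁻ z, yE X z N ω * Ψ N ω z ∂ν ∂P) atTop := lintegral_liminf_le hm
    _ ≤ liminf (fun _ : ℕ => c) atTop := liminf_le_liminf hc
    _ = c := by simp

lemma tail_small {S : Type*} [MeasurableSpace S] (η : Measure S) [IsFiniteMeasure η] {G : ℕ → Set S}
    (hG : ∀ n, MeasurableSet (G n)) (hmono : Monotone G) (h : ∀ᵐ z ∂η, ∃ n, z ∈ G n) :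
    Tendsto (fun n => η (G n)ᶜ) atTop (nhds 0) := by
  have := tendsto_measure_iInter_atTop (μ := η) (s := fun n => (G n)ᶜ)
    (fun n => (hG n).compl.nullMeasurableSet) (fun a b hab => compl_subset_compl.2 (hmono hab))
    ⟨0, measure_ne_top _ _⟩
  have h0 : η (⋂ n, (G n)ᶜ) = 0 := by
    rw [ae_iff] at h
    convert h using 2
    ext z; simp [mem_ofPred_eq]
  rwa [h0] at this

/-- tilted transfer for a functional of the densities along the path -/
lemma tilt_event (hM : CascadeM1A P X X₀) (z : SeqSpace A) (N : ℕ) {D : Set (Fin (N+1) → ℝ≥0∞)}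
    (hD : MeasurableSet D) :
    ∫⁻ ω, yE X z N ω * D.indicator 1 (fun k : Fin (N+1) => yE X z k ω) ∂P =
      tiltI P X₀ {t | (fun k : Fin (N+1) => yT k t) ∈ D} := by
  let yy : (Fin N → ℝ) → (Fin (N+1) → ℝ≥0∞) := fun v k =>
    ∏ j ∈ (Finset.univ : Finset (Fin N)).filter (fun j => j.1 < k.1), ENNReal.ofReal (v j)
  have hyy : Measurable yy := measurable_pi_lambda _ fun k =>
    Finset.measurable_fun_prod _ fun j _ => ENNReal.measurable_ofReal.comp (measurable_pi_apply j)
  have hprod : ∀ (f : ℕ → ℝ≥0∞) (k : Fin (N+1)), ∏ j ∈ Finset.range k.1, f j =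
      ∏ j ∈ (Finset.univ : Finset (Fin N)).filter (fun j => j.1 < k.1), f j := by
    intro f k
    symm
    refine Finset.prod_bij (fun j _ => j.1) ?_ ?_ ?_ ?_
    · intro j hj; simpa using hj
    · intro a _ b _ h; exact Fin.ext h
    · intro b hb
      simp only [Finset.mem_range] at hb
      exact ⟨⟨b, by omega⟩, by simpa using hb, rfl⟩
    · intros; rfl
  have h := tilt_lint hM z N (g := fun v => D.indicator 1 (yy v))
    ((measurable_const.indicator hD).comp hyy)
  have e1 : ∀ ω, yy (fun j : Fin N => X (wordPrefixA z (j + 1)) ω) =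
      fun k : Fin (N+1) => yE X z k ω := by
    intro ω
    funext k
    rw [yE_prod hM.nonneg, hprod]
    rfl
  have e2 : ∀ t : ℕ → ℝ, yy (fun j : Fin N => t j) = fun k : Fin (N+1) => yT k t := by
    intro t
    funext k
    rw [yT, hprod]
  simp only [e1, e2] at h
  rw [h]
  have hm : MeasurableSet {t : ℕ → ℝ | (fun k : Fin (N+1) => yT k t) ∈ D} :=
    (measurable_pi_lambda (fun (t : ℕ → ℝ) (k : Fin (N+1)) => yT k t) fun k => measurable_yT _) hD
  rw [← lintegral_indicator_one hm]
  rfl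
end
end

noncomputable section

section
variable {A B : Type*} {Ω : Type*} [MeasurableSpace Ω] [MeasurableSpace A] [Fintype A]
  [MeasurableSingletonClass A] [MeasurableSpace B] [Fintype B] [MeasurableSingletonClass B]
  {P : Measure Ω} [IsProbabilityMeasure P] {X : List A → Ω → ℝ}
  {X₀ : Ω → ℝ} {ν : Measure (SeqSpace A)} [IsProbabilityMeasure ν] (q : A → B)

/-- bad events -/
def BadS (X : List A → Ω → ℝ) (ν : Measure (SeqSpace A)) (lo : ℕ → ℝ≥0∞) (lo2 a : ℕ → ℕ → ℝ≥0∞)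
    (n0 M : ℕ) (F : ℕ → ℕ → Ω → SeqSpace A → ℝ≥0∞) : Set (Ω × SeqSpace A) :=
  {p | ∃ m k, m ≤ M ∧ k ≤ m ∧ n0 ≤ k ∧
    (yE X p.2 k p.1 < lo k ∨ ν (box q k m p.2) < lo2 k m ∨ a k m < F k m p.1 p.2)}

lemma box_congr_pre {M k m : ℕ} (hk : k ≤ M) (hm : m ≤ M) {z z' : SeqSpace A}
    (h : preA M z = preA M z') : box q k m z = box q k m z' := by
  have hi : ∀ i < M, z i = z' i := fun i hi => congrFun h ⟨i, hi⟩
  ext w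
  simp only [box, mem_ofPred_eq]
  constructor
  · exact fun hw => ⟨fun i hi' => by rw [hw.1 i hi', hi i (by omega)],
      fun i hi' => by rw [hw.2 i hi', hi i (by omega)]⟩
  · exact fun hw => ⟨fun i hi' => by rw [hw.1 i hi', hi i (by omega)],
      fun i hi' => by rw [hw.2 i hi', hi i (by omega)]⟩

lemma yE_congr_pre {M k : ℕ} (hk : k ≤ M) {z z' : SeqSpace A}
    (h : preA M z = preA M z') (ω : Ω) : yE X z k ω = yE X z' k ω := by
  refine yE_congr X ?_ ω
  simp only [cylA, mem_ofPred_eq]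
  exact fun i hi => congrFun h ⟨i, by omega⟩

lemma box_as_pre (k m M : ℕ) (hk : k ≤ M) (hm : m ≤ M) (z : SeqSpace A) :
    ∃ I : Set (Fin M → A), box q k m z = preA M ⁻¹' I := by
  refine ⟨preA M '' box q k m z, ?_⟩
  ext w
  constructor
  · exact fun h => ⟨w, h, rfl⟩
  · rintro ⟨w', h1, h2⟩
    have hi : ∀ i < M, w' i = w i := fun i hi => congrFun h2 ⟨i, hi⟩
    simp only [box, mem_ofPred_eq] at h1 ⊢
    exact ⟨fun i hi' => by rw [← hi i (by omega), h1.1 i hi'],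
      fun i hi' => by rw [← hi i (by omega), h1.2 i hi']⟩

lemma measurableSet_BadS (hM : CascadeM1A P X X₀) (lo : ℕ → ℝ≥0∞) (lo2 a : ℕ → ℕ → ℝ≥0∞)
    (n0 M : ℕ) {F : ℕ → ℕ → Ω → SeqSpace A → ℝ≥0∞}
    (hF : ∀ k m, Measurable (fun p : Ω × SeqSpace A => F k m p.1 p.2)) :
    MeasurableSet (BadS q X ν lo lo2 a n0 M F) := by
  have : BadS q X ν lo lo2 a n0 M F = ⋃ m : ℕ, ⋃ k : ℕ, ⋃ (_ : m ≤ M ∧ k ≤ m ∧ n0 ≤ k),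
      ({p | yE X p.2 k p.1 < lo k} ∪ ({p | ν (box q k m p.2) < lo2 k m} ∪
        {p | a k m < F k m p.1 p.2})) := by
    ext p
    simp only [BadS, mem_ofPred_eq, mem_iUnion, mem_union, exists_prop]
    constructor
    · rintro ⟨m, k, h1, h2, h3, h4⟩; exact ⟨m, k, ⟨h1, h2, h3⟩, h4⟩
    · rintro ⟨m, k, ⟨h1, h2, h3⟩, h4⟩; exact ⟨m, k, h1, h2, h3, h4⟩
  rw [this]
  refine MeasurableSet.iUnion fun m => MeasurableSet.iUnion fun k => MeasurableSet.iUnion fun _ => ?_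
  refine (measurableSet_lt (meas_yE_joint hM k) measurable_const).union
    ((measurableSet_lt ((meas_nubox q ν k m).comp measurable_snd) measurable_const).union
      (measurableSet_lt measurable_const (hF k m)))

/-- approximate box masses -/
def nuN (X : List A → Ω → ℝ) (ν : Measure (SeqSpace A)) (N k m : ℕ) (ω : Ω) (z : SeqSpace A) : ℝ≥0∞ :=
  ∫⁻ z' in box q k m z, yE X z' N ω ∂ν

lemma meas_nuN (hM : CascadeM1A P X X₀) (N k m : ℕ) :
    Measurable (fun p : Ω × SeqSpace A => nuN q X ν N k m p.1 p.2) := by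
  have := meas_joint (measurable_rBox q k m)
    (F := fun (ω : Ω) i => ∫⁻ z' in rBox q k m ⁻¹' {i}, yE X z' N ω ∂ν) (fun i => meas_int hM _ N)
  simpa only [nuN, box_eq] using this

lemma meas_TN (hM : CascadeM1A P X X₀) (n m N : ℕ) :
    Measurable (fun p : Ω × SeqSpace A => TN q X ν n m N p.2 p.1) := by
  refine Finset.measurable_fun_sum _ fun k _ => ?_
  exact (meas_yE_joint hM k).mul ((meas_nubox q ν k m).comp measurable_snd)

lemma meas_kbox (κ : Kernel Ω (SeqSpace A)) (k m : ℕ) :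
    Measurable (fun p : Ω × SeqSpace A => κ p.1 (box q k m p.2)) := by
  have := meas_joint (measurable_rBox q k m)
    (F := fun (ω : Ω) i => κ ω (rBox q k m ⁻¹' {i}))
    (fun i => κ.measurable_coe (measurable_rBox q k m (measurableSet_singleton i)))
  simpa only [box_eq] using this

lemma mem_BadS_congr {lo : ℕ → ℝ≥0∞} {lo2 a : ℕ → ℕ → ℝ≥0∞} {n0 M : ℕ} 
    (F : ℕ → ℕ → Ω → SeqSpace A → ℝ≥0∞) {ω : Ω} {z z' : SeqSpace A} (hF : ∀ k m, k ≤ M → m ≤ M → F k m ω z = F k m ω z')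
    (h : preA M z = preA M z') :
    (ω, z) ∈ BadS q X ν lo lo2 a n0 M F ↔ (ω, z') ∈ BadS q X ν lo lo2 a n0 M F := by
  simp only [BadS, mem_ofPred_eq]
  refine exists_congr fun m => exists_congr fun k => ?_
  refine and_congr_right fun h1 => and_congr_right fun h2 => and_congr_right fun h3 => ?_
  rw [yE_congr_pre (h2.trans h1) h, box_congr_pre q (h2.trans h1) h1 h, hF k m (h2.trans h1) h1]

lemma bad_bound (hM : CascadeM1A P X X₀) {κ : Kernel Ω (SeqSpace A)} (hk : SubA X ν κ)
    (lo up : ℕ → ℝ≥0∞) (lo2 a Bd : ℕ → ℕ → ℝ≥0∞) (n0 M : ℕ) {C : Set (SeqSpace A)}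
    (hC : MeasurableSet C) (hC2 : ∀ z ∈ C, ∀ k ≥ n0, ∀ m ≥ k, lo2 k m ≤ ν (box q k m z))
    (hT : ∀ N z ω, z ∈ C → (∀ k, n0 ≤ k → k ≤ N → yE X z k ω ≤ up k) →
      ∀ k m, n0 ≤ k → k ≤ m → TN q X ν k m N z ω ≤ Bd k m)
    (ha : ∀ k m, a k m ≠ 0) (ha' : ∀ k m, a k m ≠ ⊤)
    (hB : ∀ k m, Bd k m ≠ 0) (hB' : ∀ k m, Bd k m ≠ ⊤) :
    ∫⁻ ω, κ ω (Prod.mk ω ⁻¹' BadS q X ν lo lo2 a n0 M (fun k m ω z => κ ω (box q k m z))) ∂P ≤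
      ν Cᶜ + tiltI P X₀ {t | ¬ ∀ k ≥ n0, lo k ≤ yT k t ∧ yT k t ≤ up k} +
        ∑ m ∈ Finset.Icc n0 M, ∑ k ∈ Finset.Icc n0 m, Bd k m / a k m := by
  classical
  let FN : ℕ → ℕ → ℕ → Ω → SeqSpace A → ℝ≥0∞ := fun N k m ω z => nuN q X ν N k m ω z
  let Fκ : ℕ → ℕ → Ω → SeqSpace A → ℝ≥0∞ := fun k m ω z => κ ω (box q k m z)
  have hBκ : MeasurableSet (BadS q X ν lo lo2 a n0 M Fκ) :=
    measurableSet_BadS q hM lo lo2 a n0 M (fun k m => meas_kbox q κ k m)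
  have hBN : ∀ N, MeasurableSet (BadS q X ν lo lo2 a n0 M (FN N)) := fun N =>
    measurableSet_BadS q hM lo lo2 a n0 M (fun k m => meas_nuN q hM N k m)
  have e0 : ∀ ω, κ ω (Prod.mk ω ⁻¹' BadS q X ν lo lo2 a n0 M Fκ) =
      ∫⁻ z, (BadS q X ν lo lo2 a n0 M Fκ).indicator 1 (ω, z) ∂(κ ω) := by
    intro ω
    rw [← lintegral_indicator_one (measurable_prodMk_left hBκ)]
    rfl
  change ∫⁻ ω, κ ω (Prod.mk ω ⁻¹' BadS q X ν lo lo2 a n0 M Fκ) ∂P ≤ _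
  simp only [e0]
  have hΨm : ∀ N, Measurable (fun p : Ω × SeqSpace A =>
      (BadS q X ν lo lo2 a n0 M (FN N)).indicator (1 : Ω × SeqSpace A → ℝ≥0∞) (p.1, p.2)) := fun N =>
    measurable_const.indicator (hBN N)
  refine fatou_gen hM hk M (fun ω z => (BadS q X ν lo lo2 a n0 M Fκ).indicator 1 (ω, z))
    (fun N ω z => (BadS q X ν lo lo2 a n0 M (FN N)).indicator 1 (ω, z)) ?_ ?_ hΨm ?_ ?_
  · intro ω z z' h
    have := mem_BadS_congr q (ν := ν) (lo := lo) (lo2 := lo2) (a := a) (n0 := n0) (X := X) Fκ (ω := ω)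
      (fun k m h1 h2 => by simp only [Fκ]; rw [box_congr_pre q h1 h2 h]) h
    simp only [indicator, this]
    rfl
  · intro N ω z z' h
    have := mem_BadS_congr q (ν := ν) (lo := lo) (lo2 := lo2) (a := a) (n0 := n0) (X := X) (FN N) (ω := ω)
      (fun k m h1 h2 => by simp only [FN, nuN]; rw [box_congr_pre q h1 h2 h]) h
    simp only [indicator, this]
    rfl
  · intro ω z
    by_cases hb : (ω, z) ∈ BadS q X ν lo lo2 a n0 M Fκ
    · rw [indicator_of_mem hb]
      have hev : ∀ᶠ N in atTop, (ω, z) ∈ BadS q X ν lo lo2 a n0 M (FN N) := by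
        obtain ⟨m, k, h1, h2, h3, h4⟩ := hb
        rcases h4 with h4 | h4 | h4
        · exact Eventually.of_forall fun N => ⟨m, k, h1, h2, h3, Or.inl h4⟩
        · exact Eventually.of_forall fun N => ⟨m, k, h1, h2, h3, Or.inr (Or.inl h4)⟩
        · obtain ⟨I, hI⟩ := box_as_pre q k m M (h2.trans h1) h1 z
          have h5 : a k m < liminf (fun n => ∫⁻ z' in box q k m z, yE X z' n ω ∂ν) atTop := by
            refine lt_of_lt_of_le h4 ?_
            simp only [Fκ, hI]
            exact hk ω M I
          filter_upwards [eventually_lt_of_lt_liminf h5] with N hN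
          exact ⟨m, k, h1, h2, h3, Or.inr (Or.inr hN)⟩
      refine le_trans ?_ (liminf_le_liminf (u := fun _ : ℕ => (1 : ℝ≥0∞)) ?_)
      · simp
      · filter_upwards [hev] with N hN
        rw [indicator_of_mem hN]; rfl
    · rw [indicator_of_notMem hb]; exact zero_le
  · filter_upwards [eventually_ge_atTop M] with N hN
    rw [lintegral_lintegral_swap ((meas_yE_joint hM N).mul (hΨm N)).aemeasurable]
    let D : Set (Fin (N+1) → ℝ≥0∞) := {y | ¬ ∀ k : Fin (N+1), n0 ≤ k.1 → lo k ≤ y k ∧ y k ≤ up k}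
    have hD : MeasurableSet D := by
      have : D = (⋂ k : Fin (N+1), ⋂ (_ : n0 ≤ k.1), {y | lo k ≤ y k ∧ y k ≤ up k})ᶜ := by
        ext y; simp [D, mem_ofPred_eq]
      rw [this]
      refine (MeasurableSet.iInter fun k => MeasurableSet.iInter fun _ => ?_).compl
      exact (measurableSet_le measurable_const (measurable_pi_apply k)).inter
        (measurableSet_le (measurable_pi_apply k) measurable_const)
    have hpt : ∀ ω z, (BadS q X ν lo lo2 a n0 M (FN N)).indicator (1 : Ω × SeqSpace A → ℝ≥0∞) (ω, z) ≤
        Cᶜ.indicator 1 z + D.indicator 1 (fun k : Fin (N+1) => yE X z k ω) +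
        ∑ m ∈ Finset.Icc n0 M, ∑ k ∈ Finset.Icc n0 m, Bd k m / a k m *
          (nuN q X ν N k m ω z * (TN q X ν k m N z ω)⁻¹) := by
      intro ω z
      by_cases hb : (ω, z) ∈ BadS q X ν lo lo2 a n0 M (FN N)
      swap
      · rw [indicator_of_notMem hb]; exact zero_le
      rw [indicator_of_mem hb]
      by_cases hzC : z ∈ C
      swap
      · rw [indicator_of_mem (show z ∈ Cᶜ from hzC), add_assoc]
        exact le_self_add
      by_cases hzD : (fun k : Fin (N+1) => yE X z k ω) ∈ D
      · rw [indicator_of_mem hzD, add_comm (Cᶜ.indicator _ _), add_assoc]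
        exact le_self_add
      simp only [D, mem_ofPred_eq, not_not] at hzD
      have hT' := hT N z ω hzC (fun k h1 h2 => (hzD ⟨k, by omega⟩ h1).2)
      obtain ⟨m, k, h1, h2, h3, h4⟩ := hb
      have h5 : a k m < nuN q X ν N k m ω z := by
        rcases h4 with h4 | h4 | h4
        · exact absurd (hzD ⟨k, by omega⟩ h3).1 (not_le.2 h4)
        · exact absurd (hC2 z hzC k h3 m h2) (not_le.2 h4)
        · exact h4
      have h6 := hT' k m h3 h2
      refine le_trans ?_ le_add_self
      have h7 : (1 : ℝ≥0∞) ≤ Bd k m / a k m * (nuN q X ν N k m ω z * (TN q X ν k m N z ω)⁻¹) := by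
        by_cases hT0 : TN q X ν k m N z ω = 0
        · have h8 : nuN q X ν N k m ω z ≠ 0 := (lt_of_le_of_lt zero_le h5).ne'
          have h9 : Bd k m / a k m ≠ 0 := (ENNReal.div_pos (hB k m) (ha' k m)).ne'
          rw [hT0, ENNReal.inv_zero, ENNReal.mul_top h8, ENNReal.mul_top h9]
          exact le_top
        · have hTt : TN q X ν k m N z ω ≠ ⊤ := ne_top_of_le_ne_top (hB' k m) h6
          calc (1 : ℝ≥0∞) = (TN q X ν k m N z ω * (TN q X ν k m N z ω)⁻¹) * (a k m * (a k m)⁻¹) := by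
                rw [ENNReal.mul_inv_cancel hT0 hTt, ENNReal.mul_inv_cancel (ha k m) (ha' k m), one_mul]
            _ = TN q X ν k m N z ω / a k m * (a k m * (TN q X ν k m N z ω)⁻¹) := by
                rw [div_eq_mul_inv]; ring
            _ ≤ _ := by gcongr
      refine h7.trans ?_
      refine le_trans (Finset.single_le_sum (f := fun k => Bd k m / a k m *
          (nuN q X ν N k m ω z * (TN q X ν k m N z ω)⁻¹)) (fun _ _ => zero_le)
        (Finset.mem_Icc.2 ⟨h3, h2⟩)) ?_
      exact Finset.single_le_sum (f := fun m => ∑ k ∈ Finset.Icc n0 m, Bd k m / a k m *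
          (nuN q X ν N k m ω z * (TN q X ν k m N z ω)⁻¹)) (fun _ _ => zero_le)
        (Finset.mem_Icc.2 ⟨h3.trans h2, h1⟩)
    have hz : ∀ z, ∫⁻ ω, yE X z N ω * (BadS q X ν lo lo2 a n0 M (FN N)).indicator 1 (ω, z) ∂P ≤
        Cᶜ.indicator 1 z + (tiltI P X₀ {t | ¬ ∀ k ≥ n0, lo k ≤ yT k t ∧ yT k t ≤ up k} +
        ∑ m ∈ Finset.Icc n0 M, ∑ k ∈ Finset.Icc n0 m, Bd k m / a k m) := by
      intro z
      have hmy : Measurable (yE X z N) := meas_yE hM z N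
      have hm1 : Measurable (fun ω => yE X z N ω * Cᶜ.indicator 1 z) := hmy.mul_const _
      have hm2 : Measurable (fun ω => yE X z N ω * D.indicator 1 (fun k : Fin (N+1) => yE X z k ω)) :=
        hmy.mul ((measurable_const.indicator hD).comp
          (measurable_pi_lambda (fun (ω : Ω) (k : Fin (N+1)) => yE X z k ω) fun k => meas_yE hM z k))
      have hm12 : Measurable (fun ω => yE X z N ω * Cᶜ.indicator 1 z +
          yE X z N ω * D.indicator 1 (fun k : Fin (N+1) => yE X z k ω)) := hm1.add hm2
      have hm3 : ∀ k m, Measurable (fun ω => yE X z N ω *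
          (nuN q X ν N k m ω z * (TN q X ν k m N z ω)⁻¹)) := fun k m =>
        hmy.mul (((meas_nuN q hM N k m).comp measurable_prodMk_right).mul
          ((meas_TN q hM k m N).comp measurable_prodMk_right).inv)
      calc _ ≤ ∫⁻ ω, ((yE X z N ω * Cᶜ.indicator 1 z +
            yE X z N ω * D.indicator 1 (fun k : Fin (N+1) => yE X z k ω)) +
            ∑ m ∈ Finset.Icc n0 M, ∑ k ∈ Finset.Icc n0 m, Bd k m / a k m *
            (yE X z N ω * (nuN q X ν N k m ω z * (TN q X ν k m N z ω)⁻¹))) ∂P := by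
              refine lintegral_mono fun ω => ?_
              refine (mul_le_mul_right (hpt ω z) _).trans (le_of_eq ?_)
              rw [mul_add, mul_add, Finset.mul_sum]
              congr 1
              refine Finset.sum_congr rfl fun m _ => ?_
              rw [Finset.mul_sum]
              refine Finset.sum_congr rfl fun k _ => ?_
              ring
        _ ≤ _ := by
              rw [lintegral_add_left hm12, lintegral_add_left hm1, lintegral_mul_const _ hmy,
                lint_yE hM, one_mul, tilt_event hM z N hD, add_assoc]
              rw [lintegral_finsetSum _ fun m _ => Finset.measurable_fun_sum _ fun k _ =>
                (hm3 k m).const_mul _]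
              refine add_le_add le_rfl (add_le_add (measure_mono ?_) (Finset.sum_le_sum fun m hm => ?_))
              · intro t ht
                simp only [D, mem_ofPred_eq] at ht ⊢
                exact fun hall => ht fun k hk => hall k hk
              · rw [lintegral_finsetSum _ fun k _ => (hm3 k m).const_mul _]
                refine Finset.sum_le_sum fun k hk => ?_
                rw [lintegral_const_mul _ (hm3 k m)]
                simp only [Finset.mem_Icc] at hk hm
                exact (mul_le_mul_right (star q hM ν m (by omega) z) _).trans (by simp)
    refine (lintegral_mono hz).trans (le_of_eq ?_)
    have hCm : Measurable (Cᶜ.indicator (1 : SeqSpace A → ℝ≥0∞)) := measurable_const.indicator hC.compl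
    rw [lintegral_add_left hCm, lintegral_indicator_one hC.compl]
    simp [add_assoc]
end
end

noncomputable section

section
variable {A B : Type*} {Ω : Type*} [MeasurableSpace Ω] [MeasurableSpace A] [Fintype A]
  [MeasurableSingletonClass A] [MeasurableSpace B] [Fintype B] [MeasurableSingletonClass B]
  {P : Measure Ω} [IsProbabilityMeasure P] {X : List A → Ω → ℝ}
  {X₀ : Ω → ℝ} {ν : Measure (SeqSpace A)} [IsProbabilityMeasure ν] (q : A → B)

/-- shorthand for exponentials -/
def eE (x : ℝ) : ℝ≥0∞ := ENNReal.ofReal (Real.exp x)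

lemma eE_mul (x y : ℝ) : eE x * eE y = eE (x + y) := by
  rw [eE, eE, eE, ← ENNReal.ofReal_mul (Real.exp_pos _).le, Real.exp_add]

lemma eE_ne_zero (x : ℝ) : eE x ≠ 0 := by simp [eE, Real.exp_pos]

lemma eE_ne_top (x : ℝ) : eE x ≠ ⊤ := ENNReal.ofReal_ne_top

lemma eE_le {x y : ℝ} (h : x ≤ y) : eE x ≤ eE y := 
  ENNReal.ofReal_le_ofReal (Real.exp_le_exp.2 h)

lemma eE_inv (x : ℝ) : (eE x)⁻¹ = eE (-x) := by
  rw [eE, eE, Real.exp_neg, ENNReal.ofReal_inv_of_pos (Real.exp_pos _)]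

lemma sum_eE {ε : ℝ} (hε : 0 < ε) : ∑' m : ℕ, ((m : ℝ≥0∞) + 1) * eE (-(ε * m)) ≠ ⊤ := by
  have hs : Summable (fun m : ℕ => ((m:ℝ) + 1) * Real.exp (-(ε * m))) := by
    have e1 := Real.summable_pow_mul_exp_neg_nat_mul 1 hε
    have e0 := Real.summable_pow_mul_exp_neg_nat_mul 0 hε
    refine (e1.add e0).congr fun m => ?_
    simp; ring_nf
  have := hs.tsum_ofReal_ne_top
  convert this using 3 with m
  rw [ENNReal.ofReal_mul (by positivity), ENNReal.ofReal_add (by positivity) (by norm_num)]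
  simp [eE]

lemma T_bound {h h' hX ε : ℝ} (hε : 0 < ε) (hδ : 3 * ε ≤ h - h' - hX) (hh' : 0 ≤ h')
    {n0 N : ℕ} {z : SeqSpace A} {ω : Ω}
    (hz : ∀ k ≥ n0, ∀ m ≥ k, ν (box q k m z) ≤ eE (-(k * h) - (m - k) * h' + ε * m))
    (hy : ∀ k, n0 ≤ k → k ≤ N → yE X z k ω ≤ eE (k * (hX + ε))) {k m : ℕ} (hk : n0 ≤ k) (hkm : k ≤ m) :
    TN q X ν k m N z ω ≤ eE (-(k * (h - h' - hX)) - m * h' + 3 * ε * m) * ∑' j : ℕ, ((j : ℝ≥0∞) + 1) * eE (-(ε * j)) := by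
  have hkm' : (k : ℝ) ≤ m := by exact_mod_cast hkm
  rw [← ENNReal.tsum_mul_left]
  refine le_trans ?_ (ENNReal.sum_le_tsum (Finset.Icc k N))
  refine Finset.sum_le_sum fun j hj => ?_
  simp only [Finset.mem_Icc] at hj
  have hkj : (k : ℝ) ≤ j := by exact_mod_cast hj.1
  have h1 : yE X z j ω * ν (box q j m z) ≤ eE (-(k * (h - h' - hX)) - m * h' + 3 * ε * m) * eE (-(ε * j)) := by
    have hyj := hy j (by omega) hj.2
    rcases le_total j m with hjm | hjm
    · refine (mul_le_mul' hyj (hz j (by omega) m hjm)).trans ?_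
      have hjm' : (j : ℝ) ≤ m := by exact_mod_cast hjm
      rw [eE_mul, eE_mul]
      refine eE_le ?_
      nlinarith [mul_le_mul_of_nonneg_right hkj (by linarith : 0 ≤ h - h' - hX),
        mul_le_mul_of_nonneg_right hjm' hε.le]
    · rw [box_of_le q hjm]
      refine (mul_le_mul' hyj (hz j (by omega) j le_rfl)).trans ?_
      have hjm' : (m : ℝ) ≤ j := by exact_mod_cast hjm
      rw [eE_mul, eE_mul]
      refine eE_le ?_
      nlinarith [mul_le_mul_of_nonneg_right hkm' (by linarith : 0 ≤ h - h' - hX),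
        mul_le_mul_of_nonneg_right hjm' hh',
        mul_le_mul_of_nonneg_right hjm' (by linarith : 0 ≤ h - h' - hX - 3 * ε)]
  refine h1.trans ?_
  gcongr
  exact le_mul_of_one_le_left' le_add_self

lemma upper_Q (hM : CascadeM1A P X X₀) (hfin : entropyXA P X₀ ≠ ⊤) (hν : Ergodic (shiftA A) ν)
    {h h' : ℝ} (hent : Tendsto (entropySeqA ν) atTop (nhds h))
    (hent' : Tendsto (entropySeqA (ν.map (prQ q))) atTop (nhds h')) {ε : ℝ} (hε : 0 < ε)
    (hδ : 3 * ε ≤ h - h' - (entropyXA P X₀).toReal) {κ : Kernel Ω (SeqSpace A)} [IsFiniteKernel κ]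
    (hk : SubA X ν κ) :
    ∃ C : ℝ≥0∞, C ≠ ⊤ ∧ ∀ᵐ p ∂(P ⊗ₘ κ), ∃ n0 : ℕ, ∀ k ≥ n0, ∀ m ≥ k,
      eE (k * ((entropyXA P X₀).toReal - ε)) ≤ yE X p.2 k p.1 ∧
      eE (-(k * h) - (m - k) * h' - ε * m) ≤ ν (box q k m p.2) ∧
      κ p.1 (box q k m p.2) ≤
        C * eE (-(k * (h - h' - (entropyXA P X₀).toReal)) - m * h' + 4 * ε * m) := by
  set hX := (entropyXA P X₀).toReal with hXdef
  have := tiltI_prob hM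
  have hmp := hν.toMeasurePreserving
  have hh' : 0 ≤ h' := entropy_nonneg hent'
  let Cc : ℝ≥0∞ := ∑' j : ℕ, ((j : ℝ≥0∞) + 1) * eE (-(ε * j))
  have hCt : Cc ≠ ⊤ := sum_eE hε
  have hC0 : Cc ≠ 0 := by
    have h1 : ((0 : ℕ) + 1 : ℝ≥0∞) * eE (-(ε * (0 : ℕ))) ≤ Cc :=
      ENNReal.le_tsum (f := fun j : ℕ => ((j : ℝ≥0∞) + 1) * eE (-(ε * j))) 0
    intro h0
    rw [h0] at h1
    simp [eE] at h1
  refine ⟨Cc, hCt, ?_⟩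
  let lo : ℕ → ℝ≥0∞ := fun k => eE (k * (hX - ε))
  let up : ℕ → ℝ≥0∞ := fun k => eE (k * (hX + ε))
  let lo2 : ℕ → ℕ → ℝ≥0∞ := fun k m => eE (-(k * h) - (m - k) * h' - ε * m)
  let up2 : ℕ → ℕ → ℝ≥0∞ := fun k m => eE (-(k * h) - (m - k) * h' + ε * m)
  let Bd : ℕ → ℕ → ℝ≥0∞ := fun k m => eE (-(k * (h - h' - hX)) - m * h' + 3 * ε * m) * Cc
  let a : ℕ → ℕ → ℝ≥0∞ := fun k m => Cc * eE (-(k * (h - h' - hX)) - m * h' + 4 * ε * m)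
  have hBa : ∀ k m, Bd k m / a k m ≤ eE (-(ε * m)) := by
    intro k m
    refine ENNReal.div_le_of_le_mul (le_of_eq ?_)
    simp only [a, Bd]
    rw [mul_left_comm, eE_mul, mul_comm]
    congr 2; ring
  let C : ℕ → Set (SeqSpace A) := fun n0 => {z | ∀ k ≥ n0, ∀ m ≥ k, lo2 k m ≤ ν (box q k m z) ∧
    ν (box q k m z) ≤ up2 k m}
  have hCm : ∀ n0, MeasurableSet (C n0) := by
    intro n0
    have : C n0 = ⋂ k : ℕ, ⋂ (_ : n0 ≤ k), ⋂ m : ℕ, ⋂ (_ : k ≤ m), {z | lo2 k m ≤ ν (box q k m z) ∧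
      ν (box q k m z) ≤ up2 k m} := by
      ext z; simp [C, mem_ofPred_eq]
    rw [this]
    refine MeasurableSet.iInter fun k => MeasurableSet.iInter fun _ => MeasurableSet.iInter fun m =>
      MeasurableSet.iInter fun _ => ?_
    exact (measurableSet_le measurable_const (meas_nubox q ν k m)).inter
      (measurableSet_le (meas_nubox q ν k m) measurable_const)
  have hCt0 : Tendsto (fun n => ν (C n)ᶜ) atTop (nhds 0) := by
    refine tail_small ν hCm (fun n n' hn z hz => ?_) ?_
    · simp only [C, mem_ofPred_eq] at hz ⊢
      exact fun k hk => hz k (hn.trans hk)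
    · filter_upwards [box_upper q hν hent hent' hε, box_lower q hν hent hent' hε] with z h1 h2
      obtain ⟨n1, h1⟩ := h1
      obtain ⟨n2, h2⟩ := h2
      refine ⟨max n1 n2, ?_⟩
      simp only [C, mem_ofPred_eq]
      exact fun k hk m hm => ⟨h2 k (le_of_max_le_right hk) m hm, h1 k (le_of_max_le_left hk) m hm⟩
  let D : ℕ → Set (ℕ → ℝ) := fun n0 => {t | ∀ k ≥ n0, lo k ≤ yT k t ∧ yT k t ≤ up k}
  have hDm : ∀ n0, MeasurableSet (D n0) := by
    intro n0
    have : D n0 = ⋂ k : ℕ, ⋂ (_ : n0 ≤ k), {t | lo k ≤ yT k t ∧ yT k t ≤ up k} := by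
      ext z; simp [D, mem_ofPred_eq]
    rw [this]
    refine MeasurableSet.iInter fun k => MeasurableSet.iInter fun _ => ?_
    exact (measurableSet_le measurable_const (measurable_yT k)).inter
      (measurableSet_le (measurable_yT k) measurable_const)
  have hDt0 : Tendsto (fun n => tiltI P X₀ (D n)ᶜ) atTop (nhds 0) := by
    refine tail_small _ hDm (fun n n' hn z hz => ?_) ?_
    · simp only [D, mem_ofPred_eq] at hz ⊢
      exact fun k hk => hz k (hn.trans hk)
    · filter_upwards [slln hM hfin hε] with t ht
      obtain ⟨n, hn⟩ := eventually_atTop.1 ht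
      exact ⟨n, hn⟩
  have hSt0 := ENNReal.tendsto_sum_nat_add (fun m : ℕ => ((m : ℝ≥0∞) + 1) * eE (-(ε * m))) (sum_eE hε)
  have hlim := (hCt0.add hDt0).add hSt0
  simp only [add_zero] at hlim
  let Fκ : ℕ → ℕ → Ω → SeqSpace A → ℝ≥0∞ := fun k m ω z => κ ω (box q k m z)
  have hbd : ∀ n0, (P ⊗ₘ κ) (⋃ M, BadS q X ν lo lo2 a n0 M Fκ) ≤ ν (C n0)ᶜ + tiltI P X₀ (D n0)ᶜ +
      ∑' j : ℕ, (((j + n0 : ℕ) : ℝ≥0∞) + 1) * eE (-(ε * (j + n0 : ℕ))) := by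
    intro n0
    have hmono : Monotone (fun M => BadS q X ν lo lo2 a n0 M Fκ) := by
      rintro M M' hMM p ⟨m, k, h1, h2⟩
      exact ⟨m, k, h1.trans hMM, h2⟩
    rw [hmono.measure_iUnion]
    refine iSup_le fun M => ?_
    rw [Measure.compProd_apply (measurableSet_BadS q hM lo lo2 a n0 M (fun k m => meas_kbox q κ k m))]
    refine (bad_bound q hM hk lo up lo2 a Bd n0 M (hCm n0) (fun z hz k hk m hm => (hz k hk m hm).1)
      (fun N z ω hz hy k m h1 h2 => T_bound q hε hδ hh' (fun k hk m hm => (hz k hk m hm).2) hy h1 h2)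
      (fun k m => mul_ne_zero hC0 (eE_ne_zero _)) (fun k m => ENNReal.mul_ne_top hCt (eE_ne_top _))
      (fun k m => mul_ne_zero (eE_ne_zero _) hC0)
      (fun k m => ENNReal.mul_ne_top (eE_ne_top _) hCt)).trans ?_
    refine add_le_add (add_le_add le_rfl le_rfl) ?_
    calc _ ≤ ∑ m ∈ Finset.Icc n0 M, ((m : ℝ≥0∞) + 1) * eE (-(ε * m)) := by
          refine Finset.sum_le_sum fun m hm => ?_
          refine (Finset.sum_le_card_nsmul _ _ _ fun k _ => hBa k m).trans ?_
          rw [nsmul_eq_mul]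
          gcongr
          rw [Nat.card_Icc]
          exact_mod_cast (by omega : m + 1 - n0 ≤ m + 1)
      _ = ∑ m ∈ Finset.Ico n0 (M + 1), ((m : ℝ≥0∞) + 1) * eE (-(ε * m)) := by
          congr 1
      _ ≤ _ := by
          rw [Finset.sum_Ico_eq_sum_range]
          simp only [add_comm n0]
          exact ENNReal.sum_le_tsum _
  rw [ae_iff]
  rw [← nonpos_iff_eq_zero]
  refine ge_of_tendsto' hlim fun n0 => ?_
  refine le_trans (measure_mono ?_) (hbd n0)
  intro p hp
  simp only [mem_ofPred_eq] at hp
  push Not at hp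
  obtain ⟨k, hk1, m, hm1, hb⟩ := hp n0
  refine mem_iUnion.2 ⟨m, m, k, le_rfl, hm1, hk1, ?_⟩
  by_contra hcon
  push Not at hcon
  exact absurd (hb hcon.1 hcon.2.1) (not_lt.2 hcon.2.2)

end
end

noncomputable section

section
variable {A B : Type*} {Ω : Type*} [MeasurableSpace Ω] [MeasurableSpace A] [Fintype A]
  [MeasurableSingletonClass A] [MeasurableSpace B] [Fintype B] [MeasurableSingletonClass B]
  {P : Measure Ω} [IsProbabilityMeasure P] {X : List A → Ω → ℝ}
  {X₀ : Ω → ℝ} {ν : Measure (SeqSpace A)} [IsProbabilityMeasure ν] (q : A → B)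

lemma lint_Z (hM : CascadeM1A P X X₀) (k : ℕ) : ∫⁻ ω, ∫⁻ z, yE X z k ω ∂ν ∂P = 1 := by
  rw [lintegral_lintegral_swap (meas_yE_joint hM k).aemeasurable]
  simp [lint_yE hM]

lemma lower_Q (hM : CascadeM1A P X X₀) {ε : ℝ} (hε : 0 < ε) {κ : Kernel Ω (SeqSpace A)}
    [IsFiniteKernel κ] :
    ∀ᵐ p ∂(P ⊗ₘ κ), ∃ n0 : ℕ, ∀ m ≥ n0, ∀ k ≤ m,
      yE X p.2 k p.1 * ν (box q k m p.2) * (κ p.1 (box q k m p.2))⁻¹ ≤ eE (ε * m) := by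
  have hm : ∀ k m, Measurable (fun p : Ω × SeqSpace A =>
      yE X p.2 k p.1 * ν (box q k m p.2) * (κ p.1 (box q k m p.2))⁻¹) := fun k m =>
    ((meas_yE_joint hM k).mul ((meas_nubox q ν k m).comp measurable_snd)).mul (meas_kbox q κ k m).inv
  refine bc_pairs (P ⊗ₘ κ) (fun k m p => yE X p.2 k p.1 * ν (box q k m p.2) *
    (κ p.1 (box q k m p.2))⁻¹) hm 1 ENNReal.one_ne_top (fun k m hkm => ?_) hε
  rw [Measure.lintegral_compProd (hm k m), ← lint_Z (ν := ν) hM k]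
  refine lintegral_mono fun ω => ?_
  have hr := measurable_rBox q k m
  have e1 := low_fibers (κ ω) hr (fun i => yW X k ω i.1 * ν (rBox q k m ⁻¹' {i}))
  have e2 := fin_part ν hr (fun i => yW X k ω i.1) (G := fun _ => 1) measurable_const
  simp only [mul_one, lintegral_const, Measure.restrict_apply MeasurableSet.univ, univ_inter,
        one_mul] at e2
  rw [← e2] at e1
  simp only [← box_eq] at e1
  exact e1

/-- two-sided estimates of the box masses -/
lemma box_Q (hM : CascadeM1A P X X₀) (hfin : entropyXA P X₀ ≠ ⊤) (hν : Ergodic (shiftA A) ν)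
    {h h' : ℝ} (hent : Tendsto (entropySeqA ν) atTop (nhds h))
    (hent' : Tendsto (entropySeqA (ν.map (prQ q))) atTop (nhds h')) {ε : ℝ} (hε : 0 < ε)
    (hδ : 3 * ε ≤ h - h' - (entropyXA P X₀).toReal) {κ : Kernel Ω (SeqSpace A)} [IsFiniteKernel κ]
    (hk : SubA X ν κ) :
    ∀ᵐ p ∂(P ⊗ₘ κ), ∃ n0 : ℕ, ∀ k ≥ n0, ∀ m ≥ k,
      eE (-(k * (h - h' - (entropyXA P X₀).toReal)) - m * h' - 5 * ε * m) ≤ κ p.1 (box q k m p.2) ∧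
      κ p.1 (box q k m p.2) ≤
        eE (-(k * (h - h' - (entropyXA P X₀).toReal)) - m * h' + 5 * ε * m) := by
  set hX := (entropyXA P X₀).toReal with hXdef
  obtain ⟨C, hC, hup⟩ := upper_Q q hM hfin hν hent hent' hε hδ hk
  filter_upwards [hup, lower_Q (X := X) (ν := ν) q hM hε (κ := κ)] with p h1 h2
  obtain ⟨n1, h1⟩ := h1
  obtain ⟨n2, h2⟩ := h2
  obtain ⟨n3, h3⟩ : ∃ n3 : ℕ, ∀ m ≥ n3, C ≤ eE (ε * m) := by
    have ht : Tendsto (fun m : ℕ => Real.exp (ε * m)) atTop atTop :=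
      Real.tendsto_exp_atTop.comp (Tendsto.const_mul_atTop hε tendsto_natCast_atTop_atTop)
    obtain ⟨n3, h3⟩ := eventually_atTop.1 (ht.eventually_ge_atTop C.toReal)
    refine ⟨n3, fun m hm => ?_⟩
    rw [← ENNReal.ofReal_toReal hC]
    exact ENNReal.ofReal_le_ofReal (h3 m hm)
  refine ⟨max n1 (max n2 n3), fun k hk m hm => ?_⟩
  simp only [ge_iff_le, max_le_iff] at hk
  obtain ⟨a1, a2, a3⟩ := h1 k hk.1 m hm
  have a4 := h2 m (by omega) k hm
  have hkm : (k : ℝ) ≤ m := by exact_mod_cast hm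
  constructor
  · have hb0 : κ p.1 (box q k m p.2) ≠ 0 := by
      intro h0
      rw [h0, ENNReal.inv_zero, ENNReal.mul_top] at a4
      · exact eE_ne_top _ (top_le_iff.1 a4)
      · exact mul_ne_zero (ne_of_gt (lt_of_lt_of_le (pos_iff_ne_zero.2 (eE_ne_zero _)) a1))
          (ne_of_gt (lt_of_lt_of_le (pos_iff_ne_zero.2 (eE_ne_zero _)) a2))
    have a5 : eE (k * (hX - ε)) * eE (-(k * h) - (m - k) * h' - ε * m) ≤
        eE (ε * m) * κ p.1 (box q k m p.2) := by
      refine (mul_le_mul' a1 a2).trans ?_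
      rw [← ENNReal.div_le_iff_le_mul (Or.inl hb0) (Or.inl (measure_ne_top _ _)), div_eq_mul_inv]
      exact a4
    calc _ ≤ eE (-(ε * m)) * (eE (k * (hX - ε)) * eE (-(k * h) - (m - k) * h' - ε * m)) := by
          rw [eE_mul, eE_mul]
          refine eE_le ?_
          nlinarith [mul_le_mul_of_nonneg_left hkm hε.le, mul_nonneg hε.le (Nat.cast_nonneg (α := ℝ) m)]
      _ ≤ eE (-(ε * m)) * (eE (ε * m) * κ p.1 (box q k m p.2)) := by gcongr
      _ = _ := by
          rw [← mul_assoc, eE_mul]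
          simp [eE]
  · refine a3.trans ?_
    refine (mul_le_mul_left (h3 m (by omega)) _).trans ?_
    rw [eE_mul]
    refine eE_le ?_
    linarith

end
end

noncomputable section

section
variable {A B : Type*} {Ω : Type*} [MeasurableSpace Ω] [MeasurableSpace A] [Fintype A]
  [MeasurableSingletonClass A] [MeasurableSpace B] [Fintype B] [MeasurableSingletonClass B]
  {P : Measure Ω} [IsProbabilityMeasure P] {X : List A → Ω → ℝ}
  {X₀ : Ω → ℝ} {ν : Measure (SeqSpace A)} [IsProbabilityMeasure ν] (q : A → B)

lemma cyl_as_pre {s : Set (SeqSpace A)} (hs : s ∈ measurableCylinders (fun _ : ℕ => A)) :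
    ∃ (M : ℕ) (I : Set (Fin M → A)), s = preA M ⁻¹' I := by
  rw [mem_measurableCylinders] at hs
  obtain ⟨t, S, -, rfl⟩ := hs
  refine ⟨t.sup id + 1, preA (t.sup id + 1) '' cylinder t S, ?_⟩
  ext w
  constructor
  · exact fun h => ⟨w, h, rfl⟩
  · rintro ⟨w', h1, h2⟩
    rw [mem_cylinder] at h1 ⊢
    convert h1 using 1
    funext i
    have hi : i.1 ≤ t.sup id := Finset.le_sup (f := id) i.2
    exact (congrFun h2 ⟨i.1, by omega⟩).symm

lemma final_Q (hM : CascadeM1A P X X₀) (hfin : entropyXA P X₀ ≠ ⊤) (hν : Ergodic (shiftA A) ν)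
    {h h' : ℝ} (hent : Tendsto (entropySeqA ν) atTop (nhds h))
    (hent' : Tendsto (entropySeqA (ν.map (prQ q))) atTop (nhds h')) {ε : ℝ} (hε : 0 < ε)
    (hδ : 3 * ε ≤ h - h' - (entropyXA P X₀).toReal) {Q : Ω → Measure (SeqSpace A)}
    (hQ : ∀ᵐ ω ∂P, ConvA X ν ω (Q ω)) :
    ∀ᵐ ω ∂P, ∀ᵐ z ∂(Q ω), ∃ n0 : ℕ, ∀ k ≥ n0, ∀ m ≥ k,
      eE (-(k * (h - h' - (entropyXA P X₀).toReal)) - m * h' - 5 * ε * m) ≤ Q ω (box q k m z) ∧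
      Q ω (box q k m z) ≤
        eE (-(k * (h - h' - (entropyXA P X₀).toReal)) - m * h' + 5 * ε * m) := by
  classical
  let S0 := (toMeasurable P {ω | ¬ ConvA X ν ω (Q ω)})ᶜ
  have hS0m : MeasurableSet S0 := (measurableSet_toMeasurable _ _).compl
  have hS0 : ∀ ω ∈ S0, ConvA X ν ω (Q ω) := by
    intro ω hω
    by_contra hc
    exact hω (subset_toMeasurable _ _ hc)
  have hS0ae : ∀ᵐ ω ∂P, ω ∈ S0 := by
    rw [ae_iff] at hQ ⊢
    have : {ω | ω ∉ S0} = toMeasurable P {ω | ¬ ConvA X ν ω (Q ω)} := by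
      ext; simp [S0, mem_ofPred_eq]
    rw [this, measure_toMeasurable, hQ]
  let Zl : Ω → ℝ≥0∞ := fun ω => liminf (fun n => ∫⁻ z, yE X z n ω ∂ν) atTop
  have hZm : Measurable Zl := Measurable.liminf fun n => meas_int hM ν n
  have hZfin : ∀ᵐ ω ∂P, Zl ω < ⊤ := by
    refine ae_lt_top hZm (ne_top_of_le_ne_top ENNReal.one_ne_top ?_)
    refine (lintegral_liminf_le fun n => meas_int hM ν n).trans ?_
    simp [lint_Z hM]
  have hQZ : ∀ ω ∈ S0, Q ω univ = Zl ω := by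
    intro ω hω
    have := conv_fin (hS0 ω hω) 0 univ
    simp only [preimage_univ, Measure.restrict_univ] at this
    exact this.liminf_eq.symm
  have main : ∀ L : ℕ, ∀ᵐ ω ∂P, (ω ∈ S0 ∧ Zl ω ≤ L) → ∀ᵐ z ∂(Q ω), ∃ n0 : ℕ, ∀ k ≥ n0, ∀ m ≥ k,
      eE (-(k * (h - h' - (entropyXA P X₀).toReal)) - m * h' - 5 * ε * m) ≤ Q ω (box q k m z) ∧
      Q ω (box q k m z) ≤
        eE (-(k * (h - h' - (entropyXA P X₀).toReal)) - m * h' + 5 * ε * m) := by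
    intro L
    let G : Set Ω := {ω | ω ∈ S0 ∧ Zl ω ≤ L}
    have hG : MeasurableSet G := hS0m.inter (measurableSet_le hZm measurable_const)
    let K : Ω → Measure (SeqSpace A) := fun ω => if ω ∈ G then Q ω else 0
    have hKle : ∀ ω, K ω univ ≤ L := by
      intro ω
      by_cases hω : ω ∈ G
      · simp only [K, hω, if_true]
        rw [hQZ ω hω.1]; exact hω.2
      · simp [K, hω]
    haveI : ∀ ω, IsFiniteMeasure (K ω) := fun ω =>
      ⟨lt_of_le_of_lt (hKle ω) (ENNReal.natCast_lt_top L)⟩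
    have hKpre : ∀ (M : ℕ) (I : Set (Fin M → A)) ω, K ω (preA M ⁻¹' I) =
        if ω ∈ G then liminf (fun n => ∫⁻ z in preA M ⁻¹' I, yE X z n ω ∂ν) atTop else 0 := by
      intro M I ω
      by_cases hω : ω ∈ G
      · simp only [K, hω, if_true]
        exact (conv_fin (hS0 ω hω.1) M I).liminf_eq.symm
      · simp [K, hω]
    have hKpm : ∀ (M : ℕ) (I : Set (Fin M → A)), Measurable (fun ω => K ω (preA M ⁻¹' I)) := by
      intro M I
      simp only [hKpre]
      exact Measurable.ite hG (Measurable.liminf fun n => meas_int hM _ n) measurable_const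
    have hKm : Measurable K := by
      refine Measurable.measure_of_isPiSystem generateFrom_measurableCylinders.symm
        isPiSystem_measurableCylinders (fun s hs => ?_) ?_
      · obtain ⟨M, I, rfl⟩ := cyl_as_pre hs
        exact hKpm M I
      · exact hKpm 0 univ
    let κ : Kernel Ω (SeqSpace A) := ⟨K, hKm⟩
    haveI : IsFiniteKernel κ := ⟨L, ENNReal.natCast_lt_top L, hKle⟩
    have hsub : SubA X ν κ := by
      intro ω M I
      change K ω (preA M ⁻¹' I) ≤ _
      rw [hKpre]
      by_cases hω : ω ∈ G
      · simp [hω]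
      · simp [hω]
    have hb := Measure.ae_ae_of_ae_compProd (box_Q q hM hfin hν hent hent' hε hδ hsub)
    filter_upwards [hb] with ω h1 h2
    have e : κ ω = Q ω := by
      change K ω = Q ω
      have : ω ∈ G := h2
      simp only [K, this, if_true]
    simp only [e] at h1
    exact h1
  filter_upwards [ae_all_iff.2 main, hS0ae, hZfin] with ω h1 h2 h3
  obtain ⟨L, hL⟩ := ENNReal.exists_nat_gt h3.ne
  exact h1 L ⟨h2, hL.le⟩

end
end

noncomputable section

section

/-- the scale attached to a radius -/
def scl (b : ℕ) (ρ : ℝ) : ℕ := ⌊(-Real.log ρ) / Real.log b⌋₊ + 1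

lemma inv_pow_eE {b : ℕ} (hb : 1 ≤ b) (i : ℕ) : ((b : ℝ≥0∞))⁻¹ ^ i = eE (-(i * Real.log b)) := by
  have hb' : (0 : ℝ) < b := by exact_mod_cast hb
  rw [← eE_inv, ← ENNReal.inv_pow]
  congr 1
  rw [eE, Real.exp_nat_mul, Real.exp_log hb', ENNReal.ofReal_pow hb'.le, ENNReal.ofReal_natCast]

lemma eE_lt {x y : ℝ} (h : x < y) : eE x < eE y :=
  (ENNReal.ofReal_lt_ofReal_iff (Real.exp_pos _)).2 (Real.exp_lt_exp.2 h)

lemma ofReal_eE {ρ : ℝ} (hρ : 0 < ρ) : ENNReal.ofReal ρ = eE (Real.log ρ) := by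
  rw [eE, Real.exp_log hρ]

lemma scl_lt {b : ℕ} (hb : 2 ≤ b) {ρ : ℝ} (hρ : 0 < ρ) {i : ℕ} (hi : scl b ρ ≤ i) :
    ((b : ℝ≥0∞))⁻¹ ^ i ≤ ((b : ℝ≥0∞))⁻¹ ^ (scl b ρ) ∧ ((b : ℝ≥0∞))⁻¹ ^ (scl b ρ) < ENNReal.ofReal ρ := by
  have hl : 0 < Real.log b := Real.log_pos (by exact_mod_cast hb)
  rw [inv_pow_eE (by omega), inv_pow_eE (by omega), ofReal_eE hρ]
  constructor
  · refine eE_le ?_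
    have : (scl b ρ : ℝ) ≤ i := by exact_mod_cast hi
    nlinarith
  · refine eE_lt ?_
    have h1 : (-Real.log ρ) / Real.log b < scl b ρ := by
      rw [scl]; push_cast; exact Nat.lt_floor_add_one _
    rw [div_lt_iff₀ hl] at h1
    linarith

lemma scl_ge {b : ℕ} (hb : 2 ≤ b) {ρ : ℝ} (hρ : 0 < ρ) (hρ1 : ρ < 1) {i : ℕ} (hi : i < scl b ρ) :
    ENNReal.ofReal ρ ≤ ((b : ℝ≥0∞))⁻¹ ^ i := by
  have hl : 0 < Real.log b := Real.log_pos (by exact_mod_cast hb)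
  rw [inv_pow_eE (by omega), ofReal_eE hρ]
  refine eE_le ?_
  have h0 : 0 ≤ (-Real.log ρ) / Real.log b :=
    div_nonneg (by have := Real.log_neg hρ hρ1; linarith) hl.le
  have h1 : (i : ℝ) ≤ (-Real.log ρ) / Real.log b := by
    rw [scl] at hi
    exact (Nat.le_floor_iff h0).1 (by omega)
  rw [le_div_iff₀ hl] at h1
  linarith

lemma scl_mono {b b' : ℕ} (hb : 2 ≤ b) (hbb : b ≤ b') {ρ : ℝ} (hρ : 0 < ρ) (hρ1 : ρ < 1) :
    scl b' ρ ≤ scl b ρ := by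
  have hl : 0 < Real.log b := Real.log_pos (by exact_mod_cast hb)
  have h0 : 0 ≤ -Real.log ρ := by have := Real.log_neg hρ hρ1; linarith
  rw [scl, scl]
  gcongr

lemma ball_box {b₁ b₂ : ℕ} (hb₂ : 2 ≤ b₂) (hb : b₂ < b₁) (z : SeqSpace (Fin b₁ × Fin b₂)) {ρ : ℝ}
    (hρ : 0 < ρ) (hρ1 : ρ < 1) :
    ballBM b₁ b₂ z ρ = box Prod.snd (scl b₁ ρ) (scl b₂ ρ) z := by
  ext z'
  simp only [ballBM, box, mem_ofPred_eq]
  have hmn := scl_mono hb₂ hb.le hρ hρ1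
  constructor
  · intro hd
    have hn : ∀ n, max (if (z n).1 ≠ (z' n).1 then ((b₁ : ℝ≥0∞))⁻¹ ^ n else 0)
        (if (z n).2 ≠ (z' n).2 then ((b₂ : ℝ≥0∞))⁻¹ ^ n else 0) < ENNReal.ofReal ρ := fun n =>
      lt_of_le_of_lt (le_iSup (fun n => max (if (z n).1 ≠ (z' n).1 then ((b₁ : ℝ≥0∞))⁻¹ ^ n else 0)
        (if (z n).2 ≠ (z' n).2 then ((b₂ : ℝ≥0∞))⁻¹ ^ n else 0)) n) hd
    have h1 : ∀ i < scl b₁ ρ, (z' i).1 = (z i).1 := by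
      intro i hi
      by_contra hne
      have := (le_max_left _ _).trans_lt (hn i)
      rw [if_pos (fun h => hne h.symm)] at this
      exact absurd this (not_lt.2 (scl_ge (by omega) hρ hρ1 hi))
    have h2 : ∀ i < scl b₂ ρ, (z' i).2 = (z i).2 := by
      intro i hi
      by_contra hne
      have := (le_max_right _ _).trans_lt (hn i)
      rw [if_pos (fun h => hne h.symm)] at this
      exact absurd this (not_lt.2 (scl_ge (by omega) hρ hρ1 hi))
    exact ⟨fun i hi => Prod.ext (h1 i hi) (h2 i (by omega)), h2⟩
  · rintro ⟨h1, h2⟩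
    refine lt_of_le_of_lt (iSup_le (a := max (((b₁ : ℝ≥0∞))⁻¹ ^ (scl b₁ ρ))
      (((b₂ : ℝ≥0∞))⁻¹ ^ (scl b₂ ρ))) fun i => max_le_max ?_ ?_)
      (max_lt (scl_lt (by omega) hρ le_rfl).2 (scl_lt (by omega) hρ le_rfl).2)
    · by_cases hi : i < scl b₁ ρ
      · simp [h1 i hi]
      · split_ifs
        · exact (scl_lt (by omega) hρ (not_lt.1 hi)).1
        · exact zero_le
    · by_cases hi : i < scl b₂ ρ
      · simp [h2 i hi]
      · split_ifs
        · exact (scl_lt (by omega) hρ (not_lt.1 hi)).1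
        · exact zero_le

lemma tendsto_neglog : Tendsto (fun ρ : ℝ => -Real.log ρ) (nhdsWithin 0 (Ioi 0)) atTop :=
  tendsto_neg_atBot_atTop.comp Real.tendsto_log_nhdsGT_zero

lemma scl_ratio {b : ℕ} (hb : 2 ≤ b) :
    Tendsto (fun ρ : ℝ => (scl b ρ : ℝ) / (-Real.log ρ)) (nhdsWithin 0 (Ioi 0))
      (nhds (1 / Real.log b)) := by
  have hl : 0 < Real.log b := Real.log_pos (by exact_mod_cast hb)
  have h1 : Tendsto (fun t : ℝ => ((⌊t / Real.log b⌋₊ + 1 : ℕ) : ℝ) / t) atTop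
      (nhds (1 / Real.log b)) := by
    have h2 : Tendsto (fun t : ℝ => (1 / Real.log b) + 1 / t) atTop (nhds (1 / Real.log b)) := by
      have := (tendsto_const_nhds (x := 1 / Real.log b)).add (tendsto_inv_atTop_zero (𝕜 := ℝ))
      simpa using this
    refine tendsto_of_tendsto_of_tendsto_of_le_of_le' tendsto_const_nhds h2 ?_ ?_
    · filter_upwards [eventually_gt_atTop 0] with t ht
      rw [le_div_iff₀ ht]
      have := (Nat.lt_floor_add_one (t / Real.log b)).le
      push_cast
      calc 1 / Real.log b * t = t / Real.log b := by ring
        _ ≤ _ := this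
    · filter_upwards [eventually_gt_atTop 0] with t ht
      rw [div_le_iff₀ ht]
      have := Nat.floor_le (show 0 ≤ t / Real.log b by positivity)
      push_cast
      calc _ ≤ t / Real.log b + 1 := by linarith
        _ = _ := by field_simp
  exact h1.comp tendsto_neglog

lemma dim_limit {b₁ b₂ : ℕ} (hb₂ : 2 ≤ b₂) (hb : b₂ < b₁) {η : Measure (SeqSpace (Fin b₁ × Fin b₂))}
    {z : SeqSpace (Fin b₁ × Fin b₂)} {δ h' : ℝ} {e : ℕ → ℝ} (he0 : ∀ j, 0 ≤ e j)
    (he : Tendsto e atTop (nhds 0))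
    (hz : ∀ j, ∃ n0 : ℕ, ∀ k ≥ n0, ∀ m ≥ k,
      eE (-(k * δ) - m * h' - 5 * e j * m) ≤ η (box Prod.snd k m z) ∧
      η (box Prod.snd k m z) ≤ eE (-(k * δ) - m * h' + 5 * e j * m)) :
    Tendsto (fun ρ : ℝ => Real.log ((η (ballBM b₁ b₂ z ρ)).toReal) / Real.log ρ)
      (nhdsWithin 0 (Set.Ioi 0)) (nhds (δ / Real.log b₁ + h' / Real.log b₂)) := by
  have r1 := scl_ratio (b := b₁) (by omega)
  have r2 := scl_ratio (b := b₂) hb₂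
  let g : ℝ → ℝ := fun ρ => (scl b₁ ρ : ℝ) / (-Real.log ρ) * δ + (scl b₂ ρ : ℝ) / (-Real.log ρ) * h'
  have hg : Tendsto g (nhdsWithin 0 (Ioi 0)) (nhds (δ / Real.log b₁ + h' / Real.log b₂)) := by
    have := (r1.mul_const δ).add (r2.mul_const h')
    convert this using 2
    ring
  let f : ℝ → ℝ := fun ρ => Real.log ((η (ballBM b₁ b₂ z ρ)).toReal) / Real.log ρ
  have hdiff : Tendsto (fun ρ => f ρ - g ρ) (nhdsWithin 0 (Ioi 0)) (nhds 0) := by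
    let Kc : ℝ := 1 / Real.log b₂ + 1
    have hl2 : 0 < Real.log b₂ := Real.log_pos (by exact_mod_cast hb₂)
    have hKc : 0 < Kc := by positivity
    have hK : ∀ᶠ ρ in nhdsWithin (0:ℝ) (Ioi 0), (scl b₂ ρ : ℝ) / (-Real.log ρ) ≤ Kc :=
      r2.eventually_le_const (by simp only [Kc]; linarith)
    rw [Metric.tendsto_nhds]
    intro θ hθ
    have he' : Tendsto (fun j => 5 * e j * Kc) atTop (nhds 0) := by
      have := (he.const_mul 5).mul_const Kc
      simpa using this
    obtain ⟨j, hj⟩ := (he'.eventually (gt_mem_nhds hθ)).exists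
    obtain ⟨n0, hn0⟩ := hz j
    have hbig : ∀ᶠ ρ in nhdsWithin (0:ℝ) (Ioi 0), n0 ≤ scl b₁ ρ := by
      have hl1 : 0 < Real.log b₁ := Real.log_pos (by exact_mod_cast (by omega : 1 < b₁))
      filter_upwards [tendsto_neglog.eventually_ge_atTop (n0 * Real.log b₁)] with ρ hρ
      rw [scl]
      have : n0 ≤ ⌊-Real.log ρ / Real.log b₁⌋₊ := Nat.le_floor (by rwa [le_div_iff₀ hl1])
      omega
    have hsmall : ∀ᶠ ρ in nhdsWithin (0:ℝ) (Ioi 0), 0 < ρ ∧ ρ < 1 := by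
      filter_upwards [Ioo_mem_nhdsGT (zero_lt_one (α := ℝ))] with ρ hρ
      exact hρ
    filter_upwards [hK, hbig, hsmall] with ρ hρK hρb hρ
    rw [Real.dist_eq, sub_zero]
    refine lt_of_le_of_lt ?_ hj
    have hmn := scl_mono hb₂ hb.le hρ.1 hρ.2
    obtain ⟨a1, a2⟩ := hn0 _ hρb _ hmn
    have hlog : 0 < -Real.log ρ := by have := Real.log_neg hρ.1 hρ.2; linarith
    simp only [f, g, ball_box hb₂ hb z hρ.1 hρ.2]
    have hfin : η (box Prod.snd (scl b₁ ρ) (scl b₂ ρ) z) ≠ ⊤ := ne_top_of_le_ne_top (eE_ne_top _) a2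
    have b1 : Real.exp (-((scl b₁ ρ) * δ) - (scl b₂ ρ) * h' - 5 * e j * (scl b₂ ρ)) ≤
        (η (box Prod.snd (scl b₁ ρ) (scl b₂ ρ) z)).toReal :=
      (ENNReal.ofReal_le_iff_le_toReal hfin).1 a1
    have b2 : (η (box Prod.snd (scl b₁ ρ) (scl b₂ ρ) z)).toReal ≤
        Real.exp (-((scl b₁ ρ) * δ) - (scl b₂ ρ) * h' + 5 * e j * (scl b₂ ρ)) :=
      ENNReal.toReal_le_of_le_ofReal (Real.exp_pos _).le a2
    have hpos := (Real.exp_pos _).trans_le b1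
    have c1 := (Real.le_log_iff_exp_le hpos).2 b1
    have c2 := (Real.log_le_iff_le_exp hpos).2 b2
    set n : ℝ := (scl b₁ ρ : ℝ)
    set m : ℝ := (scl b₂ ρ : ℝ)
    set l := Real.log (η (box Prod.snd (scl b₁ ρ) (scl b₂ ρ) z)).toReal
    have e1 : l / Real.log ρ - (n / (-Real.log ρ) * δ + m / (-Real.log ρ) * h') =
        (-l - n * δ - m * h') / (-Real.log ρ) := by
      have : Real.log ρ ≠ 0 := by linarith
      field_simp
      ring
    rw [e1, abs_div, abs_of_pos hlog]
    have e2 : |-l - n * δ - m * h'| ≤ 5 * e j * m := by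
      rw [abs_le]; constructor <;> linarith
    calc _ ≤ 5 * e j * m / (-Real.log ρ) := by gcongr
      _ = 5 * e j * (m / (-Real.log ρ)) := by ring
      _ ≤ _ := by
        have := he0 j
        gcongr
  have := hdiff.add hg
  simpa [f] using this

end
end

/-- **Theorem (cascades on Bedford–McMullen-type symbolic products).**
Fix `b₁ > b₂ ≥ 2`, a set `Λ ⊆ Λ₁ × Λ₂` with at least two elements, a shift-ergodic
probability measure `ν` supported on `Λ^{ℤ₊}` with entropy `h_ν(σ)`, whose projection
`π₂*ν` has entropy `h_{π₂*ν}(σ₂)`, and a Mandelbrot multiplicative cascade (M1) with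
`h_X < h_ν(σ) − h_{π₂*ν}(σ₂)`. Then `ν` is `Q`-regular and, with probability 1,
conditional on `Q·ν ≠ 0`, the projection `π₂*(Q·ν)` is absolutely continuous with respect
to `π₂*ν` and `Q·ν` is exact-dimensional with respect to the metric `d_{(b₁,b₂)}` with
dimension `(h_ν(σ) − h_X)/log b₁ + (1/log b₂ − 1/log b₁) h_{π₂*ν}(σ₂)`. -/
theorem cascade_on_bedford_mcmullen_symbolic
    {b₁ b₂ : ℕ} (hb₂ : 2 ≤ b₂) (hb : b₂ < b₁)
    {Ω : Type*} [MeasurableSpace Ω] (P : Measure Ω) [IsProbabilityMeasure P]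
    (X : List (Fin b₁ × Fin b₂) → Ω → ℝ) (X₀ : Ω → ℝ)
    (hM1 : CascadeM1A P X X₀)
    (Λs : Finset (Fin b₁ × Fin b₂)) (hΛs : 2 ≤ Λs.card)
    (ν : Measure (SeqSpace (Fin b₁ × Fin b₂))) [IsProbabilityMeasure ν]
    (hνsupp : ν {x | ∀ n, x n ∈ Λs} = 1)
    (hνerg : Ergodic (shiftA (Fin b₁ × Fin b₂)) ν)
    (hν hπν : ℝ)
    (hent : Tendsto (entropySeqA ν) atTop (nhds hν))
    (hent₂ : Tendsto (entropySeqA (ν.map projSnd)) atTop (nhds hπν))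
    (Qν : Ω → Measure (SeqSpace (Fin b₁ × Fin b₂)))
    (hQν : ∀ᵐ ω ∂P, ∀ w : List (Fin b₁ × Fin b₂),
      Tendsto
        (fun n => ∫⁻ x in cylinderA w, ENNReal.ofReal (cascadeYA X (wordPrefixA x n) ω) ∂ν)
        atTop (nhds (Qν ω (cylinderA w))))
    (hhX : entropyXA P X₀ < ENNReal.ofReal (hν - hπν)) :
    UniformIntegrable (fun n ω => cascadeZA X ν n ω) 1 P ∧
    (∀ᵐ ω ∂P, Qν ω ≠ 0 →
      (Qν ω).map projSnd ≪ ν.map projSnd ∧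
      ∀ᵐ z ∂(Qν ω),
        Tendsto
          (fun ρ : ℝ => Real.log ((Qν ω (ballBM b₁ b₂ z ρ)).toReal) / Real.log ρ)
          (nhdsWithin 0 (Set.Ioi 0))
          (nhds ((hν - (entropyXA P X₀).toReal) / Real.log b₁ +
            (1 / Real.log b₂ - 1 / Real.log b₁) * hπν))) := by
  have hfin : entropyXA P X₀ ≠ ⊤ := (hhX.trans ENNReal.ofReal_lt_top).ne
  have hδ : (entropyXA P X₀).toReal < hν - hπν := (ENNReal.lt_ofReal_iff_toReal_lt hfin).1 hhX
  have hent' : Tendsto (entropySeqA (ν.map (prQ (Prod.snd : Fin b₁ × Fin b₂ → Fin b₂)))) atTop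
      (nhds hπν) := hent₂
  have hQ' : ∀ᵐ ω ∂P, ConvA X ν ω (Qν ω) := hQν
  refine ⟨UI_main Prod.snd hM1 hfin hνerg hent hent' hδ, ?_⟩
  set δ : ℝ := hν - hπν - (entropyXA P X₀).toReal with hδdef
  have hδ0 : 0 < δ := by rw [hδdef]; linarith
  let e : ℕ → ℝ := fun j => δ / 3 * (1 / ((j : ℝ) + 1))
  have he0 : ∀ j, 0 < e j := fun j => by positivity
  have he1 : ∀ j, 3 * e j ≤ δ := fun j => by
    have h1 : 1 / ((j : ℝ) + 1) ≤ 1 := by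
      rw [div_le_one (by positivity)]
      have : (0 : ℝ) ≤ j := Nat.cast_nonneg j
      linarith
    simp only [e]
    nlinarith
  have he : Tendsto e atTop (nhds 0) := by
    have := (tendsto_one_div_add_atTop_nhds_zero_nat (𝕜 := ℝ)).const_mul (δ / 3)
    simpa [e] using this
  have hall := ae_all_iff.2 fun j =>
    final_Q Prod.snd hM1 hfin hνerg hent hent' (he0 j) (he1 j) hQ'
  filter_upwards [hQ', R_zero Prod.snd hM1 hfin hνerg hent hent' hδ, hall] with ω h1 h2 h3 _
  refine ⟨AC_pt Prod.snd h1 h2, ?_⟩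
  filter_upwards [ae_all_iff.2 h3] with z hz
  have hlim := dim_limit hb₂ hb (fun j => (he0 j).le) he hz
  have heq : (hν - (entropyXA P X₀).toReal) / Real.log b₁ +
      (1 / Real.log b₂ - 1 / Real.log b₁) * hπν = δ / Real.log b₁ + hπν / Real.log b₂ := by
    rw [hδdef]; ring
  rw [heq]
  exact hlim

end
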